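/- There exist a piecewise linear continuous unimodal function g of the form (DG) satisfying hypotheses (UM) and (FC), and positive numbers h and c_* < c^*, such that: (a) for each c ≥ c_* the profile equation φ''(t) − cφ'(t) − φ(t) + g(φ(t − ch)) = 0 has a unique (up to translation) wavefront profile with speed c, and it has no wavefront profile with speed c < c_*; (b) for each c ∈ [c_*, c^*] the wavefront profile is non-monotone on ℝ but eventually monotone; (c) for each c > c^* the wavefront profile slowly oscillates about κ. -/

import Mathlib

open Real Filter Set Topology

noncomputable section

/-- Characteristic function `z² − cz − 1 + k·e^{−zch}` (real version). -/
def chi (k c h : ℝ) : ℝ → ℝ := fun z => z ^ 2 - c * z - 1 + k * Real.exp (-(z * c * h))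

/-- Hypothesis (UM): `g : [0,∞) → [0,∞)` is continuous, has exactly one positive local
extremum point `θ` which is a global maximum point, has exactly two fixed points `0` and
`κ > 0`, is differentiable at `0` and at `κ` with `g'(0) = g₀ > 1` and `g'(κ) = gκ < 1`,
`g(x) > x` on `(0,κ)` and `g(x) < x` for `x > κ`. -/
structure UMHyp (g : ℝ → ℝ) (θ κ g₀ gκ : ℝ) : Prop where
  cont : ContinuousOn g (Ici 0)
  nonneg : ∀ x ∈ Ici (0:ℝ), 0 ≤ g x
  theta_pos : 0 < θ
  kappa_pos : 0 < κ
  unique_ext : ∀ x : ℝ, 0 < x → ((IsLocalMax g x ∨ IsLocalMin g x) ↔ x = θ)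
  global_max : ∀ x ∈ Ici (0:ℝ), g x ≤ g θ
  fixed_pts : ∀ x ∈ Ici (0:ℝ), (g x = x ↔ x = 0 ∨ x = κ)
  deriv0 : HasDerivWithinAt g g₀ (Ici 0) 0
  derivκ : HasDerivWithinAt g gκ (Ici 0) κ
  g0_gt_one : 1 < g₀
  gκ_lt_one : gκ < 1
  above_id : ∀ x : ℝ, 0 < x → x < κ → x < g x
  below_id : ∀ x : ℝ, κ < x → g x < x

/-- A wavefront profile with speed `c` (and delay `h`): a positive `C²` solution of
`φ'' − cφ' − φ + g(φ(· − ch)) = 0` with `φ(−∞) = 0` and `φ(+∞) = κ`. -/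
structure Wavefront (g : ℝ → ℝ) (κ c h : ℝ) (φ : ℝ → ℝ) : Prop where
  smooth : ContDiff ℝ 2 φ
  pos : ∀ t, 0 < φ t
  eqn : ∀ t, deriv (deriv φ) t - c * deriv φ t - φ t + g (φ (t - c * h)) = 0
  lim_bot : Tendsto φ atBot (𝓝 0)
  lim_top : Tendsto φ atTop (𝓝 κ)

/-- The set `𝕂 = [−ch, 0] ∪ {1}`. -/
def sigK (c h : ℝ) : Set ℝ := Icc (-(c * h)) 0 ∪ {1}

/-- `scGe c h v k` : the function `v` has at least `k` sign changes on `𝕂`. -/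
def scGe (c h : ℝ) (v : ℝ → ℝ) (k : ℕ) : Prop :=
  ∃ t : Fin (k + 1) → ℝ, StrictMono t ∧ (∀ i, t i ∈ sigK c h) ∧
    ∀ i : Fin k, v (t i.castSucc) * v (t i.succ) < 0

/-- The function `φ̄_t : 𝕂 → ℝ`, `φ̄_t(s) = φ(t+s) − κ` for `s ∈ [−ch,0]`, `φ̄_t(1) = φ'(t)`. -/
def phibar (φ : ℝ → ℝ) (κ t : ℝ) : ℝ → ℝ :=
  fun s => if s = 1 then deriv φ t else φ (t + s) - κ

/-- `φ` slowly oscillates about `κ`: `φ − κ` has zeros in every neighbourhood of `+∞`, is not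
eventually of one sign, and `sc(φ̄_t) ∈ {1,2}` for all large `t`. -/
def SlowlyOscillating (φ : ℝ → ℝ) (κ c h : ℝ) : Prop :=
  (∀ T : ℝ, ∃ t ≥ T, φ t = κ) ∧
  (∀ T : ℝ, ∃ t ≥ T, κ < φ t) ∧
  (∀ T : ℝ, ∃ t ≥ T, φ t < κ) ∧
  ∃ a : ℝ, ∀ t ≥ a, scGe c h (phibar φ κ t) 1 ∧ ¬ scGe c h (phibar φ κ t) 3

/-- `φ` is eventually monotone: monotone on some interval `[T, +∞)`. -/
def EvMonotone (φ : ℝ → ℝ) : Prop :=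
  ∃ T : ℝ, MonotoneOn φ (Ici T) ∨ AntitoneOn φ (Ici T)

/-- Hypothesis (FC): `(g(x) − κ)(x − κ) < 0` on `[g²(θ), g(θ)] \ {κ}`. -/
def FCHyp (g : ℝ → ℝ) (θ κ : ℝ) : Prop :=
  ∀ x ∈ Icc (g (g θ)) (g θ), x ≠ κ → (g x - κ) * (x - κ) < 0

/-- The piecewise linear birth function (DG). -/
def DGHyp (g : ℝ → ℝ) (k₁ k₂ k₃ θ θ₁ q₂ q₃ κ : ℝ) : Prop :=
  0 < θ ∧ θ < θ₁ ∧ θ₁ < κ ∧ κ < g θ ∧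
  k₂ < k₃ ∧ k₃ < 0 ∧ 1 < k₁ ∧
  (∀ x : ℝ, 0 ≤ x → x ≤ θ → g x = k₁ * x) ∧
  (∀ x : ℝ, θ ≤ x → x ≤ θ₁ → g x = k₂ * x + q₂) ∧
  (∀ x : ℝ, θ₁ < x → x ≤ g θ → g x = k₃ * x + q₃) ∧
  k₂ * θ₁ + q₂ = k₃ * θ₁ + q₃

/-- `χ` has exactly two positive real zeros `0 < μ₂ ≤ μ₁` counted with multiplicity. -/
def TwoPosZeros (χ : ℝ → ℝ) (μ₂ μ₁ : ℝ) : Prop :=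
  0 < μ₂ ∧ μ₂ ≤ μ₁ ∧ χ μ₂ = 0 ∧ χ μ₁ = 0 ∧
  (∀ x : ℝ, 0 < x → χ x = 0 → x = μ₂ ∨ x = μ₁) ∧
  (μ₂ = μ₁ → deriv χ μ₁ = 0) ∧
  (μ₂ < μ₁ → deriv χ μ₂ ≠ 0 ∧ deriv χ μ₁ ≠ 0)

/-- `χ` has exactly two negative real zeros `l₂ ≤ l₁ < 0` counted with multiplicity. -/
def TwoNegZeros (χ : ℝ → ℝ) (l₂ l₁ : ℝ) : Prop :=
  l₂ ≤ l₁ ∧ l₁ < 0 ∧ χ l₂ = 0 ∧ χ l₁ = 0 ∧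
  (∀ x : ℝ, x < 0 → χ x = 0 → x = l₂ ∨ x = l₁) ∧
  (l₂ = l₁ → deriv χ l₁ = 0) ∧
  (l₂ < l₁ → deriv χ l₂ ≠ 0 ∧ deriv χ l₁ ≠ 0)

/-- `(h,c) ∈ D_L`. -/
def DLmem (g₀ gκ c h : ℝ) : Prop :=
  ∃ μ₂ μ₁ l₂ l₁ : ℝ, TwoPosZeros (chi g₀ c h) μ₂ μ₁ ∧ TwoNegZeros (chi gκ c h) l₂ l₁

/-- A function with nonnegative derivative on `[a, b]` satisfies `f a ≤ f b`. -/
theorem le_of_hasDerivAt_nonneg {f f' : ℝ → ℝ} {a b : ℝ} (hab : a ≤ b)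
    (hf : ∀ t ∈ Icc a b, HasDerivAt f (f' t) t) (h : ∀ t ∈ Icc a b, 0 ≤ f' t) : f a ≤ f b := by
  have hm : MonotoneOn f (Icc a b) := by
    apply monotoneOn_of_deriv_nonneg (convex_Icc a b)
    · exact fun t ht => (hf t ht).continuousAt.continuousWithinAt
    · exact fun t ht => (hf t (interior_subset ht)).differentiableAt.differentiableWithinAt
    · intro t ht
      rw [(hf t (interior_subset ht)).deriv]
      exact h t (interior_subset ht)
  exact hm (left_mem_Icc.2 hab) (right_mem_Icc.2 hab) hab

/-- A derivative bound from below by `m` gives linear growth. -/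
theorem add_mul_le_of_hasDerivAt {f f' : ℝ → ℝ} {a b m : ℝ} (hab : a ≤ b)
    (hf : ∀ t ∈ Icc a b, HasDerivAt f (f' t) t) (h : ∀ t ∈ Icc a b, m ≤ f' t) :
    f a + m * (b - a) ≤ f b := by
  have := le_of_hasDerivAt_nonneg (f := fun t => f t - m * t) (f' := fun t => f' t - m) hab
    (fun t ht => by simpa using (hf t ht).fun_sub ((hasDerivAt_id t).const_mul m))
    (fun t ht => by linarith [h t ht])
  linarith

/-- Derivative of `t ↦ w t * exp (-(β * t))`. -/
theorem hasDerivAt_mul_exp_neg {w : ℝ → ℝ} {w' β t : ℝ} (hw : HasDerivAt w w' t) :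
    HasDerivAt (fun s => w s * exp (-(β * s))) ((w' - β * w t) * exp (-(β * t))) t := by
  have h1 : HasDerivAt (fun s : ℝ => exp (-(β * s))) (exp (-(β * t)) * (-β)) t := by
    have : HasDerivAt (fun s : ℝ => -(β * s)) (-β) t := by
      simpa using ((hasDerivAt_id t).const_mul β).fun_neg
    exact this.exp
  exact (hw.fun_mul h1).congr_deriv (by ring)

/-- Differential inequality `w' ≥ β w` integrated. -/
theorem mul_exp_le_of_hasDerivAt {w w' : ℝ → ℝ} {a b β : ℝ} (hab : a ≤ b)
    (hw : ∀ t ∈ Icc a b, HasDerivAt w (w' t) t) (h : ∀ t ∈ Icc a b, β * w t ≤ w' t) :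
    w a * exp (β * (b - a)) ≤ w b := by
  have := le_of_hasDerivAt_nonneg (f := fun s => w s * exp (-(β * s))) hab
    (fun t ht => hasDerivAt_mul_exp_neg (hw t ht))
    (fun t ht => mul_nonneg (by linarith [h t ht]) (exp_pos _).le)
  have h2 := mul_le_mul_of_nonneg_right this (exp_pos (β * b)).le
  rw [mul_assoc, mul_assoc, ← exp_add, ← exp_add] at h2
  have e1 : -(β * a) + β * b = β * (b - a) := by ring
  have e2 : -(β * b) + β * b = 0 := by ring
  rwa [e1, e2, exp_zero, mul_one] at h2

/-- The negative root of `z² - c z - P`. -/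
def negRoot (c P : ℝ) : ℝ := (c - √(c ^ 2 + 4 * P)) / 2

theorem negRoot_sq {c P : ℝ} (hP : 0 ≤ P) :
    negRoot c P ^ 2 - c * negRoot c P - P = 0 := by
  have := Real.sq_sqrt (show 0 ≤ c ^ 2 + 4 * P by positivity)
  unfold negRoot
  linarith

theorem negRoot_nonpos {c P : ℝ} (hP : 0 ≤ P) : negRoot c P ≤ 0 := by
  have : c ≤ √(c ^ 2 + 4 * P) := Real.le_sqrt_of_sq_le (by linarith)
  unfold negRoot
  linarith

theorem negRoot_neg {c P : ℝ} (hP : 0 < P) : negRoot c P < 0 := by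
  refine lt_of_le_of_ne (negRoot_nonpos hP.le) fun h => ?_
  have := negRoot_sq (c := c) hP.le
  rw [h] at this
  linarith

/-- Forward invariance of the positive quadrant for `u'' ≥ a u' + P u`. -/
theorem forward_nonneg {u u₁ u₂ : ℝ → ℝ} {a P X Y : ℝ} (hP : 0 ≤ P)
    (h1 : ∀ t ∈ Icc X Y, HasDerivAt u (u₁ t) t) (h2 : ∀ t ∈ Icc X Y, HasDerivAt u₁ (u₂ t) t)
    (h : ∀ t ∈ Icc X Y, a * u₁ t + P * u t ≤ u₂ t) (hu : 0 ≤ u X) (hu1 : 0 ≤ u₁ X) :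
    ∀ t ∈ Icc X Y, 0 ≤ u t ∧ 0 ≤ u₁ t := by
  have hα := negRoot_sq (c := a) hP
  have hα0 := negRoot_nonpos (c := a) hP
  set α := negRoot a P
  have hw : ∀ t ∈ Icc X Y, 0 ≤ u₁ t - α * u t := by
    intro t ht
    have := mul_exp_le_of_hasDerivAt (w := fun t => u₁ t - α * u t)
      (w' := fun t => u₂ t - α * u₁ t) (β := a - α) ht.1
      (fun s hs => (h2 s ⟨hs.1, hs.2.trans ht.2⟩).sub ((h1 s ⟨hs.1, hs.2.trans ht.2⟩).const_mul α))
      (fun s hs => by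
        have := h s ⟨hs.1, hs.2.trans ht.2⟩
        have e : (a - α) * (u₁ s - α * u s) = a * u₁ s + P * u s - α * u₁ s := by
          linear_combination (u s) * hα
        rw [e]; linarith)
    refine le_trans (mul_nonneg ?_ (exp_pos _).le) this
    have := mul_nonneg (neg_nonneg.2 hα0) hu
    linarith
  have hu' : ∀ t ∈ Icc X Y, 0 ≤ u t := by
    intro t ht
    refine le_trans (mul_nonneg hu (exp_pos _).le) (mul_exp_le_of_hasDerivAt (β := α) ht.1
      (fun s hs => h1 s ⟨hs.1, hs.2.trans ht.2⟩) fun s hs => ?_)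
    linarith [hw s ⟨hs.1, hs.2.trans ht.2⟩]
  intro t ht
  refine ⟨hu' t ht, le_trans (mul_nonneg hu1 (exp_pos _).le) (mul_exp_le_of_hasDerivAt (β := a) ht.1
      (fun s hs => h2 s ⟨hs.1, hs.2.trans ht.2⟩) fun s hs => ?_)⟩
  have hs' : s ∈ Icc X Y := ⟨hs.1, hs.2.trans ht.2⟩
  have := mul_nonneg hP (hu' s hs')
  linarith [h s hs']

/-- A solution of `u'' ≥ c u' + u` on a half-line that is bounded above satisfies `u' ≤ α u`. -/
theorem deriv_le_of_bounded {u u₁ u₂ : ℝ → ℝ} {c a C : ℝ}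
    (h1 : ∀ t ≥ a, HasDerivAt u (u₁ t) t) (h2 : ∀ t ≥ a, HasDerivAt u₁ (u₂ t) t)
    (h : ∀ t ≥ a, c * u₁ t + u t ≤ u₂ t) (hC : ∀ t ≥ a, u t ≤ C) :
    ∀ t ≥ a, u₁ t ≤ negRoot c 1 * u t := by
  have hα := negRoot_sq (c := c) zero_le_one
  have hα0 := negRoot_neg (c := c) zero_lt_one
  set α := negRoot c 1
  intro t₀ ht₀
  by_contra hcon
  push Not at hcon
  set W := u₁ t₀ - α * u t₀ with hW
  have hWpos : 0 < W := by linarith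
  set β := c - α with hβ
  have hβpos : 0 < β := by
    have : α * β = -1 := by rw [hβ]; linarith
    by_contra hb
    push Not at hb
    nlinarith
  have hw : ∀ t ≥ t₀, W * exp (β * (t - t₀)) ≤ u₁ t - α * u t := by
    intro t ht
    exact mul_exp_le_of_hasDerivAt (w := fun t => u₁ t - α * u t)
      (w' := fun t => u₂ t - α * u₁ t) (β := β) ht
      (fun s hs => (h2 s (ht₀.trans hs.1)).sub ((h1 s (ht₀.trans hs.1)).const_mul α))
      (fun s hs => by
        have := h s (ht₀.trans hs.1)
        have e : β * (u₁ s - α * u s) = c * u₁ s + u s - α * u₁ s := by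
          rw [hβ]; linear_combination (u s) * hα
        rw [e]; linarith)
  set t₁ := t₀ + (|1 - α * C|) / (W * β) with ht₁
  have ht₁₀ : t₀ ≤ t₁ := by
    have : 0 ≤ (|1 - α * C|) / (W * β) := by positivity
    linarith
  have hder : ∀ t ≥ t₁, 1 ≤ u₁ t := by
    intro t ht
    have h3 := hw t (ht₁₀.trans ht)
    have h4 : 1 - α * C ≤ W * exp (β * (t - t₀)) := by
      have h5 : β * (t - t₀) ≤ exp (β * (t - t₀)) := by linarith [add_one_le_exp (β * (t - t₀))]
      have h6 : |1 - α * C| ≤ W * (β * (t - t₀)) := by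
        have : (|1 - α * C|) / (W * β) ≤ t - t₀ := by linarith
        rw [div_le_iff₀ (by positivity)] at this
        linarith
      exact (le_abs_self _).trans (h6.trans (mul_le_mul_of_nonneg_left h5 hWpos.le))
    have h7 := hC t (ht₀.trans (ht₁₀.trans ht))
    have h8 : α * C ≤ α * u t := mul_le_mul_of_nonpos_left h7 hα0.le
    linarith
  have hb : t₁ ≤ t₁ + (|C - u t₁| + 1) := by linarith [abs_nonneg (C - u t₁)]
  have h9 := add_mul_le_of_hasDerivAt (m := 1) hb
    (fun t ht => h1 t (ht₀.trans (ht₁₀.trans ht.1))) (fun t ht => hder t ht.1)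
  have h10 := hC (t₁ + (|C - u t₁| + 1)) (ht₀.trans (ht₁₀.trans hb))
  linarith [le_abs_self (C - u t₁)]

/-- A solution of `u'' ≥ c u' + u` on a half-line that is bounded above decays. -/
theorem le_mul_exp_of_bounded {u u₁ u₂ : ℝ → ℝ} {c a C : ℝ}
    (h1 : ∀ t ≥ a, HasDerivAt u (u₁ t) t) (h2 : ∀ t ≥ a, HasDerivAt u₁ (u₂ t) t)
    (h : ∀ t ≥ a, c * u₁ t + u t ≤ u₂ t) (hC : ∀ t ≥ a, u t ≤ C) :
    ∀ t ≥ a, u t ≤ u a * exp (negRoot c 1 * (t - a)) := by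
  intro t ht
  have := mul_exp_le_of_hasDerivAt (w := fun t => -u t) (w' := fun t => -u₁ t)
    (β := negRoot c 1) ht (fun s hs => (h1 s hs.1).neg)
    (fun s hs => by linarith [deriv_le_of_bounded h1 h2 h hC s hs.1])
  linarith

/-- The features of the birth function used in the analysis. -/
structure BirthProps (g : ℝ → ℝ) (k p Q κ θ₁ : ℝ) : Prop where
  cont : Continuous g
  zero : ∀ x ≤ 0, g x = 0
  lin : ∀ x, 0 ≤ x → x ≤ 1 → g x = k * x
  mid : ∀ x, 1 ≤ x → x ≤ θ₁ → Q - p * x ≤ g x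
  right : ∀ x, θ₁ ≤ x → x ≤ k → g x = Q - p * x
  le_k : ∀ x, g x ≤ k
  pos : ∀ x, 0 < x → 0 < g x
  slope : ∀ x y, y ≤ x → g x - g y ≤ k * (x - y)
  fixed : κ * (1 + p) = Q
  one_lt : 1 < θ₁
  lt_kappa : θ₁ < κ
  kappa_lt : κ < k
  lt_min : θ₁ < Q - p * k
  p_pos : 0 < p
  p_lt : p < 1

namespace BirthProps
variable {g : ℝ → ℝ} {k p Q κ θ₁ : ℝ}

theorem nonneg (B : BirthProps g k p Q κ θ₁) (x : ℝ) : 0 ≤ g x := by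
  rcases le_or_gt x 0 with h | h
  · exact (B.zero x h).ge
  · exact (B.pos x h).le

theorem one_lt_k (B : BirthProps g k p Q κ θ₁) : 1 < k :=
  B.one_lt.trans (B.lt_kappa.trans B.kappa_lt)

theorem right_ge (B : BirthProps g k p Q κ θ₁) {x : ℝ} (h1 : 1 ≤ x) (h2 : x ≤ k) :
    Q - p * x ≤ g x := by
  rcases le_total x θ₁ with h | h
  · exact B.mid x h1 h
  · exact (B.right x h h2).ge

theorem min_le (B : BirthProps g k p Q κ θ₁) {x : ℝ} (h1 : 1 ≤ x) (h2 : x ≤ k) :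
    Q - p * k ≤ g x := by
  have := mul_le_mul_of_nonneg_left h2 B.p_pos.le
  linarith [B.right_ge h1 h2]

end BirthProps

/-- A global solution of the profile equation with derivative `φ₁`. -/
structure Profile (g : ℝ → ℝ) (c τ : ℝ) (φ φ₁ : ℝ → ℝ) : Prop where
  d1 : ∀ t, HasDerivAt φ (φ₁ t) t
  d2 : ∀ t, HasDerivAt φ₁ (c * φ₁ t + φ t - g (φ (t - τ))) t

/-- A positive profile joining `0` to `κ`. -/
structure Front (g : ℝ → ℝ) (κ c τ : ℝ) (φ φ₁ : ℝ → ℝ) : Prop extends Profile g c τ φ φ₁ where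
  pos : ∀ t, 0 < φ t
  bot : Tendsto φ atBot (𝓝 0)
  top : Tendsto φ atTop (𝓝 κ)

theorem Profile.continuous {g : ℝ → ℝ} {c τ : ℝ} {φ φ₁ : ℝ → ℝ} (F : Profile g c τ φ φ₁) :
    Continuous φ := continuous_iff_continuousAt.2 fun t => (F.d1 t).continuousAt

theorem Profile.continuous₁ {g : ℝ → ℝ} {c τ : ℝ} {φ φ₁ : ℝ → ℝ} (F : Profile g c τ φ φ₁) :
    Continuous φ₁ := continuous_iff_continuousAt.2 fun t => (F.d2 t).continuousAt

namespace Front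
variable {g : ℝ → ℝ} {k p Q κ θ₁ c τ : ℝ} {φ φ₁ : ℝ → ℝ}

theorem bddAbove (F : Front g κ c τ φ φ₁) : ∃ C, ∀ t, φ t ≤ C := by
  obtain ⟨T, hT⟩ := eventually_atTop.1 (F.top.eventually (ge_mem_nhds (lt_add_one κ)))
  obtain ⟨S, hS⟩ := eventually_atBot.1 (F.bot.eventually (ge_mem_nhds zero_lt_one))
  obtain ⟨D, hD⟩ := (isCompact_Icc (a := S) (b := T)).bddAbove_image F.continuous.continuousOn
  refine ⟨max (κ + 1) (max 1 D), fun t => ?_⟩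
  rcases le_total T t with h | h
  · exact (hT t h).trans (le_max_left _ _)
  rcases le_total t S with h' | h'
  · exact (hS t h').trans ((le_max_left _ _).trans (le_max_right _ _))
  · exact (hD ⟨t, ⟨h', h⟩, rfl⟩).trans ((le_max_right _ _).trans (le_max_right _ _))

theorem deriv_le (F : Front g κ c τ φ φ₁) (B : BirthProps g k p Q κ θ₁) (t : ℝ) :
    φ₁ t ≤ negRoot c 1 * (φ t - k) := by
  obtain ⟨C, hC⟩ := F.bddAbove
  exact deriv_le_of_bounded (u := fun t => φ t - k) (C := C - k) (a := t)
    (fun t _ => (F.d1 t).sub_const k) (fun t _ => F.d2 t)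
    (fun t _ => by linarith [B.le_k (φ (t - τ))]) (fun t _ => by linarith [hC t]) t le_rfl

theorem le_k (F : Front g κ c τ φ φ₁) (B : BirthProps g k p Q κ θ₁) (t : ℝ) : φ t ≤ k := by
  obtain ⟨C, hC⟩ := F.bddAbove
  obtain ⟨S, hS⟩ := eventually_atBot.1 (F.bot.eventually (ge_mem_nhds zero_lt_one))
  have := le_mul_exp_of_bounded (u := fun t => φ t - k) (C := C - k) (a := min S t)
    (fun t _ => (F.d1 t).sub_const k) (fun t _ => F.d2 t)
    (fun t _ => by linarith [B.le_k (φ (t - τ))]) (fun t _ => by linarith [hC t]) t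
    (min_le_right _ _)
  have h1 := hS (min S t) (min_le_left _ _)
  have h2 : (φ (min S t) - k) * exp (negRoot c 1 * (t - min S t)) ≤ 0 :=
    mul_nonpos_of_nonpos_of_nonneg (by linarith [B.one_lt_k]) (exp_pos _).le
  linarith

theorem le_deriv (F : Front g κ c τ φ φ₁) (B : BirthProps g k p Q κ θ₁) (t : ℝ) :
    negRoot c 1 * φ t ≤ φ₁ t := by
  have := deriv_le_of_bounded (u := fun t => -φ t) (u₁ := fun t => - φ₁ t)
    (u₂ := fun t => -(c * φ₁ t + φ t - g (φ (t - τ)))) (C := 0) (a := t) (c := c)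
    (fun t _ => (F.d1 t).fun_neg) (fun t _ => (F.d2 t).fun_neg)
    (fun t _ => by linarith [B.nonneg (φ (t - τ))]) (fun t _ => by linarith [F.pos t]) t le_rfl
  linarith

theorem exists_linear (F : Front g κ c τ φ φ₁) : ∃ T, ∀ t ≤ T, φ t ≤ 1 :=
  eventually_atBot.1 (F.bot.eventually (ge_mem_nhds zero_lt_one))

theorem deriv_le_posRoot (F : Front g κ c τ φ φ₁) (B : BirthProps g k p Q κ θ₁) (t : ℝ) :
    φ₁ t ≤ (c - negRoot c 1) * φ t := by
  have hα := negRoot_sq (c := c) zero_le_one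
  have hα0 := negRoot_neg (c := c) zero_lt_one
  set α := negRoot c 1
  have hβ : 0 < c - α := by
    by_contra hb
    push Not at hb
    nlinarith
  by_contra hcon
  push Not at hcon
  set m := φ₁ t - (c - α) * φ t with hm
  have hm0 : 0 < m := by linarith
  have hw : ∀ s ≤ t, m ≤ φ₁ s := by
    intro s hs
    have := mul_exp_le_of_hasDerivAt (w := fun t => -(φ₁ t - (c - α) * φ t))
      (w' := fun t => -(c * φ₁ t + φ t - g (φ (t - τ)) - (c - α) * φ₁ t)) (β := α) hs
      (fun r _ => ((F.d2 r).fun_sub ((F.d1 r).const_mul (c - α))).fun_neg)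
      (fun r _ => by
        have e : α * -(φ₁ r - (c - α) * φ r) = -(α * φ₁ r + φ r) := by
          linear_combination -(φ r) * hα
        rw [e]; linarith [B.nonneg (φ (r - τ))])
    have h2 : exp (α * (t - s)) ≤ 1 := exp_le_one_iff.2
      (mul_nonpos_of_nonpos_of_nonneg hα0.le (by linarith))
    have h3 := mul_pos hβ (F.pos s)
    have h4 := exp_pos (α * (t - s))
    nlinarith
  have h5 := add_mul_le_of_hasDerivAt (m := m) (a := t - φ t / m) (b := t)
    (by have := div_pos (F.pos t) hm0; linarith) (fun s _ => F.d1 s) (fun s hs => hw s hs.2)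
  have h6 : m * (t - (t - φ t / m)) = φ t := by field_simp; ring
  linarith [F.pos (t - φ t / m)]

/-- If `φ' ≤ λ φ` and the characteristic function is positive at `λ`, then `λ` can be lowered. -/
theorem lower_rate (F : Front g κ c τ φ φ₁) (hτ : 0 < τ) (hk : 0 < k) {T lam : ℝ}
    (hlin : ∀ t ≤ T, g (φ (t - τ)) = k * φ (t - τ)) (h : ∀ t ≤ T, φ₁ t ≤ lam * φ t)
    (hδ : 0 < lam ^ 2 - c * lam - 1 + k * exp (-(lam * τ))) :
    ∃ η > 0, ∀ t ≤ T, φ₁ t ≤ (lam - η) * φ t := by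
  set δ := lam ^ 2 - c * lam - 1 + k * exp (-(lam * τ)) with hδd
  set η := δ / (2 * (|c - 2 * lam| + 1)) with hη
  have hA : 0 < |c - 2 * lam| + 1 := by positivity
  have hη0 : 0 < η := by positivity
  have hηA : η * (|c - 2 * lam| + 1) = δ / 2 := by rw [hη]; field_simp
  refine ⟨η, hη0, fun t₀ ht₀ => ?_⟩
  by_contra hcon
  push Not at hcon
  have hdelay : ∀ t ≤ T, φ t * exp (-(lam * τ)) ≤ φ (t - τ) := by
    intro t ht
    have := mul_exp_le_of_hasDerivAt (w := fun t => -φ t) (w' := fun t => -φ₁ t) (β := lam)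
      (a := t - τ) (b := t) (by linarith) (fun s _ => (F.d1 s).fun_neg)
      (fun s hs => by linarith [h s (hs.2.trans ht)])
    have e : t - (t - τ) = τ := by ring
    rw [e] at this
    have h2 := mul_le_mul_of_nonneg_right this (exp_pos (-(lam * τ))).le
    rw [mul_assoc, ← exp_add] at h2
    simp at h2
    linarith
  set w' : ℝ → ℝ := fun t => lam * φ₁ t - (c * φ₁ t + φ t - g (φ (t - τ))) with hw'
  have hwd : ∀ t, HasDerivAt (fun t => lam * φ t - φ₁ t) (w' t) t := fun t =>
    ((F.d1 t).const_mul lam).fun_sub (F.d2 t)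
  have hwge : ∀ t ≤ T, (c - lam) * (lam * φ t - φ₁ t) + δ * φ t ≤ w' t := by
    intro t ht
    have h1 := mul_le_mul_of_nonneg_left (hdelay t ht) hk.le
    simp only [hw', hlin t ht, hδd]
    nlinarith
  have hq : ∀ t ≤ t₀, lam * φ t - φ₁ t < η * φ t := by
    intro t ht
    have := mul_exp_le_of_hasDerivAt (w := fun t => lam * φ t - φ₁ t - η * φ t)
      (w' := fun t => w' t - η * φ₁ t) (β := c - lam + η) ht
      (fun s _ => (hwd s).fun_sub ((F.d1 s).const_mul η))
      (fun s hs => by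
        have h1 := hwge s (hs.2.trans ht₀)
        have h2 : 0 ≤ (δ + η * (c - 2 * lam + η)) * φ s := by
          refine mul_nonneg ?_ (F.pos s).le
          have := neg_abs_le (c - 2 * lam)
          nlinarith
        nlinarith)
    have h3 : lam * φ t₀ - φ₁ t₀ - η * φ t₀ < 0 := by linarith
    by_contra hc
    push Not at hc
    have : 0 ≤ (lam * φ t - φ₁ t - η * φ t) * exp ((c - lam + η) * (t₀ - t)) :=
      mul_nonneg (by linarith) (exp_pos _).le
    linarith
  have hρd : ∀ t, HasDerivAt (fun t => (lam * φ t - φ₁ t) / φ t)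
      ((w' t * φ t - (lam * φ t - φ₁ t) * φ₁ t) / φ t ^ 2) t := fun t =>
    (hwd t).fun_div (F.d1 t) (F.pos t).ne'
  have hρ : ∀ t ≤ t₀, δ / 2 ≤ (w' t * φ t - (lam * φ t - φ₁ t) * φ₁ t) / φ t ^ 2 := by
    intro t ht
    have hp := F.pos t
    rw [le_div_iff₀ (by positivity)]
    have h1 := hwge t (ht.trans ht₀)
    have h2 := hq t ht
    have h3 : 0 ≤ lam * φ t - φ₁ t := by linarith [h t (ht.trans ht₀)]
    set w := lam * φ t - φ₁ t
    have e : φ₁ t = lam * φ t - w := by simp [w]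
    rw [e]
    have h4 := mul_le_mul_of_nonneg_right h1 hp.le
    have h5 : -(|c - 2 * lam| * (η * φ t)) ≤ (c - 2 * lam) * w := by
      have := neg_abs_le (c - 2 * lam)
      have h6 := abs_nonneg (c - 2 * lam)
      nlinarith
    nlinarith [mul_le_mul_of_nonneg_right h5 hp.le, mul_pos hp hp, mul_pos hη0 (mul_pos hp hp)]
  have hfin := add_mul_le_of_hasDerivAt (m := δ / 2) (a := t₀ - 2 * η / δ) (b := t₀)
    (by have : 0 < 2 * η / δ := by positivity
        linarith) (fun s _ => hρd s) (fun s hs => hρ s hs.2)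
  have e1 : δ / 2 * (t₀ - (t₀ - 2 * η / δ)) = η := by field_simp; ring
  have h7 : (lam * φ t₀ - φ₁ t₀) / φ t₀ < η := by
    rw [div_lt_iff₀ (F.pos t₀)]; exact hq t₀ le_rfl
  have h8 : 0 ≤ (lam * φ (t₀ - 2 * η / δ) - φ₁ (t₀ - 2 * η / δ)) / φ (t₀ - 2 * η / δ) := by
    refine div_nonneg ?_ (F.pos _).le
    have : t₀ - 2 * η / δ ≤ T := by
      have : 0 < 2 * η / δ := by positivity
      linarith
    linarith [h _ this]
  linarith

/-- The optimal exponential rate of a front makes the characteristic function nonpositive. -/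
theorem exists_rate (F : Front g κ c τ φ φ₁) (B : BirthProps g k p Q κ θ₁) (hτ : 0 < τ) {T : ℝ}
    (hlin : ∀ t ≤ T, g (φ (t - τ)) = k * φ (t - τ)) :
    ∃ lam, 0 ≤ lam ∧ lam ^ 2 - c * lam - 1 + k * exp (-(lam * τ)) ≤ 0 ∧
      ∀ t ≤ T, φ₁ t ≤ lam * φ t := by
  set S := {lam : ℝ | ∀ t ≤ T, φ₁ t ≤ lam * φ t} with hS
  have hne : S.Nonempty := ⟨c - negRoot c 1, fun t _ => F.deriv_le_posRoot B t⟩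
  have hlb : ∀ lam ∈ S, 0 ≤ lam := by
    intro lam hl
    by_contra hneg
    push Not at hneg
    have hmono : ∀ t ≤ T, φ T ≤ φ t := by
      intro t ht
      have := le_of_hasDerivAt_nonneg (f := fun s => -φ s) (f' := fun s => -φ₁ s) ht
        (fun s _ => (F.d1 s).fun_neg)
        (fun s hs => by
          have h1 := hl s hs.2
          have h2 := mul_nonpos_of_nonpos_of_nonneg hneg.le (F.pos s).le
          linarith)
      linarith
    obtain ⟨R, hR⟩ := eventually_atBot.1 (F.bot.eventually (gt_mem_nhds (F.pos T)))
    have h1 := hR (min R T) (min_le_left _ _)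
    have h2 := hmono (min R T) (min_le_right _ _)
    linarith
  have hbdd : BddBelow S := ⟨0, hlb⟩
  have hmem : sInf S ∈ S := by
    intro t ht
    rw [← div_le_iff₀ (F.pos t)]
    refine le_csInf hne fun b hb => ?_
    rw [div_le_iff₀ (F.pos t)]
    exact hb t ht
  refine ⟨sInf S, hlb _ hmem, ?_, hmem⟩
  by_contra hpos
  push Not at hpos
  obtain ⟨η, hη, h⟩ := F.lower_rate hτ (by linarith [B.one_lt_k]) hlin hmem hpos
  have := csInf_le hbdd (show sInf S - η ∈ S from h)
  linarith

end Front

theorem eq_mul_exp_of_hasDerivAt {w w' : ℝ → ℝ} {a b β : ℝ} (hab : a ≤ b)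
    (hw : ∀ t ∈ Icc a b, HasDerivAt w (w' t) t) (h : ∀ t ∈ Icc a b, w' t = β * w t) :
    w b = w a * exp (β * (b - a)) := by
  refine le_antisymm ?_ (mul_exp_le_of_hasDerivAt hab hw fun t ht => (h t ht).ge)
  have := mul_exp_le_of_hasDerivAt (w := fun t => -w t) (w' := fun t => -w' t) (β := β) hab
    (fun t ht => (hw t ht).fun_neg) (fun t ht => by rw [h t ht]; linarith)
  linarith

/-- Exponentially weighted integral over the delay window. -/
def expWindow (z τ : ℝ) (u : ℝ → ℝ) (t : ℝ) : ℝ := ∫ s in (t - τ)..t, exp (z * (t - τ - s)) * u s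

theorem hasDerivAt_window {f : ℝ → ℝ} (hf : Continuous f) (τ t : ℝ) :
    HasDerivAt (fun t => ∫ s in (t - τ)..t, f s) (f t - f (t - τ)) t := by
  have h0 : ∀ t, HasDerivAt (fun t => ∫ s in (0:ℝ)..t, f s) (f t) t := fun t =>
    intervalIntegral.integral_hasDerivAt_right (hf.intervalIntegrable _ _)
      (hf.stronglyMeasurableAtFilter _ _) hf.continuousAt
  have e : (fun t => ∫ s in (t - τ)..t, f s) =
      fun t => (∫ s in (0:ℝ)..t, f s) - ∫ s in (0:ℝ)..(t - τ), f s := by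
    funext t
    exact (intervalIntegral.integral_interval_sub_left (hf.intervalIntegrable _ _)
      (hf.intervalIntegrable _ _)).symm
  rw [e]
  exact (h0 t).fun_sub (by simpa using (h0 (t - τ)).comp_sub_const t τ)

theorem expWindow_eq (z τ : ℝ) (u : ℝ → ℝ) (t : ℝ) :
    expWindow z τ u t = exp (z * (t - τ)) * ∫ s in (t - τ)..t, exp (-(z * s)) * u s := by
  rw [expWindow, ← intervalIntegral.integral_const_mul]
  congr 1
  funext s
  rw [← mul_assoc, ← exp_add]
  congr 2
  ring

theorem hasDerivAt_expWindow {u : ℝ → ℝ} (hu : Continuous u) (z τ t : ℝ) :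
    HasDerivAt (expWindow z τ u)
      (z * expWindow z τ u t + exp (-(z * τ)) * u t - u (t - τ)) t := by
  have e : expWindow z τ u = fun t => exp (z * (t - τ)) *
      ∫ s in (t - τ)..t, exp (-(z * s)) * u s := funext fun t => expWindow_eq z τ u t
  have h1 : HasDerivAt (fun t : ℝ => exp (z * (t - τ))) (exp (z * (t - τ)) * z) t := by
    have : HasDerivAt (fun t : ℝ => z * (t - τ)) z t := by
      simpa using ((hasDerivAt_id t).sub_const τ).const_mul z
    exact this.exp
  have h2 := hasDerivAt_window (f := fun s => exp (-(z * s)) * u s) (by fun_prop) τ t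
  rw [e]
  refine (h1.fun_mul h2).congr_deriv ?_
  have e1 : exp (-(z * τ)) = exp (z * (t - τ)) * exp (-(z * t)) := by
    rw [← exp_add]; congr 1; ring
  have e2 : exp (z * (t - τ)) * exp (-(z * (t - τ))) = 1 := by
    rw [← exp_add]; simp
  rw [e1]
  linear_combination (-u (t - τ)) * e2

theorem expWindow_mono {u v : ℝ → ℝ} (hu : Continuous u) (hv : Continuous v) {z τ t : ℝ}
    (hτ : 0 ≤ τ) (h : ∀ s ∈ Icc (t - τ) t, u s ≤ v s) :
    expWindow z τ u t ≤ expWindow z τ v t := by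
  refine intervalIntegral.integral_mono_on (by linarith)
    (Continuous.intervalIntegrable (by fun_prop) _ _)
    (Continuous.intervalIntegrable (by fun_prop) _ _) fun s hs => ?_
  exact mul_le_mul_of_nonneg_left (h s hs) (exp_pos _).le

theorem expWindow_congr {u v : ℝ → ℝ} {z τ t : ℝ}
    (hτ : 0 ≤ τ) (h : ∀ s ∈ Icc (t - τ) t, u s = v s) :
    expWindow z τ u t = expWindow z τ v t := by
  refine intervalIntegral.integral_congr fun s hs => ?_
  rw [uIcc_of_le (by linarith)] at hs
  simp only [h s hs]

theorem expWindow_nonneg {u : ℝ → ℝ} {z τ t : ℝ}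
    (hτ : 0 ≤ τ) (h : ∀ s ∈ Icc (t - τ) t, 0 ≤ u s) : 0 ≤ expWindow z τ u t := by
  refine intervalIntegral.integral_nonneg (by linarith) fun s hs => ?_
  exact mul_nonneg (exp_pos _).le (h s hs)

theorem expWindow_const_mul (z τ a : ℝ) (u : ℝ → ℝ) (t : ℝ) :
    expWindow z τ (fun s => a * u s) t = a * expWindow z τ u t := by
  rw [expWindow, expWindow, ← intervalIntegral.integral_const_mul]
  congr 1
  funext s
  ring

theorem expWindow_add {u v : ℝ → ℝ} (hu : Continuous u) (hv : Continuous v) (z τ t : ℝ) :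
    expWindow z τ (fun s => u s + v s) t = expWindow z τ u t + expWindow z τ v t := by
  rw [expWindow, expWindow, expWindow, ← intervalIntegral.integral_add
    (Continuous.intervalIntegrable (by fun_prop) _ _)
    (Continuous.intervalIntegrable (by fun_prop) _ _)]
  congr 1
  funext s
  ring

theorem expWindow_shift (z τ a : ℝ) (u : ℝ → ℝ) (t : ℝ) :
    expWindow z τ (fun s => u (s - a)) t = expWindow z τ u (t - a) := by
  have := intervalIntegral.integral_comp_sub_right (a := t - τ) (b := t)
    (fun s => exp (z * (t - a - τ - s)) * u s) a
  rw [expWindow, expWindow, show t - a - τ = t - τ - a by ring] at *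
  rw [← this]
  congr 1
  funext s
  congr 2
  ring

/-- `u ↦ u' + (z - c) u - K ∫ …` satisfies a first-order equation when `z` is a root of the
characteristic function. -/
theorem hasDerivAt_charFunctional {u u₁ : ℝ → ℝ} {c τ K z r t : ℝ} (hu : Continuous u)
    (hz : z ^ 2 - c * z - 1 + K * exp (-(z * τ)) = 0) (h1 : HasDerivAt u (u₁ t) t)
    (h2 : HasDerivAt u₁ (c * u₁ t + u t - K * u (t - τ) - r) t) :
    HasDerivAt (fun t => u₁ t + (z - c) * u t - K * expWindow z τ u t)
      (z * (u₁ t + (z - c) * u t - K * expWindow z τ u t) - r) t := by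
  refine ((h2.fun_add (h1.const_mul (z - c))).fun_sub
    ((hasDerivAt_expWindow hu z τ t).const_mul K)).congr_deriv ?_
  linear_combination (-(u t)) * hz

/-- The two positive characteristic roots at the trivial equilibrium. -/
structure CharRoots (k c τ μ₂ μ₁ : ℝ) : Prop where
  pos : 0 < μ₂
  le : μ₂ ≤ μ₁
  root₂ : μ₂ ^ 2 - c * μ₂ - 1 + k * exp (-(μ₂ * τ)) = 0
  root₁ : μ₁ ^ 2 - c * μ₁ - 1 + k * exp (-(μ₁ * τ)) = 0
  double : μ₂ = μ₁ → k * τ * exp (-(μ₁ * τ)) = 2 * μ₁ - c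
  beyond : ∀ z, μ₁ < z → 0 < z ^ 2 - c * z - 1 + k * exp (-(z * τ))

theorem expWindow_exp {z x τ t : ℝ} (hne : x ≠ z) :
    expWindow z τ (fun s => exp (x * s)) t =
      (exp (-(z * τ)) - exp (-(x * τ))) / (x - z) * exp (x * t) := by
  have hxz : x - z ≠ 0 := sub_ne_zero.2 hne
  rw [expWindow_eq]
  have e : ∀ s, exp (-(z * s)) * exp (x * s) = exp ((x - z) * s) := fun s => by
    rw [← exp_add]; congr 1; ring
  simp only [e]
  have e2 : ∫ s in (t - τ)..t, exp ((x - z) * s) =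
      (exp ((x - z) * t) - exp ((x - z) * (t - τ))) / (x - z) := by
    rw [intervalIntegral.integral_comp_mul_left (fun s => exp s) hxz, integral_exp, smul_eq_mul]
    field_simp
  rw [e2, ← mul_div_assoc, div_mul_eq_mul_div]
  congr 1
  rw [mul_sub (exp _), sub_mul (exp _), ← exp_add, ← exp_add, ← exp_add, ← exp_add]
  congr 2 <;> ring

theorem expWindow_exp_self {z τ t : ℝ} :
    expWindow z τ (fun s => exp (z * s)) t = τ * exp (-(z * τ)) * exp (z * t) := by
  rw [expWindow_eq]
  have e : ∀ s, exp (-(z * s)) * exp (z * s) = 1 := fun s => by rw [← exp_add]; simp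
  simp only [e]
  simp only [intervalIntegral.integral_const, smul_eq_mul, mul_one]
  rw [mul_comm, mul_assoc, ← exp_add]
  congr 2 <;> ring

namespace CharRoots
variable {k c τ μ₂ μ₁ : ℝ}

theorem window₂ (R : CharRoots k c τ μ₂ μ₁) (t : ℝ) :
    k * expWindow μ₂ τ (fun s => exp (μ₁ * s)) t = (μ₁ + μ₂ - c) * exp (μ₁ * t) := by
  rcases eq_or_ne μ₂ μ₁ with h | h
  · have := R.double h
    subst h
    rw [expWindow_exp_self]
    linear_combination exp (μ₂ * t) * this
  · have h' : μ₁ - μ₂ ≠ 0 := sub_ne_zero.2 h.symm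
    rw [expWindow_exp h.symm, ← mul_assoc]
    congr 1
    rw [mul_div_assoc', div_eq_iff h']
    linear_combination R.root₂ - R.root₁

theorem window₁ (R : CharRoots k c τ μ₂ μ₁) (t : ℝ) :
    k * expWindow μ₁ τ (fun s => exp (μ₂ * s)) t = (μ₁ + μ₂ - c) * exp (μ₂ * t) := by
  rcases eq_or_ne μ₂ μ₁ with h | h
  · have := R.double h
    subst h
    rw [expWindow_exp_self]
    linear_combination exp (μ₂ * t) * this
  · have h' : μ₂ - μ₁ ≠ 0 := sub_ne_zero.2 h
    rw [expWindow_exp h, ← mul_assoc]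
    congr 1
    rw [mul_div_assoc', div_eq_iff h']
    linear_combination R.root₁ - R.root₂

end CharRoots

/-- Bounded solutions of the reduced first-order equation do not increase under the normalised
shift. -/
theorem reduced_le {u : ℝ → ℝ} {k c τ μ₂ μ₁ T C a : ℝ} (R : CharRoots k c τ μ₂ μ₁)
    (hk : 0 < k) (hτ : 0 < τ) (ha : 0 < a) (hu : Continuous u)
    (hd : ∀ t ≤ T, HasDerivAt u ((c - μ₁) * u t + k * expWindow μ₁ τ u t) t)
    (hC : ∀ t ≤ T, |u t| ≤ C * exp (μ₂ * t)) :
    ∀ t ≤ T, u t ≤ exp (μ₂ * a) * u (t - a) := by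
  set U : ℝ → ℝ := fun t => u t * exp (-(μ₂ * t)) with hU
  have hUC : ∀ t ≤ T, |U t| ≤ C := by
    intro t ht
    simp only [hU, abs_mul, abs_of_pos (exp_pos (-(μ₂ * t)))]
    have := mul_le_mul_of_nonneg_right (hC t ht) (exp_pos (-(μ₂ * t))).le
    rwa [mul_assoc, ← exp_add, add_neg_cancel, exp_zero, mul_one] at this
  set V : Set ℝ := (fun t => U t - U (t - a)) '' Iic T with hV
  have hbdd : BddAbove V := by
    refine ⟨2 * C, ?_⟩
    rintro _ ⟨t, ht, rfl⟩
    have h1 := (abs_le.1 (hUC t ht)).2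
    have h2 := (abs_le.1 (hUC (t - a) (by simp at ht; linarith))).1
    simp only; linarith
  have hne : V.Nonempty := ⟨_, T, self_mem_Iic, rfl⟩
  set S := sSup V with hS
  have hUle : ∀ t ≤ T, U t - U (t - a) ≤ S := fun t ht => le_csSup hbdd ⟨t, ht, rfl⟩
  have hueq : ∀ t, u t = U t * exp (μ₂ * t) := fun t => by
    simp only [hU]; rw [mul_assoc, ← exp_add]; simp
  have hqU : ∀ t, S * exp (μ₂ * t) - u t + exp (μ₂ * a) * u (t - a) =
      (S - (U t - U (t - a))) * exp (μ₂ * t) := by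
    intro t
    rw [hueq t, hueq (t - a), show exp (μ₂ * t) = exp (μ₂ * a) * exp (μ₂ * (t - a)) by
      rw [← exp_add]; congr 1; ring]
    ring
  have hq0 : ∀ t ≤ T, 0 ≤ S * exp (μ₂ * t) - u t + exp (μ₂ * a) * u (t - a) := fun t ht => by
    rw [hqU]; exact mul_nonneg (by linarith [hUle t ht]) (exp_pos _).le
  have hqW : ∀ t, expWindow μ₁ τ
      (fun t => S * exp (μ₂ * t) - u t + exp (μ₂ * a) * u (t - a)) t =
      S * expWindow μ₁ τ (fun t => exp (μ₂ * t)) t - expWindow μ₁ τ u t +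
        exp (μ₂ * a) * expWindow μ₁ τ u (t - a) := by
    intro t
    have e : (fun t => S * exp (μ₂ * t) - u t + exp (μ₂ * a) * u (t - a)) =
        fun t => (S * exp (μ₂ * t) + (-1) * u t) + exp (μ₂ * a) * u (t - a) := by
      funext t; ring
    rw [e, expWindow_add (by fun_prop) (by fun_prop), expWindow_add (by fun_prop) (by fun_prop),
      expWindow_const_mul, expWindow_const_mul, expWindow_const_mul, expWindow_shift]
    ring
  have hdelay : ∀ t ≤ T, ∀ s ≥ 0, S - (U (t - s) - U (t - s - a)) ≤
      exp ((μ₁ + μ₂ - c) * s) * (S - (U t - U (t - a))) := by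
    intro t ht s hs
    have hexp : ∀ t, HasDerivAt (fun t : ℝ => exp (μ₂ * t)) (exp (μ₂ * t) * μ₂) t := fun t => by
      have : HasDerivAt (fun t : ℝ => μ₂ * t) μ₂ t := by
        simpa using (hasDerivAt_id t).const_mul μ₂
      exact this.exp
    have := mul_exp_le_of_hasDerivAt
      (w := fun t => S * exp (μ₂ * t) - u t + exp (μ₂ * a) * u (t - a))
      (w' := fun t => S * (exp (μ₂ * t) * μ₂) - ((c - μ₁) * u t + k * expWindow μ₁ τ u t) +
        exp (μ₂ * a) * ((c - μ₁) * u (t - a) + k * expWindow μ₁ τ u (t - a)))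
      (β := c - μ₁) (a := t - s) (b := t) (by linarith)
      (fun r hr => (((hexp r).const_mul S).fun_sub (hd r (hr.2.trans ht))).fun_add
        (((hd (r - a) (by linarith [hr.2])).comp_sub_const r a).const_mul _))
      (fun r hr => by
        have h0 : 0 ≤ expWindow μ₁ τ
            (fun t => S * exp (μ₂ * t) - u t + exp (μ₂ * a) * u (t - a)) r :=
          expWindow_nonneg hτ.le fun x hx => hq0 x (hx.2.trans (hr.2.trans ht))
        rw [hqW] at h0
        have h1 := mul_nonneg hk.le h0
        have h2 := R.window₁ r
        linear_combination h1 + S * h2)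
    simp only [hqU] at this
    have h2 := mul_le_mul_of_nonneg_right this (exp_pos (-(μ₂ * t) + (μ₁ - c) * s)).le
    have e1 : exp (μ₂ * (t - s)) * exp ((c - μ₁) * (t - (t - s))) *
        exp (-(μ₂ * t) + (μ₁ - c) * s) = exp (-(μ₂ * s)) := by
      rw [← exp_add, ← exp_add]; congr 1; ring
    have e2 : exp (μ₂ * t) * exp (-(μ₂ * t) + (μ₁ - c) * s) = exp ((μ₁ - c) * s) := by
      rw [← exp_add]; congr 1; ring
    have h3 : (S - (U (t - s) - U (t - s - a))) * exp (-(μ₂ * s)) ≤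
        (S - (U t - U (t - a))) * exp ((μ₁ - c) * s) := by
      rw [← e1, ← e2]; linarith
    have h4 := mul_le_mul_of_nonneg_right h3 (exp_pos (μ₂ * s)).le
    have e3 : exp (-(μ₂ * s)) * exp (μ₂ * s) = 1 := by rw [← exp_add]; simp
    have e4 : exp ((μ₁ + μ₂ - c) * s) = exp ((μ₁ - c) * s) * exp (μ₂ * s) := by
      rw [← exp_add]; congr 1; ring
    rw [e4]
    linear_combination h4 - (S - (U (t - s) - U (t - s - a))) * e3
  have hSle : S ≤ 0 := by
    by_contra hpos
    push Not at hpos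
    obtain ⟨N, hN⟩ := exists_nat_gt (4 * C / S)
    rw [div_lt_iff₀ hpos] at hN
    set ε := S / (2 * exp (|μ₁ + μ₂ - c| * (N * a))) with hε
    have hε0 : 0 < ε := by positivity
    obtain ⟨_, ⟨t, ht, rfl⟩, hlt⟩ := exists_lt_of_lt_csSup hne (show S - ε < S by linarith)
    have hstep : ∀ j : ℕ, j ≤ N → S / 2 ≤ U (t - j * a) - U (t - j * a - a) := by
      intro j hj
      have h1 := hdelay t ht (j * a) (by positivity)
      have hja : (j : ℝ) * a ≤ N * a :=
        mul_le_mul_of_nonneg_right (by exact_mod_cast hj) ha.le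
      have h2 : exp ((μ₁ + μ₂ - c) * (j * a)) ≤ exp (|μ₁ + μ₂ - c| * (N * a)) := by
        apply exp_le_exp.2
        calc (μ₁ + μ₂ - c) * (j * a) ≤ |μ₁ + μ₂ - c| * (j * a) :=
              mul_le_mul_of_nonneg_right (le_abs_self _) (by positivity)
          _ ≤ _ := mul_le_mul_of_nonneg_left hja (abs_nonneg _)
      have h3 : exp ((μ₁ + μ₂ - c) * (j * a)) * (S - (U t - U (t - a))) ≤ S / 2 := by
        calc _ ≤ exp (|μ₁ + μ₂ - c| * (N * a)) * ε := by
              apply mul_le_mul h2 (by simp only at hlt; linarith) _ (exp_pos _).le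
              linarith [hUle t ht]
          _ = S / 2 := by rw [hε]; field_simp
      linarith
    have htel : ∀ j : ℕ, j ≤ N → j * (S / 2) ≤ U t - U (t - j * a) := by
      intro j
      induction j with
      | zero => intro _; simp
      | succ j ih =>
        intro hj
        have h1 := ih (by omega)
        have h2 := hstep j (by omega)
        push_cast
        rw [show t - ((j : ℝ) + 1) * a = t - j * a - a by ring]
        linarith
    have h5 := htel N le_rfl
    have h6 := (abs_le.1 (hUC t ht)).2
    have h7 := (abs_le.1 (hUC (t - N * a)
      (by have : 0 ≤ (N : ℝ) * a := by positivity
          simp at ht; linarith))).1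
    linarith
  intro t ht
  have h1 := hUle t ht
  have h2 : u t ≤ U (t - a) * exp (μ₂ * t) := by
    rw [hueq t]; exact mul_le_mul_of_nonneg_right (by linarith) (exp_pos _).le
  rw [hueq (t - a), mul_left_comm, ← exp_add]
  rwa [show μ₂ * a + μ₂ * (t - a) = μ₂ * t by ring]

/-- Exponential growth of differences of solutions is propagated forward in time. -/
theorem growth_propagates {d d₁ Δ : ℝ → ℝ} {k c τ μ₂ X : ℝ} (hk : 0 ≤ k) (hτ : 0 < τ)
    (hroot : μ₂ ^ 2 - c * μ₂ - 1 + k * exp (-(μ₂ * τ)) = 0)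
    (h1 : ∀ t, HasDerivAt d (d₁ t) t) (h2 : ∀ t, HasDerivAt d₁ (c * d₁ t + d t - Δ t) t)
    (hΔ : ∀ t, 0 ≤ d (t - τ) → Δ t ≤ k * d (t - τ))
    (hX : ∀ t ≤ X, 0 ≤ d t ∧ μ₂ * d t ≤ d₁ t) : ∀ t, 0 ≤ d t ∧ μ₂ * d t ≤ d₁ t := by
  have step : ∀ X, (∀ t ≤ X, 0 ≤ d t ∧ μ₂ * d t ≤ d₁ t) →
      ∀ t ≤ X + τ, 0 ≤ d t ∧ μ₂ * d t ≤ d₁ t := by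
    intro X hX t ht
    rcases le_total t X with htX | htX
    · exact hX t htX
    have hN : ∀ t, HasDerivAt (fun t => d t * exp (-(μ₂ * t)) - d X * exp (-(μ₂ * X)))
        ((d₁ t - μ₂ * d t) * exp (-(μ₂ * t))) t := fun t =>
      (hasDerivAt_mul_exp_neg (h1 t)).sub_const _
    have hN1 : ∀ t, HasDerivAt (fun t => (d₁ t - μ₂ * d t) * exp (-(μ₂ * t)))
        ((c * d₁ t + d t - Δ t - μ₂ * d₁ t - μ₂ * (d₁ t - μ₂ * d t)) * exp (-(μ₂ * t))) t :=
      fun t => hasDerivAt_mul_exp_neg ((h2 t).fun_sub ((h1 t).const_mul μ₂))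
    have key := forward_nonneg (a := c - 2 * μ₂) (P := k * exp (-(μ₂ * τ)))
      (X := X) (Y := X + τ) (by positivity) (fun t _ => hN t) (fun t _ => hN1 t)
      (fun t ht => by
        have hd := hX (t - τ) (by linarith [ht.2])
        have h3 := hΔ t hd.1
        have h4 := mul_exp_le_of_hasDerivAt (w := d) (β := μ₂) (a := t - τ) (b := X)
          (by linarith [ht.2]) (fun s _ => h1 s) (fun s hs => (hX s hs.2).2)
        have h5 : d (t - τ) * exp (-(μ₂ * t)) ≤
            exp (-(μ₂ * τ)) * (d X * exp (-(μ₂ * X))) := by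
          have := mul_le_mul_of_nonneg_right h4 (exp_pos (-(μ₂ * (X + τ)))).le
          rw [mul_assoc, ← exp_add] at this
          rw [mul_left_comm, ← exp_add]
          have e1 : μ₂ * (X - (t - τ)) + -(μ₂ * (X + τ)) = -(μ₂ * t) := by ring
          have e2 : -(μ₂ * τ) + -(μ₂ * X) = -(μ₂ * (X + τ)) := by ring
          rwa [e1, ← e2] at this
        have h6 := mul_le_mul_of_nonneg_right h3 (exp_pos (-(μ₂ * t))).le
        have h7 := mul_le_mul_of_nonneg_left h5 hk
        linear_combination h6 + h7 + exp (-(μ₂ * t)) * d t * hroot)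
      (by simp) (mul_nonneg (by linarith [(hX X le_rfl).2]) (exp_pos _).le) t ⟨htX, ht⟩
    have hpos := exp_pos (-(μ₂ * t))
    constructor
    · have h8 : 0 ≤ d t * exp (-(μ₂ * t)) := by
        have := mul_nonneg (hX X le_rfl).1 (exp_pos (-(μ₂ * X))).le
        linarith [key.1]
      exact nonneg_of_mul_nonneg_left h8 hpos
    · have := nonneg_of_mul_nonneg_left key.2 hpos
      linarith
  have hn : ∀ n : ℕ, ∀ t ≤ X + n * τ, 0 ≤ d t ∧ μ₂ * d t ≤ d₁ t := by
    intro n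
    induction n with
    | zero => simpa using hX
    | succ n ih =>
      intro t ht
      exact step _ ih t (by push_cast at ht; linarith)
  intro t
  obtain ⟨n, hn'⟩ := exists_nat_ge ((t - X) / τ)
  rw [div_le_iff₀ hτ] at hn'
  exact hn n t (by linarith)

/-- A bounded function growing exponentially forward in time vanishes. -/
theorem eq_zero_of_growth {d d₁ : ℝ → ℝ} {μ C : ℝ} (hμ : 0 < μ)
    (h1 : ∀ t, HasDerivAt d (d₁ t) t) (h : ∀ t, 0 ≤ d t ∧ μ * d t ≤ d₁ t) (hC : ∀ t, d t ≤ C) :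
    ∀ t, d t = 0 := by
  intro t
  by_contra hne
  have hpos : 0 < d t := lt_of_le_of_ne (h t).1 (Ne.symm hne)
  have hC0 : 0 < C := hpos.trans_le (hC t)
  set s := C / (d t * μ) with hs
  have hs0 : 0 < s := by positivity
  have h3 := mul_exp_le_of_hasDerivAt (w := d) (β := μ) (a := t) (b := t + s) (by linarith)
    (fun s _ => h1 s) (fun s _ => (h s).2)
  have h4 := add_one_le_exp (μ * (t + s - t))
  have h5 : d t * (μ * (t + s - t) + 1) = C + d t := by rw [hs]; field_simp; ring
  have h6 := mul_le_mul_of_nonneg_left h4 hpos.le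
  linarith [hC (t + s)]

namespace Front
variable {g : ℝ → ℝ} {k p Q κ θ₁ c τ μ₂ μ₁ : ℝ} {φ φ₁ : ℝ → ℝ}

/-- Shape of a front as long as it only feels the linear part of the birth function. -/
theorem representation (F : Front g κ c τ φ φ₁) (B : BirthProps g k p Q κ θ₁)
    (R : CharRoots k c τ μ₂ μ₁) (hτ : 0 < τ) {T : ℝ} (hT : ∀ t ≤ T, φ (t - τ) ≤ 1) :
    ∃ b, ∀ t ≤ T, φ₁ t = μ₂ * φ t - b * exp (μ₁ * t) := by
  have hk : 0 < k := by linarith [B.one_lt_k]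
  have hlin : ∀ t ≤ T, g (φ (t - τ)) = k * φ (t - τ) := fun t ht =>
    B.lin _ (F.pos _).le (hT t ht)
  have hc := F.continuous
  have hc1 := F.continuous₁
  have hμ : ∀ t ≤ T, φ₁ t ≤ μ₁ * φ t := by
    obtain ⟨lam, _, hchi, hl⟩ := F.exists_rate B hτ hlin
    have : lam ≤ μ₁ := by
      by_contra hcon
      push Not at hcon
      linarith [R.beyond lam hcon]
    exact fun t ht => (hl t ht).trans (mul_le_mul_of_nonneg_right this (F.pos t).le)
  set u : ℝ → ℝ := fun t => μ₁ * φ t - φ₁ t with hu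
  have huc : Continuous u := by fun_prop
  set E : ℝ → ℝ := fun t => φ₁ t + (μ₂ - c) * φ t - k * expWindow μ₂ τ φ t with hE
  have hEd : ∀ t ≤ T, HasDerivAt E (μ₂ * E t) t := by
    intro t ht
    have := hasDerivAt_charFunctional (r := 0) hc R.root₂ (F.d1 t)
      ((F.d2 t).congr_deriv (by rw [hlin t ht]; ring))
    simpa [hE] using this
  have huE : ∀ t ≤ T, u t ≤ -E t := by
    intro t ht
    have hmono : ∀ s ∈ Icc (t - τ) t, φ t * exp (-(μ₁ * t)) * exp (μ₁ * s) ≤ φ s := by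
      intro s hs
      have := mul_exp_le_of_hasDerivAt (w := fun t => -φ t) (w' := fun t => -φ₁ t) (β := μ₁)
        hs.2 (fun s _ => (F.d1 s).fun_neg)
        (fun r hr => by linarith [hμ r (hr.2.trans ht)])
      have h2 := mul_le_mul_of_nonneg_right this (exp_pos (μ₁ * (s - t))).le
      rw [mul_assoc, ← exp_add] at h2
      rw [mul_assoc, ← exp_add]
      have e1 : μ₁ * (t - s) + μ₁ * (s - t) = 0 := by ring
      have e2 : -(μ₁ * t) + μ₁ * s = μ₁ * (s - t) := by ring
      rw [e1, exp_zero] at h2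
      rw [e2]
      linarith
    have h3 := expWindow_mono (z := μ₂) (by fun_prop) hc hτ.le hmono
    rw [expWindow_const_mul] at h3
    have h4 := mul_le_mul_of_nonneg_left h3 hk.le
    have h5 := R.window₂ t
    have e : exp (-(μ₁ * t)) * exp (μ₁ * t) = 1 := by rw [← exp_add]; simp
    simp only [hu, hE]
    linear_combination h4 + (-(φ t * exp (-(μ₁ * t)))) * h5 - (φ t * (μ₁ + μ₂ - c)) * e
  have hEeq : ∀ t ≤ T, E t = E T * exp (-(μ₂ * T)) * exp (μ₂ * t) := by
    intro t ht
    have := eq_mul_exp_of_hasDerivAt ht (fun s hs => hEd s hs.2) (fun s _ => rfl)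
    rw [this, mul_assoc, mul_assoc, ← exp_add, ← exp_add]
    rw [show μ₂ * (T - t) + (-(μ₂ * T) + μ₂ * t) = 0 by ring]
    simp
  have hu0 : ∀ t ≤ T, 0 ≤ u t := fun t ht => by simp only [hu]; linarith [hμ t ht]
  have hwin : ∀ t, φ (t - τ) = exp (-(μ₁ * τ)) * φ t + expWindow μ₁ τ u t := by
    intro t
    have h1 : ∀ s, HasDerivAt (fun s => -(φ s * exp (-(μ₁ * s)))) (exp (-(μ₁ * s)) * u s) s := by
      intro s
      exact (hasDerivAt_mul_exp_neg (F.d1 s)).fun_neg.congr_deriv (by simp only [hu]; ring)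
    have h2 := intervalIntegral.integral_eq_sub_of_hasDerivAt (a := t - τ) (b := t)
      (fun s _ => h1 s) (Continuous.intervalIntegrable (by fun_prop) _ _)
    rw [expWindow_eq, h2]
    have e1 : exp (-(μ₁ * τ)) = exp (μ₁ * (t - τ)) * exp (-(μ₁ * t)) := by
      rw [← exp_add]; congr 1; ring
    have e2 : exp (μ₁ * (t - τ)) * exp (-(μ₁ * (t - τ))) = 1 := by
      rw [← exp_add]; simp
    rw [e1]
    linear_combination (-φ (t - τ)) * e2
  have hud : ∀ t ≤ T, HasDerivAt u ((c - μ₁) * u t + k * expWindow μ₁ τ u t) t := by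
    intro t ht
    refine (((F.d1 t).const_mul μ₁).fun_sub (F.d2 t)).congr_deriv ?_
    rw [hlin t ht, hwin t]
    simp only [hu]
    linear_combination (φ t) * R.root₁
  have hbd : ∀ t ≤ T, |u t| ≤ -(E T * exp (-(μ₂ * T))) * exp (μ₂ * t) := by
    intro t ht
    rw [abs_of_nonneg (hu0 t ht)]
    have := huE t ht
    rw [hEeq t ht] at this
    linarith
  have hueq : ∀ t ≤ T, u t = u T * exp (-(μ₂ * T)) * exp (μ₂ * t) := by
    intro t ht
    rcases ht.eq_or_lt with rfl | hlt
    · rw [mul_assoc, ← exp_add]; simp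
    have ha : 0 < T - t := by linarith
    have h1 := reduced_le R hk hτ ha huc hud hbd T le_rfl
    have h2 := reduced_le (u := fun t => (-1) * u t) R hk hτ ha (by fun_prop)
      (fun t ht => ((hud t ht).const_mul (-1)).congr_deriv (by rw [expWindow_const_mul]; ring))
      (fun t ht => by
        rw [abs_mul]; simp only [abs_neg, abs_one, one_mul]; exact hbd t ht) T le_rfl
    rw [show T - (T - t) = t by ring] at h1 h2
    have h3 : u T = exp (μ₂ * (T - t)) * u t := by linarith
    have e : exp (μ₂ * (T - t)) * exp (-(μ₂ * T)) * exp (μ₂ * t) = 1 := by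
      rw [← exp_add, ← exp_add, show μ₂ * (T - t) + -(μ₂ * T) + μ₂ * t = 0 by ring, exp_zero]
    rw [h3]
    linear_combination (-(u t)) * e
  have hud' : ∀ t ≤ T, HasDerivAt u (μ₂ * u t) t := by
    intro t ht
    refine (hud t ht).congr_deriv ?_
    rw [expWindow_congr (v := fun s => u T * exp (-(μ₂ * T)) * exp (μ₂ * s)) hτ.le
      (fun s hs => hueq s (hs.2.trans ht)), expWindow_const_mul]
    have h1 := R.window₁ t
    rw [hueq t ht]
    linear_combination (u T * exp (-(μ₂ * T))) * h1
  have hφ2 : ∀ t ≤ T, HasDerivAt φ₁ (μ₁ * φ₁ t - μ₂ * u t) t := by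
    intro t ht
    have := ((F.d1 t).const_mul μ₁).fun_sub (hud' t ht)
    simpa [hu] using this
  refine ⟨-((φ₁ T - μ₂ * φ T) * exp (-(μ₁ * T))), fun t ht => ?_⟩
  have hv := eq_mul_exp_of_hasDerivAt (w := fun t => φ₁ t - μ₂ * φ t) (β := μ₁) ht
    (fun s hs => (hφ2 s hs.2).fun_sub ((F.d1 s).const_mul μ₂))
    (fun s _ => by simp only [hu]; ring)
  rw [hv]
  have e : exp (μ₁ * (T - t)) * exp (-(μ₁ * T)) * exp (μ₁ * t) = 1 := by
    rw [← exp_add, ← exp_add, show μ₁ * (T - t) + -(μ₁ * T) + μ₁ * t = 0 by ring, exp_zero]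
  linear_combination (-(φ₁ t - μ₂ * φ t)) * e

theorem coeff_pos (F : Front g κ c τ φ φ₁) (B : BirthProps g k p Q κ θ₁)
    (R : CharRoots k c τ μ₂ μ₁) (hτ : 0 < τ) {T b : ℝ}
    (hb : ∀ t ≤ T, φ₁ t = μ₂ * φ t - b * exp (μ₁ * t)) : 0 < b := by
  by_contra hneg
  push Not at hneg
  have h := growth_propagates (X := T) (Δ := fun t => g (φ (t - τ)))
    (show 0 ≤ k by linarith [B.one_lt_k]) hτ R.root₂ F.d1 F.d2
    (fun t h0 => by
      have := B.slope (φ (t - τ)) 0 h0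
      rw [B.zero 0 le_rfl] at this
      simpa using this)
    (fun t ht => ⟨(F.pos t).le, by
      rw [hb t ht]
      have := mul_nonpos_of_nonpos_of_nonneg hneg (exp_pos (μ₁ * t)).le
      linarith⟩)
  have := eq_zero_of_growth R.pos F.d1 h (F.le_k B) 0
  exact (F.pos 0).ne' this

theorem shift (F : Front g κ c τ φ φ₁) (s : ℝ) :
    Front g κ c τ (fun t => φ (t + s)) (fun t => φ₁ (t + s)) where
  d1 t := (F.d1 (t + s)).comp_add_const t s
  d2 t := by
    have := (F.d2 (t + s)).comp_add_const t s
    rwa [show t + s - τ = t - τ + s by ring] at this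
  pos t := F.pos _
  bot := F.bot.comp (tendsto_atBot_add_const_right _ s tendsto_id)
  top := F.top.comp (tendsto_atTop_add_const_right _ s tendsto_id)

theorem eq_of_same_coeff {ψ ψ₁ : ℝ → ℝ} (F : Front g κ c τ φ φ₁) (G : Front g κ c τ ψ ψ₁)
    (B : BirthProps g k p Q κ θ₁) (R : CharRoots k c τ μ₂ μ₁) (hτ : 0 < τ) {T b : ℝ}
    (hF : ∀ t ≤ T, φ₁ t = μ₂ * φ t - b * exp (μ₁ * t))
    (hG : ∀ t ≤ T, ψ₁ t = μ₂ * ψ t - b * exp (μ₁ * t)) (hT : ψ T ≤ φ T) : ∀ t, φ t = ψ t := by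
  have h1 : ∀ t, HasDerivAt (fun t => φ t - ψ t) (φ₁ t - ψ₁ t) t := fun t =>
    (F.d1 t).fun_sub (G.d1 t)
  have h := growth_propagates (X := T) (d := fun t => φ t - ψ t) (d₁ := fun t => φ₁ t - ψ₁ t)
    (Δ := fun t => g (φ (t - τ)) - g (ψ (t - τ)))
    (show 0 ≤ k by linarith [B.one_lt_k]) hτ R.root₂ h1
    (fun t => ((F.d2 t).fun_sub (G.d2 t)).congr_deriv (by ring))
    (fun t h0 => B.slope _ _ (by linarith))
    (fun t ht => ⟨by
      have := eq_mul_exp_of_hasDerivAt (w := fun t => φ t - ψ t) (β := μ₂) ht (fun s _ => h1 s)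
        (fun s hs => by rw [hF s hs.2, hG s hs.2]; ring)
      have h2 : 0 ≤ φ T - ψ T := by linarith
      rw [this] at h2
      exact nonneg_of_mul_nonneg_left h2 (exp_pos _), by
      rw [hF t ht, hG t ht]; linarith⟩)
  intro t
  have := eq_zero_of_growth (C := k) R.pos h1 h
    (fun t => by linarith [F.le_k B t, G.pos t]) t
  linarith

/-- Fronts are unique up to translation. -/
theorem unique {ψ ψ₁ : ℝ → ℝ} (F : Front g κ c τ φ φ₁) (G : Front g κ c τ ψ ψ₁)
    (B : BirthProps g k p Q κ θ₁) (R : CharRoots k c τ μ₂ μ₁) (hτ : 0 < τ) :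
    ∃ s, ∀ t, ψ t = φ (t + s) := by
  obtain ⟨T, hT⟩ := F.exists_linear
  obtain ⟨S, hS⟩ := G.exists_linear
  obtain ⟨b, hb⟩ := F.representation B R hτ (T := T + τ) (fun t ht => hT _ (by linarith))
  obtain ⟨b', hb'⟩ := G.representation B R hτ (T := S + τ) (fun t ht => hS _ (by linarith))
  have hbp := F.coeff_pos B R hτ hb
  have hbp' := G.coeff_pos B R hτ hb'
  have hμ₁ : 0 < μ₁ := R.pos.trans_le R.le
  set s := log (b' / b) / μ₁ with hs
  have hexp : b * exp (μ₁ * s) = b' := by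
    rw [hs, mul_div_cancel₀ _ hμ₁.ne', exp_log (by positivity)]
    field_simp
  refine ⟨s, ?_⟩
  set X := min (T + τ - s) (S + τ) with hX
  have hF : ∀ t ≤ X, φ₁ (t + s) = μ₂ * φ (t + s) - b' * exp (μ₁ * t) := by
    intro t ht
    have := ht.trans (min_le_left _ _)
    rw [hb (t + s) (by linarith), ← hexp, mul_assoc, ← exp_add]
    congr 3; ring
  have hG : ∀ t ≤ X, ψ₁ t = μ₂ * ψ t - b' * exp (μ₁ * t) := fun t ht =>
    hb' t (ht.trans (min_le_right _ _))
  rcases le_total (ψ X) (φ (X + s)) with h | h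
  · exact fun t => ((F.shift s).eq_of_same_coeff G B R hτ hF hG h t).symm
  · exact fun t => G.eq_of_same_coeff (F.shift s) B R hτ hG hF h t

end Front

theorem IsLocalMin.second_deriv_nonneg {f f₁ : ℝ → ℝ} {q d : ℝ} (h : IsLocalMin f q)
    (h1 : ∀ t, HasDerivAt f (f₁ t) t) (h2 : HasDerivAt f₁ d q) : f₁ q = 0 ∧ 0 ≤ d := by
  have h0 : f₁ q = 0 := h.hasDerivAt_eq_zero (h1 q)
  refine ⟨h0, ?_⟩
  by_contra hd
  push Not at hd
  have hs := (hasDerivAt_iff_tendsto_slope.1 h2).eventually (gt_mem_nhds hd)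
  rw [eventually_nhdsWithin_iff] at hs
  obtain ⟨ε, hε, hball⟩ := Metric.eventually_nhds_iff.1 (hs.and h)
  have hneg : ∀ s ∈ Ioo q (q + ε / 2), f₁ s < 0 := by
    intro s hs
    have h3 := (hball (y := s) (by
      rw [Real.dist_eq, abs_of_pos (by linarith [hs.1])]; linarith [hs.2])).1 hs.1.ne'
    rw [slope_def_field, h0, sub_zero] at h3
    by_contra hc
    push Not at hc
    have := div_nonneg hc (show 0 ≤ s - q by linarith [hs.1])
    linarith
  have hanti : StrictAntiOn f (Icc q (q + ε / 2)) := by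
    apply strictAntiOn_of_deriv_neg (convex_Icc _ _)
    · exact fun t _ => (h1 t).continuousAt.continuousWithinAt
    · intro t ht
      rw [interior_Icc] at ht
      rw [(h1 t).deriv]
      exact hneg t ht
  have h4 := hanti (left_mem_Icc.2 (by linarith)) (right_mem_Icc.2 (by linarith))
    (show q < q + ε / 2 by linarith)
  have h5 := (hball (y := q + ε / 2) (by
    rw [Real.dist_eq, abs_of_pos (by linarith)]; linarith)).2
  linarith

theorem IsLocalMax.second_deriv_nonpos {f f₁ : ℝ → ℝ} {q d : ℝ} (h : IsLocalMax f q)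
    (h1 : ∀ t, HasDerivAt f (f₁ t) t) (h2 : HasDerivAt f₁ d q) : f₁ q = 0 ∧ d ≤ 0 := by
  have := IsLocalMin.second_deriv_nonneg (f := fun t => -f t) h.neg (fun t => (h1 t).fun_neg)
    h2.fun_neg
  exact ⟨by linarith [this.1], by linarith [this.2]⟩

namespace Front
variable {g : ℝ → ℝ} {k p Q κ θ₁ c τ μ₂ μ₁ : ℝ} {φ φ₁ : ℝ → ℝ}

theorem exists_first (F : Front g κ c τ φ φ₁) (hκ : 1 < κ) :
    ∃ t₀, φ t₀ = 1 ∧ ∀ t < t₀, φ t < 1 := by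
  set S := {t | 1 ≤ φ t} with hS
  have hcl : IsClosed S := isClosed_le continuous_const F.continuous
  obtain ⟨Y, hY⟩ := eventually_atTop.1 (F.top.eventually (lt_mem_nhds hκ))
  obtain ⟨X, hX⟩ := eventually_atBot.1 (F.bot.eventually (gt_mem_nhds zero_lt_one))
  have hne : S.Nonempty := ⟨Y, (hY Y le_rfl).le⟩
  have hbd : BddBelow S := ⟨X, fun t ht => by
    by_contra hc
    push Not at hc
    have := hX t hc.le
    have ht' : 1 ≤ φ t := ht
    linarith⟩
  have hlt : ∀ t < sInf S, φ t < 1 := by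
    intro t ht
    by_contra hc
    push Not at hc
    linarith [csInf_le hbd hc]
  refine ⟨sInf S, le_antisymm ?_ (hcl.csInf_mem hne hbd), hlt⟩
  exact le_of_tendsto ((F.continuous.tendsto (sInf S)).mono_left nhdsWithin_le_nhds)
    (eventually_nhdsWithin_of_forall fun t (ht : t ∈ Iio (sInf S)) => (hlt t ht).le)

/-- In the linear regime a point with nonnegative slope is preceded by strict increase. -/
theorem lt_of_linear (F : Front g κ c τ φ φ₁) (R : CharRoots k c τ μ₂ μ₁)
    {T b : ℝ} (hb0 : 0 < b) (hb : ∀ t ≤ T, φ₁ t = μ₂ * φ t - b * exp (μ₁ * t)) {s t : ℝ}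
    (hst : s < t) (ht : t ≤ T) (h0 : 0 ≤ φ₁ t) : φ s < φ t := by
  have hle : ∀ r ≤ T, φ₁ r ≤ μ₁ * φ r := by
    intro r hr
    have h1 := mul_le_mul_of_nonneg_right R.le (F.pos r).le
    have h2 := mul_pos hb0 (exp_pos (μ₁ * r))
    rw [hb r hr]; linarith
  have hpos : ∀ r ∈ Icc s t, 0 ≤ φ₁ r := by
    intro r hr
    have h3 := mul_exp_le_of_hasDerivAt (w := fun t => -φ t) (w' := fun t => -φ₁ t) (β := μ₁)
      hr.2 (fun s _ => (F.d1 s).fun_neg) (fun x hx => by linarith [hle x (hx.2.trans ht)])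
    rw [hb t ht] at h0
    rw [hb r (hr.2.trans ht)]
    have e : exp (μ₁ * t) = exp (μ₁ * r) * exp (μ₁ * (t - r)) := by
      rw [← exp_add]; congr 1; ring
    have h4 : b * exp (μ₁ * r) * exp (μ₁ * (t - r)) ≤ μ₂ * φ r * exp (μ₁ * (t - r)) := by
      have := mul_le_mul_of_nonneg_left h3 R.pos.le
      rw [e] at h0
      linarith
    have := le_of_mul_le_mul_right h4 (exp_pos _)
    linarith
  have hmono : ∀ r ∈ Icc s t, φ r ≤ φ t := fun r hr =>
    le_of_hasDerivAt_nonneg hr.2 (fun x _ => F.d1 x) (fun x hx => hpos x ⟨hr.1.trans hx.1, hx.2⟩)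
  refine lt_of_le_of_ne (hmono s (left_mem_Icc.2 hst.le)) fun heq => ?_
  have hcon : ∀ r ∈ Icc s t, φ r = φ s := fun r hr => le_antisymm
    ((hmono r hr).trans heq.ge)
    (le_of_hasDerivAt_nonneg hr.1 (fun x _ => F.d1 x) (fun x hx => hpos x ⟨hx.1, hx.2.trans hr.2⟩))
  have hmid : φ₁ ((s + t) / 2) = 0 := by
    have hloc : IsLocalMax φ ((s + t) / 2) := by
      filter_upwards [Icc_mem_nhds (show s < (s + t) / 2 by linarith)
        (show (s + t) / 2 < t by linarith)] with x hx
      exact ((hcon x hx).trans (hcon _ ⟨by linarith, by linarith⟩).symm).le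
    exact hloc.hasDerivAt_eq_zero (F.d1 _)
  have h1 : μ₂ * φ s = b * exp (μ₁ * ((s + t) / 2)) := by
    have := hb ((s + t) / 2) (by linarith)
    rw [hmid, hcon _ ⟨by linarith, by linarith⟩] at this
    linarith
  have h2 := hb t ht
  rw [hcon t (right_mem_Icc.2 hst.le), h1] at h2
  have h3 : exp (μ₁ * ((s + t) / 2)) < exp (μ₁ * t) :=
    exp_lt_exp.2 (mul_lt_mul_of_pos_left (by linarith) (R.pos.trans_le R.le))
  have := mul_lt_mul_of_pos_left h3 hb0
  linarith

/-- The geometric information about a front: linear regime up to time `t₀ + τ`, and `φ ≥ 1`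
after time `t₀`. -/
theorem shape (F : Front g κ c τ φ φ₁) (B : BirthProps g k p Q κ θ₁)
    (R : CharRoots k c τ μ₂ μ₁) (hτ : 0 < τ) :
    ∃ t₀ b, φ t₀ = 1 ∧ (∀ t < t₀, φ t < 1) ∧ (∀ t ≥ t₀, 1 ≤ φ t) ∧ 0 < b ∧
      ∀ t ≤ t₀ + τ, φ₁ t = μ₂ * φ t - b * exp (μ₁ * t) := by
  have hκ1 : 1 < κ := B.one_lt.trans B.lt_kappa
  obtain ⟨t₀, h0, hlt⟩ := F.exists_first hκ1
  obtain ⟨b, hb⟩ := F.representation B R hτ (T := t₀ + τ) (fun t ht => by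
    rcases (show t - τ ≤ t₀ by linarith).eq_or_lt with h | h
    · rw [h, h0]
    · exact (hlt _ h).le)
  have hb0 := F.coeff_pos B R hτ hb
  refine ⟨t₀, b, h0, hlt, fun t ht => ?_, hb0, hb⟩
  by_contra hcon
  push Not at hcon
  obtain ⟨Y, hY⟩ := eventually_atTop.1 (F.top.eventually (lt_mem_nhds hκ1))
  obtain ⟨t₂, ht₂, hmin⟩ := (isCompact_Icc (a := t₀) (b := max Y t)).exists_isMinOn
    ⟨t, ht, le_max_right _ _⟩ F.continuous.continuousOn
  have h21 : φ t₂ < 1 := (hmin ⟨ht, le_max_right _ _⟩).trans_lt hcon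
  have hgt : t₀ < t₂ := lt_of_le_of_ne ht₂.1 fun h => by rw [← h, h0] at h21; exact lt_irrefl _ h21
  have hmin' : ∀ s ≥ t₀, φ t₂ ≤ φ s := by
    intro s hs
    rcases le_total s (max Y t) with h | h
    · exact hmin ⟨hs, h⟩
    · exact (h21.trans (hY s ((le_max_left _ _).trans h))).le
  have hloc : IsLocalMin φ t₂ := by
    filter_upwards [Ioi_mem_nhds hgt] with s hs using hmin' s (le_of_lt hs)
  obtain ⟨hz, hdd⟩ := hloc.second_deriv_nonneg F.d1 (F.d2 t₂)
  rcases le_or_gt t₂ (t₀ + τ) with h | h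
  · have := F.lt_of_linear R hb0 hb hgt h hz.ge
    linarith [hmin' t₀ le_rfl]
  · rw [hz] at hdd
    have hx := hmin' (t₂ - τ) (by linarith)
    rcases le_total (φ (t₂ - τ)) 1 with hx1 | hx1
    · rw [B.lin _ (F.pos _).le hx1] at hdd
      have := F.pos (t₂ - τ)
      nlinarith [B.one_lt_k]
    · have := B.min_le hx1 (F.le_k B _)
      linarith [B.lt_min, B.one_lt]

theorem lt_of_localMax (F : Front g κ c τ φ φ₁) (B : BirthProps g k p Q κ θ₁) {q : ℝ}
    (h : IsLocalMax φ q) (hq : κ < φ q) : φ (q - τ) < κ := by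
  obtain ⟨hz, hdd⟩ := h.second_deriv_nonpos F.d1 (F.d2 q)
  by_contra hc
  push Not at hc
  rw [hz, B.right _ (B.lt_kappa.le.trans hc) (F.le_k B _)] at hdd
  have := mul_le_mul_of_nonneg_left hc B.p_pos.le
  linarith [B.fixed]

theorem lt_of_localMin (F : Front g κ c τ φ φ₁) (B : BirthProps g k p Q κ θ₁)
    (R : CharRoots k c τ μ₂ μ₁) (hτ : 0 < τ) {q : ℝ}
    (h : IsLocalMin φ q) (hq : φ q < κ) : κ < φ (q - τ) := by
  obtain ⟨t₀, b, h0, hlt, hge, hb0, hb⟩ := F.shape B R hτ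
  obtain ⟨hz, hdd⟩ := h.second_deriv_nonneg F.d1 (F.d2 q)
  have hq0 : t₀ + τ < q := by
    by_contra hc
    push Not at hc
    obtain ⟨ε, hε, hball⟩ := Metric.eventually_nhds_iff.1 h
    have h1 := hball (y := q - ε / 2) (by
      rw [Real.dist_eq, abs_of_neg (by linarith)]; linarith)
    have h2 := F.lt_of_linear R hb0 hb (show q - ε / 2 < q by linarith) hc hz.ge
    linarith
  by_contra hc
  push Not at hc
  have h3 := B.right_ge (hge (q - τ) (by linarith)) (F.le_k B _)
  rw [hz] at hdd
  have := mul_le_mul_of_nonneg_left hc B.p_pos.le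
  linarith [B.fixed]

end Front

/-- The delayed sign rule at extrema: where `σ ψ` has a positive local maximum, it was negative
one delay earlier. -/
def ExtremumRule (τ : ℝ) (ψ : ℝ → ℝ) : Prop :=
  ∀ σ : ℝ, σ = 1 ∨ σ = -1 → ∀ q, IsLocalMax (fun t => σ * ψ t) q → 0 < σ * ψ q →
    σ * ψ (q - τ) < 0

theorem ExtremumRule.exists_between {τ : ℝ} {ψ : ℝ → ℝ} (H : ExtremumRule τ ψ)
    (hc : Continuous ψ) {σ a₁ a₂ a₃ : ℝ} (hσ : σ = 1 ∨ σ = -1) (h12 : a₁ < a₂) (h23 : a₂ < a₃)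
    (h1 : σ * ψ a₁ < 0) (h2 : 0 < σ * ψ a₂) (h3 : σ * ψ a₃ < 0) :
    ∃ q ∈ Ioo a₁ a₃, 0 < σ * ψ q ∧ σ * ψ (q - τ) < 0 := by
  obtain ⟨q, hq, hmax⟩ := (isCompact_Icc (a := a₁) (b := a₃)).exists_isMaxOn
    ⟨a₂, h12.le, h23.le⟩ (f := fun t => σ * ψ t) (by fun_prop)
  have hpos : 0 < σ * ψ q := h2.trans_le (hmax ⟨h12.le, h23.le⟩)
  have hq1 : a₁ < q := lt_of_le_of_ne hq.1 fun h => by rw [h] at h1; linarith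
  have hq3 : q < a₃ := lt_of_le_of_ne hq.2 fun h => by rw [← h] at h3; linarith
  exact ⟨q, ⟨hq1, hq3⟩, hpos, H σ hσ q (hmax.isLocalMax (Icc_mem_nhds hq1 hq3)) hpos⟩

/-- Sign changes of `ψ` cannot accumulate from the right. -/
theorem ExtremumRule.not_accumulate {τ X : ℝ} {ψ : ℝ → ℝ} (H : ExtremumRule τ ψ) (hτ : 0 < τ)
    (hc : Continuous ψ) (hneg : ∀ t ≤ X, ψ t < 0) (y : ℝ)
    (hy : ∀ σ : ℝ, σ = 1 ∨ σ = -1 → ∀ ε > 0, ∃ a ∈ Ioo y (y + ε), 0 < σ * ψ a) : False := by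
  have step : ∀ y, (∀ σ : ℝ, σ = 1 ∨ σ = -1 → ∀ ε > 0, ∃ a ∈ Ioo y (y + ε), 0 < σ * ψ a) →
      ∀ σ : ℝ, σ = 1 ∨ σ = -1 → ∀ ε > 0, ∃ a ∈ Ioo (y - τ) (y - τ + ε), 0 < σ * ψ a := by
    intro y hy σ hσ ε hε
    have hσ' : -σ = 1 ∨ -σ = -1 := by rcases hσ with rfl | rfl <;> simp
    obtain ⟨a₃, ha₃, h3⟩ := hy σ hσ ε hε
    obtain ⟨a₂, ha₂, h2⟩ := hy (-σ) hσ' (a₃ - y) (by linarith [ha₃.1])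
    obtain ⟨a₁, ha₁, h1⟩ := hy σ hσ (a₂ - y) (by linarith [ha₂.1])
    obtain ⟨q, hq, _, hq'⟩ := H.exists_between hc hσ' (a₁ := a₁) (a₂ := a₂) (a₃ := a₃)
      (by linarith [ha₁.2]) (by linarith [ha₂.2]) (by linarith) h2 (by linarith)
    exact ⟨q - τ, ⟨by linarith [hq.1, ha₁.1], by linarith [hq.2, ha₃.2]⟩, by linarith⟩
  have hn : ∀ n : ℕ, ∀ σ : ℝ, σ = 1 ∨ σ = -1 → ∀ ε > 0,
      ∃ a ∈ Ioo (y - n * τ) (y - n * τ + ε), 0 < σ * ψ a := by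
    intro n
    induction n with
    | zero => simpa using hy
    | succ n ih =>
      have := step _ ih
      rwa [show y - (n + 1 : ℕ) * τ = y - n * τ - τ by push_cast; ring]
  obtain ⟨n, hn'⟩ := exists_nat_ge ((y + 1 - X) / τ)
  rw [div_le_iff₀ hτ] at hn'
  obtain ⟨a, ha, hpos⟩ := hn n 1 (Or.inl rfl) 1 one_pos
  linarith [hneg a (by linarith [ha.2])]

/-- No three sign changes within a window of length `τ`. -/
theorem ExtremumRule.no_pattern {τ X : ℝ} {ψ : ℝ → ℝ} (H : ExtremumRule τ ψ) (hτ : 0 < τ)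
    (hc : Continuous ψ) (hneg : ∀ t ≤ X, ψ t < 0) {σ x₀ x₁ x₂ x₃ : ℝ} (hσ : σ = 1 ∨ σ = -1)
    (h01 : x₀ < x₁) (h12 : x₁ < x₂) (h23 : x₂ < x₃) (h30 : x₃ ≤ x₀ + τ)
    (h0 : 0 < σ * ψ x₀) (h1 : σ * ψ x₁ < 0) (h2 : 0 < σ * ψ x₂) (h3 : σ * ψ x₃ < 0) : False := by
  set Z : Set ℝ := {y | ∃ σ x₁ x₂ x₃ : ℝ, (σ = 1 ∨ σ = -1) ∧ y < x₁ ∧ x₁ < x₂ ∧ x₂ < x₃ ∧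
    x₃ ≤ y + τ ∧ 0 < σ * ψ y ∧ σ * ψ x₁ < 0 ∧ 0 < σ * ψ x₂ ∧ σ * ψ x₃ < 0} with hZ
  have hne : Z.Nonempty := ⟨x₀, σ, x₁, x₂, x₃, hσ, h01, h12, h23, h30, h0, h1, h2, h3⟩
  have hstep : ∀ y ∈ Z, ∃ y' ∈ Z, y' < y ∧ ψ y * ψ y' < 0 := by
    rintro y ⟨σ, x₁, x₂, x₃, hσ, h01, h12, h23, h30, h0, h1, h2, h3⟩
    have hσ' : -σ = 1 ∨ -σ = -1 := by rcases hσ with rfl | rfl <;> simp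
    obtain ⟨q, hq, hqp, hqn⟩ := H.exists_between hc hσ h12 h23 h1 h2 h3
    refine ⟨q - τ, ⟨-σ, y, x₁, q, hσ', by linarith [hq.2], h01, hq.1, by linarith,
      by linarith, by linarith, by linarith, by linarith⟩, by linarith [hq.2], ?_⟩
    rcases hσ with rfl | rfl <;> nlinarith
  have hlb : ∀ y ∈ Z, X < y := by
    intro y hy
    obtain ⟨y', hy', hlt, hs⟩ := hstep y hy
    by_contra hc
    push Not at hc
    have h1 := hneg y hc
    have h2 := hneg y' (by linarith)
    nlinarith
  have hbd : BddBelow Z := ⟨X, fun y hy => (hlb y hy).le⟩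
  have hgt : ∀ y ∈ Z, sInf Z < y := by
    intro y hy
    obtain ⟨y', hy', hlt, _⟩ := hstep y hy
    exact (csInf_le hbd hy').trans_lt hlt
  refine H.not_accumulate hτ hc hneg (sInf Z) fun σ hσ ε hε => ?_
  obtain ⟨y, hy, hlt⟩ := exists_lt_of_csInf_lt hne (show sInf Z < sInf Z + ε by linarith)
  obtain ⟨y', hy', hlt', hs⟩ := hstep y hy
  rcases lt_trichotomy (σ * ψ y) 0 with h | h | h
  · refine ⟨y', ⟨hgt _ hy', hlt'.trans hlt⟩, ?_⟩
    rcases hσ with rfl | rfl <;> nlinarith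
  · exfalso
    have : ψ y = 0 := by rcases hσ with rfl | rfl <;> linarith
    rw [this] at hs; linarith
  · exact ⟨y, ⟨hgt _ hy, hlt⟩, h⟩

/-- No three sign changes among the window values followed by the final slope. -/
theorem ExtremumRule.no_pattern_slope {τ X : ℝ} {ψ : ℝ → ℝ} (H : ExtremumRule τ ψ) (hτ : 0 < τ)
    (hc : Continuous ψ) (hneg : ∀ t ≤ X, ψ t < 0) {σ s₀ s₁ s₂ t d : ℝ} (hσ : σ = 1 ∨ σ = -1)
    (h01 : s₀ < s₁) (h12 : s₁ < s₂) (h2t : s₂ ≤ t) (ht0 : t ≤ s₀ + τ)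
    (h0 : 0 < σ * ψ s₀) (h1 : σ * ψ s₁ < 0) (h2 : 0 < σ * ψ s₂) (hd : HasDerivAt ψ d t)
    (hdn : σ * d < 0) : False := by
  have hσ' : -σ = 1 ∨ -σ = -1 := by rcases hσ with rfl | rfl <;> simp
  obtain ⟨q, hq, hmax⟩ := (isCompact_Icc (a := s₁) (b := t)).exists_isMaxOn
    ⟨s₂, h12.le, h2t⟩ (f := fun t => σ * ψ t) (by fun_prop)
  have hpos : 0 < σ * ψ q := h2.trans_le (hmax ⟨h12.le, h2t⟩)
  have hq1 : s₁ < q := lt_of_le_of_ne hq.1 fun h => by rw [h] at h1; linarith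
  have hqt : q < t := by
    refine lt_of_le_of_ne hq.2 fun h => ?_
    subst h
    have hs := (hasDerivAt_iff_tendsto_slope.1 (hd.const_mul σ)).eventually (gt_mem_nhds hdn)
    rw [eventually_nhdsWithin_iff] at hs
    obtain ⟨ε, hε, hball⟩ := Metric.eventually_nhds_iff.1 hs
    set r := max (q - ε / 2) s₁ with hr
    have hrq : r < q := max_lt (by linarith) hq1
    have hrε : q - ε / 2 ≤ r := le_max_left _ _
    have h3 := hball (y := r) (by
      rw [Real.dist_eq, abs_of_neg (by linarith)]; linarith) hrq.ne
    rw [slope_def_field] at h3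
    have h4 : σ * ψ r ≤ σ * ψ q := hmax ⟨le_max_right _ _, hrq.le⟩
    have := div_nonneg_of_nonpos (show σ * ψ r - σ * ψ q ≤ 0 by linarith)
      (show r - q ≤ 0 by linarith)
    linarith
  have hqn := H σ hσ q (hmax.isLocalMax (Icc_mem_nhds hq1 hqt)) hpos
  exact H.no_pattern hτ hc hneg (σ := -σ) (x₀ := q - τ) (x₁ := s₀) (x₂ := s₁) (x₃ := q) hσ'
    (by linarith) h01 hq1 (by linarith) (by linarith) (by linarith) (by linarith) (by linarith)

theorem Front.extremumRule {g : ℝ → ℝ} {k p Q κ θ₁ c τ μ₂ μ₁ : ℝ} {φ φ₁ : ℝ → ℝ}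
    (F : Front g κ c τ φ φ₁) (B : BirthProps g k p Q κ θ₁)
    (R : CharRoots k c τ μ₂ μ₁) (hτ : 0 < τ) : ExtremumRule τ (fun t => φ t - κ) := by
  rintro σ (rfl | rfl) q hq hpos
  · have h : IsLocalMax φ q := by
      filter_upwards [hq] with s hs
      linarith
    have := F.lt_of_localMax B h (by linarith)
    linarith
  · have h : IsLocalMin φ q := by
      filter_upwards [hq] with s hs
      linarith
    have := F.lt_of_localMin B R hτ h (by linarith)
    linarith

/-- A positive solution of `u'' = c u' + u + p u(· - τ)` bounded on a half-line cannot exist when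
the characteristic equation has no negative real root, quantitatively. -/
theorem no_bounded_positive {u u₁ : ℝ → ℝ} {c τ p η T C : ℝ} (hτ : 0 < τ) (hp : 0 < p)
    (hc : 0 < c) (hη : 0 < η)
    (hδ : ∀ x ≥ 0, η * (c + 2 * x + η) ≤ p * exp (x * τ) + 1 - c * x - x ^ 2)
    (h1 : ∀ t, HasDerivAt u (u₁ t) t)
    (h2 : ∀ t ≥ T, HasDerivAt u₁ (c * u₁ t + u t + p * u (t - τ)) t)
    (hpos : ∀ t ≥ T - τ, 0 < u t) (hC : ∀ t ≥ T, u t ≤ C) : False := by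
  have hu1 : ∀ t ≥ T, u₁ t ≤ 0 := by
    intro t ht
    have := deriv_le_of_bounded (c := c) (fun t _ => h1 t) h2
      (fun t ht => by
        have := mul_pos hp (hpos (t - τ) (by linarith))
        linarith) hC t ht
    exact this.trans (mul_nonpos_of_nonpos_of_nonneg (negRoot_nonpos zero_le_one)
      (hpos t (by linarith)).le)
  have hdec : ∀ a b, T ≤ a → a ≤ b → u b ≤ u a := by
    intro a b ha hab
    have := le_of_hasDerivAt_nonneg (f := fun t => -u t) (f' := fun t => -u₁ t) hab
      (fun s _ => (h1 s).fun_neg) (fun s hs => by linarith [hu1 s (ha.trans hs.1)])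
    linarith
  have hstep : ∀ x ≥ 0, ∀ S ≥ T, (∀ t ≥ S, u₁ t ≤ -x * u t) →
      ∀ t ≥ S + τ, u₁ t ≤ -(x + η) * u t := by
    intro x hx S hS h t₁ ht₁
    by_contra hcon
    push Not at hcon
    have hdelay : ∀ t ≥ S + τ, exp (x * τ) * u t ≤ u (t - τ) := by
      intro t ht
      have := mul_exp_le_of_hasDerivAt (w := fun t => -u t) (w' := fun t => -u₁ t) (β := -x)
        (a := t - τ) (b := t) (by linarith) (fun s _ => (h1 s).fun_neg)
        (fun s hs => by linarith [h s (by linarith [hs.1])])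
      have h3 := mul_le_mul_of_nonneg_right this (exp_pos (x * τ)).le
      rw [mul_assoc, ← exp_add, show -x * (t - (t - τ)) + x * τ = 0 by ring, exp_zero] at h3
      linarith
    set γ := c + x + η with hγ
    have hγ0 : 0 < γ := by positivity
    set q := u₁ t₁ + (x + η) * u t₁ with hq
    have hq0 : 0 < q := by linarith
    have hgrow : ∀ t ≥ t₁, q * exp (γ * (t - t₁)) ≤ u₁ t + (x + η) * u t := by
      intro t ht
      exact mul_exp_le_of_hasDerivAt (w := fun t => u₁ t + (x + η) * u t)
        (w' := fun t => c * u₁ t + u t + p * u (t - τ) + (x + η) * u₁ t) (β := γ) ht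
        (fun s hs => (h2 s (by linarith [hs.1])).fun_add ((h1 s).const_mul (x + η)))
        (fun s hs => by
          have hs' : S + τ ≤ s := ht₁.trans hs.1
          have h3 := mul_le_mul_of_nonneg_left (hdelay s hs') hp.le
          have h4 := mul_le_mul_of_nonneg_right (hδ x hx) (hpos s (by linarith)).le
          simp only [hγ]
          linear_combination h3 + h4)
    set t := t₁ + (x + η) * |C| / (q * γ) with ht
    have hadd : 0 ≤ (x + η) * |C| / (q * γ) := by positivity
    have h5 := hgrow t (by linarith)
    have h6 := add_one_le_exp (γ * (t - t₁))
    have h7 : q * (γ * (t - t₁)) = (x + η) * |C| := by rw [ht]; field_simp; ring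
    have h8 := mul_le_mul_of_nonneg_left h6 hq0.le
    have h9 : (x + η) * u t ≤ (x + η) * |C| := mul_le_mul_of_nonneg_left
      ((hC t (by linarith)).trans (le_abs_self C)) (by positivity)
    have h10 := hu1 t (by linarith)
    linarith
  have hrate : ∀ n : ℕ, ∀ t ≥ T + n * τ, u₁ t ≤ -(n * η) * u t := by
    intro n
    induction n with
    | zero => intro t ht; simpa using hu1 t (by simpa using ht)
    | succ n ih =>
      intro t ht
      have := hstep (n * η) (by positivity) (T + n * τ)
        (by have : 0 ≤ (n : ℝ) * τ := by positivity
            linarith) ih t (by push_cast at ht; linarith)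
      push_cast
      linarith
  set D := p * (τ / 2) * exp (-(c * (τ / 2))) with hD
  have hD0 : 0 < D := by positivity
  have hslope : ∀ t ≥ T + τ, D * u (t - τ / 2) ≤ -u₁ t := by
    intro t ht
    have := add_mul_le_of_hasDerivAt (f := fun s => u₁ s * exp (-(c * s)))
      (m := p * u (t - τ / 2) * exp (-(c * (t + τ / 2)))) (a := t) (b := t + τ / 2)
      (by linarith) (fun s hs => hasDerivAt_mul_exp_neg (h2 s (by linarith [hs.1])))
      (fun s hs => by
        have h3 : u (t - τ / 2) ≤ u (s - τ) := hdec _ _ (by linarith [hs.1]) (by linarith [hs.2])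
        have h4 : exp (-(c * (t + τ / 2))) ≤ exp (-(c * s)) :=
          exp_le_exp.2 (by nlinarith [hs.2])
        have h5 : 0 < u (t - τ / 2) := hpos _ (by linarith)
        refine mul_le_mul ?_ h4 (exp_pos _).le ?_
        · have := mul_le_mul_of_nonneg_left h3 hp.le
          linarith [hpos s (by linarith [hs.1])]
        · have := mul_pos hp (hpos (s - τ) (by linarith [hs.1]))
          linarith [hpos s (by linarith [hs.1])])
    have h6 : u₁ (t + τ / 2) * exp (-(c * (t + τ / 2))) ≤ 0 :=
      mul_nonpos_of_nonpos_of_nonneg (hu1 _ (by linarith)) (exp_pos _).le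
    have e : exp (-(c * (t + τ / 2))) = exp (-(c * (τ / 2))) * exp (-(c * t)) := by
      rw [← exp_add]; congr 1; ring
    rw [e] at this h6
    have h7 : D * u (t - τ / 2) * exp (-(c * t)) ≤ -u₁ t * exp (-(c * t)) := by
      rw [hD]; linarith
    exact le_of_mul_le_mul_right h7 (exp_pos _)
  have hquarter : ∀ t ≥ T + 2 * τ, D * (τ / 4) * u (t - τ / 2) ≤ u (t - τ / 4) := by
    intro t ht
    have := add_mul_le_of_hasDerivAt (f := fun s => -u s) (f' := fun s => -u₁ s)
      (m := D * u (t - τ / 2)) (a := t - τ / 4) (b := t) (by linarith)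
      (fun s _ => (h1 s).fun_neg)
      (fun s hs => by
        have h3 := hslope s (by linarith [hs.1])
        have h4 : u (t - τ / 2) ≤ u (s - τ / 2) := hdec _ _ (by linarith [hs.1]) (by linarith [hs.2])
        have := mul_le_mul_of_nonneg_left h4 hD0.le
        linarith)
    linarith [hpos t (by linarith)]
  obtain ⟨n, hn⟩ := exists_nat_gt (1 / (D * (τ / 4)) / (η * (τ / 4)))
  rw [div_lt_iff₀ (by positivity), div_lt_iff₀ (by positivity)] at hn
  set t := T + n * τ + 2 * τ with ht
  have hnτ : 0 ≤ (n : ℝ) * τ := by positivity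
  have h3 := hquarter t (by linarith)
  have h4 := mul_exp_le_of_hasDerivAt (w := fun t => -u t) (w' := fun t => -u₁ t) (β := -(n * η))
    (a := t - τ / 2) (b := t - τ / 4) (by linarith) (fun s _ => (h1 s).fun_neg)
    (fun s hs => by linarith [hrate n s (by linarith [hs.1])])
  have hup : 0 < u (t - τ / 2) := hpos _ (by linarith)
  have h5 : D * (τ / 4) ≤ exp (-(n * η) * (t - τ / 4 - (t - τ / 2))) := by
    refine le_of_mul_le_mul_right ?_ hup
    linarith
  have e : -(n * η) * (t - τ / 4 - (t - τ / 2)) = -(n * (η * (τ / 4))) := by ring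
  rw [e] at h5
  have h6 := add_one_le_exp (n * (η * (τ / 4)))
  have h7 : exp (-(n * (η * (τ / 4)))) * exp (n * (η * (τ / 4))) = 1 := by
    rw [← exp_add]; simp
  have h8 := mul_le_mul_of_nonneg_right h5 (exp_pos (n * (η * (τ / 4)))).le
  rw [h7] at h8
  have h9 : 0 < D * (τ / 4) := by positivity
  nlinarith

namespace Front
variable {g : ℝ → ℝ} {k p Q κ θ₁ c τ : ℝ} {φ φ₁ : ℝ → ℝ}

/-- Eventually the delayed value lies in the rightmost linear piece. -/
theorem eventually_right (F : Front g κ c τ φ φ₁) (B : BirthProps g k p Q κ θ₁) :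
    ∃ T, ∀ t ≥ T, θ₁ ≤ φ t := by
  obtain ⟨T, hT⟩ := eventually_atTop.1 (F.top.eventually (lt_mem_nhds B.lt_kappa))
  exact ⟨T, fun t ht => (hT t ht).le⟩

theorem hasDerivAt_right (F : Front g κ c τ φ φ₁) (B : BirthProps g k p Q κ θ₁) (σ : ℝ) {t : ℝ}
    (ht : θ₁ ≤ φ (t - τ)) :
    HasDerivAt (fun t => σ * φ₁ t)
      (c * (σ * φ₁ t) + σ * (φ t - κ) + p * (σ * (φ (t - τ) - κ))) t := by
  refine ((F.d2 t).const_mul σ).congr_deriv ?_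
  rw [B.right _ ht (F.le_k B _)]
  linear_combination σ * B.fixed

/-- A front never stays at `κ`. -/
theorem not_eventually_const (F : Front g κ c τ φ φ₁) (B : BirthProps g k p Q κ θ₁) (hτ : 0 < τ)
    (s : ℝ) (hs : ∀ t ≥ s, φ t = κ) : False := by
  have step : ∀ s, (∀ t ≥ s, φ t = κ) → ∀ t ≥ s - τ / 2, φ t = κ := by
    intro s hs
    have halt : ∀ r > s - τ, φ r = κ ∨ φ r ≤ 1 := by
      intro r hr
      have hev : φ =ᶠ[𝓝 (r + τ)] fun _ => κ := by
        filter_upwards [Ioi_mem_nhds (show s < r + τ by linarith)] with x hx using hs x (le_of_lt hx)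
      have hz : ∀ᶠ x in 𝓝 (r + τ), φ₁ x = 0 := by
        filter_upwards [eventually_eventually_nhds.2 hev] with x hx
        exact (F.d1 x).unique ((hasDerivAt_const x κ).congr_of_eventuallyEq hx)
      have hdd := (F.d2 (r + τ)).unique ((hasDerivAt_const (r + τ) (0:ℝ)).congr_of_eventuallyEq hz)
      rw [hz.self_of_nhds, hev.self_of_nhds, show r + τ - τ = r by ring] at hdd
      rcases le_total (φ r) 1 with h | h
      · exact Or.inr h
      left
      rcases le_total (φ r) θ₁ with h' | h'
      · have h3 := B.mid _ h h'
        have h4 := mul_le_mul_of_nonneg_left h' B.p_pos.le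
        have h5 := mul_lt_mul_of_pos_left B.lt_kappa B.p_pos
        linarith [B.fixed]
      · rw [B.right _ h' (F.le_k B _)] at hdd
        have h6 : p * (φ r - κ) = 0 := by linarith [B.fixed]
        have := (mul_eq_zero.1 h6).resolve_left B.p_pos.ne'
        linarith
    intro t ht
    rcases le_total s t with h | h
    · exact hs t h
    refine (halt t (by linarith)).resolve_right fun h1 => ?_
    obtain ⟨x, hx, hxe⟩ := intermediate_value_Icc h F.continuous.continuousOn
      (show θ₁ ∈ Icc (φ t) (φ s) from
        ⟨by linarith [B.one_lt], by rw [hs s le_rfl]; exact B.lt_kappa.le⟩)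
    rcases halt x (by linarith [hx.1]) with h2 | h2
    · linarith [B.lt_kappa]
    · linarith [B.one_lt]
  have hn : ∀ n : ℕ, ∀ t ≥ s - n * (τ / 2), φ t = κ := by
    intro n
    induction n with
    | zero => simpa using hs
    | succ n ih =>
      intro t ht
      exact step _ ih t (by push_cast at ht; linarith)
  have hall : ∀ t, φ t = κ := by
    intro t
    obtain ⟨n, hn'⟩ := exists_nat_ge ((s - t) / (τ / 2))
    rw [div_le_iff₀ (by positivity)] at hn'
    exact hn n t (by linarith)
  obtain ⟨T, hT⟩ := F.exists_linear
  linarith [hT T le_rfl, hall T, B.one_lt, B.lt_kappa]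

/-- Without negative characteristic roots, a front is not eventually on one side of `κ`. -/
theorem not_one_sided (F : Front g κ c τ φ φ₁) (B : BirthProps g k p Q κ θ₁) (hτ : 0 < τ)
    (hc : 0 < c) {η : ℝ} (hη : 0 < η)
    (hδ : ∀ x ≥ 0, η * (c + 2 * x + η) ≤ p * exp (x * τ) + 1 - c * x - x ^ 2)
    {σ : ℝ} (hσ : σ = 1 ∨ σ = -1) (S : ℝ) : ∃ t ≥ S, σ * (φ t - κ) < 0 := by
  by_contra hcon
  push Not at hcon
  obtain ⟨Y, hY⟩ := F.eventually_right B
  set T := max S Y + τ with hT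
  have hTS : S ≤ T - τ := by rw [hT]; linarith [le_max_left S Y]
  have hTY : Y ≤ T - τ := by rw [hT]; linarith [le_max_right S Y]
  have h1 : ∀ t, HasDerivAt (fun t => σ * (φ t - κ)) (σ * φ₁ t) t := fun t =>
    ((F.d1 t).sub_const κ).const_mul σ
  have h2 : ∀ t ≥ T, HasDerivAt (fun t => σ * φ₁ t)
      (c * (σ * φ₁ t) + σ * (φ t - κ) + p * (σ * (φ (t - τ) - κ))) t := fun t ht =>
    F.hasDerivAt_right B σ (hY _ (by linarith))
  have hC : ∀ t, σ * (φ t - κ) ≤ k := by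
    intro t
    have := F.le_k B t
    have := F.pos t
    have := B.kappa_lt
    have := B.one_lt
    have := B.lt_kappa
    rcases hσ with rfl | rfl <;> linarith
  by_cases hz : ∃ s ≥ T, σ * (φ s - κ) = 0
  · obtain ⟨s, hs, hs0⟩ := hz
    refine F.not_eventually_const B hτ s fun t ht => ?_
    have := le_mul_exp_of_bounded (c := c) (a := s) (fun t _ => h1 t) (fun t ht => h2 t (hs.trans ht))
      (fun t ht => by
        have := mul_nonneg B.p_pos.le (hcon (t - τ) (by linarith))
        linarith) (fun t _ => hC t) t ht
    rw [hs0, zero_mul] at this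
    have h3 := hcon t (by linarith)
    rcases hσ with rfl | rfl <;> linarith
  · push Not at hz
    exact no_bounded_positive (T := T + τ) hτ B.p_pos hc hη hδ h1
      (fun t ht => h2 t (by linarith))
      (fun t ht => lt_of_le_of_ne (hcon t (by linarith)) (hz t (by linarith)).symm)
      (fun t _ => hC t)

/-- Without negative characteristic roots, the window together with the slope changes sign. -/
theorem window_changes_sign (F : Front g κ c τ φ φ₁) (B : BirthProps g k p Q κ θ₁) (hτ : 0 < τ)
    (hc : 0 < c) {η : ℝ} (hη : 0 < η)
    (hδ : ∀ x ≥ 0, η * (c + 2 * x + η) ≤ p * exp (x * τ) + 1 - c * x - x ^ 2) :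
    ∃ a, ∀ t ≥ a, ∀ σ : ℝ, σ = 1 ∨ σ = -1 →
      (∀ s ∈ Icc (t - τ) t, 0 ≤ σ * (φ s - κ)) → σ * φ₁ t < 0 := by
  obtain ⟨Y, hY⟩ := F.eventually_right B
  refine ⟨Y + τ, fun t ht σ hσ hw => ?_⟩
  by_contra hcon
  push Not at hcon
  have hn : ∀ n : ℕ, (∀ s ∈ Icc (t - τ) (t + n * τ), 0 ≤ σ * (φ s - κ)) ∧
      0 ≤ σ * φ₁ (t + n * τ) := by
    intro n
    induction n with
    | zero =>
      simp only [Nat.cast_zero, zero_mul, add_zero]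
      exact ⟨hw, hcon⟩
    | succ n ih =>
      have hnτ : 0 ≤ (n : ℝ) * τ := by positivity
      have key := forward_nonneg (u := fun t => σ * (φ t - κ)) (a := c) (P := 1)
        (X := t + n * τ) (Y := t + n * τ + τ) zero_le_one
        (fun s _ => ((F.d1 s).sub_const κ).const_mul σ)
        (fun s hs => F.hasDerivAt_right B σ (hY (s - τ) (by linarith [hs.1])))
        (fun s hs => by
          have := mul_nonneg B.p_pos.le (ih.1 (s - τ) ⟨by linarith [hs.1], by linarith [hs.2]⟩)
          linarith)
        (ih.1 _ ⟨by linarith, le_rfl⟩) ih.2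
      rw [show t + (n + 1 : ℕ) * τ = t + n * τ + τ by push_cast; ring]
      refine ⟨fun s hs => ?_, (key _ ⟨by linarith, le_rfl⟩).2⟩
      rcases le_total s (t + n * τ) with h | h
      · exact ih.1 s ⟨hs.1, h⟩
      · exact (key s ⟨h, hs.2⟩).1
  obtain ⟨s, hs, hneg⟩ := F.not_one_sided B hτ hc hη hδ hσ t
  obtain ⟨n, hn'⟩ := exists_nat_ge ((s - t) / τ)
  rw [div_le_iff₀ hτ] at hn'
  linarith [(hn n).1 s ⟨by linarith, by linarith⟩]

end Front

theorem nonpos_of_exp_growth {w w' : ℝ → ℝ} {a ν A : ℝ} (hν : 0 < ν)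
    (hw : ∀ t ≥ a, HasDerivAt w (w' t) t) (h : ∀ t ≥ a, ν * w t ≤ w' t) (hA : ∀ t ≥ a, w t ≤ A) :
    w a ≤ 0 := by
  by_contra hcon
  push Not at hcon
  have hadd : 0 ≤ |A| / (w a * ν) := by positivity
  have h1 := mul_exp_le_of_hasDerivAt (w := w) (a := a) (b := a + |A| / (w a * ν)) (by linarith)
    (fun s hs => hw s hs.1) (fun s hs => h s hs.1)
  have h2 := add_one_le_exp (ν * (a + |A| / (w a * ν) - a))
  have h3 := mul_le_mul_of_nonneg_left h2 hcon.le
  have h4 : w a * (ν * (a + |A| / (w a * ν) - a)) = |A| := by field_simp; ring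
  linarith [hA (a + |A| / (w a * ν)) (by linarith), le_abs_self A]

theorem expWindow_anti_rate {u : ℝ → ℝ} (hu : Continuous u) {l ν τ t : ℝ} (hτ : 0 ≤ τ)
    (hl : l ≤ ν) (h : ∀ s ∈ Icc (t - τ) t, 0 ≤ u s) :
    expWindow ν τ u t ≤ expWindow l τ u t := by
  refine intervalIntegral.integral_mono_on (by linarith)
    ((by fun_prop : Continuous fun s => exp (ν * (t - τ - s)) * u s).intervalIntegrable _ _)
    ((by fun_prop : Continuous fun s => exp (l * (t - τ - s)) * u s).intervalIntegrable _ _)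
    fun s hs => mul_le_mul_of_nonneg_right (exp_le_exp.2 ?_) (h s hs)
  nlinarith [hs.1]

theorem expWindow_le_const {u : ℝ → ℝ} (hu : Continuous u) {z τ C : ℝ} (hz : z ≠ 0) (hτ : 0 ≤ τ)
    (h : ∀ s, u s ≤ C) (t : ℝ) : expWindow z τ u t ≤ C * ((1 - exp (-(z * τ))) / z) := by
  have h1 := expWindow_mono (v := fun s => C * exp (0 * s)) (z := z) (t := t) hu (by fun_prop) hτ
    (fun s _ => by simpa using h s)
  rw [expWindow_const_mul, expWindow_exp hz.symm] at h1
  refine h1.trans_eq ?_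
  simp only [zero_mul, exp_zero, neg_zero, mul_one, zero_sub, div_neg]
  rw [← neg_div, neg_sub]

theorem expWindow_neg (z τ : ℝ) (u : ℝ → ℝ) (t : ℝ) :
    expWindow z τ (fun s => -u s) t = -expWindow z τ u t := by
  simpa using expWindow_const_mul z τ (-1) u t

namespace Front
variable {g : ℝ → ℝ} {k p Q κ θ₁ c τ μ₂ μ₁ l ν : ℝ} {φ φ₁ : ℝ → ℝ}

/-- The characteristic functional of the linearization at `κ`. -/
def kappaFunctional (p κ c τ : ℝ) (φ φ₁ : ℝ → ℝ) (z t : ℝ) : ℝ :=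
  φ₁ t + (z - c) * (φ t - κ) - -p * expWindow z τ (fun s => φ s - κ) t

theorem hasDerivAt_kappaFunctional (F : Front g κ c τ φ φ₁) (B : BirthProps g k p Q κ θ₁) {z : ℝ}
    (hz : z ^ 2 - c * z - 1 + -p * exp (-(z * τ)) = 0) (t : ℝ) :
    HasDerivAt (kappaFunctional p κ c τ φ φ₁ z) (z * kappaFunctional p κ c τ φ φ₁ z t -
      (g (φ (t - τ)) - Q + p * φ (t - τ))) t := by
  refine hasDerivAt_charFunctional (u := fun s => φ s - κ)
    (F.continuous.sub continuous_const) hz ((F.d1 t).sub_const κ)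
    ((F.d2 t).congr_deriv ?_)
  linear_combination B.fixed

theorem kappaFunctional_bounds (F : Front g κ c τ φ φ₁) (B : BirthProps g k p Q κ θ₁) {z : ℝ}
    (hτ : 0 < τ) (hz : z ≠ 0) :
    ∃ A, ∀ t, |kappaFunctional p κ c τ φ φ₁ z t| ≤ A := by
  have hψ : ∀ t, |φ t - κ| ≤ k := fun t => abs_le.2
    ⟨by linarith [F.pos t, B.kappa_lt], by linarith [F.le_k B t, B.one_lt, B.lt_kappa]⟩
  have hcont : Continuous fun s => φ s - κ := F.continuous.sub continuous_const
  set W := k * ((1 - exp (-(z * τ))) / z)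
  have hW : ∀ t, |expWindow z τ (fun s => φ s - κ) t| ≤ W := by
    intro t
    have h1 := expWindow_le_const hcont hz hτ.le (fun s => (abs_le.1 (hψ s)).2) t
    have h2 := expWindow_le_const (C := k) hcont.neg hz hτ.le
      (fun s => by have := (abs_le.1 (hψ s)).1; simp only [Pi.neg_apply]; linarith) t
    have h3 := expWindow_neg z τ (fun s => φ s - κ) t
    have h4 : expWindow z τ (fun s => -(φ s - κ)) t ≤ W := h2
    exact abs_le.2 ⟨by linarith, h1⟩
  have hn : negRoot c 1 ≤ 0 := negRoot_nonpos zero_le_one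
  have h1 : ∀ t, |φ₁ t| ≤ -negRoot c 1 * k := by
    intro t
    refine abs_le.2 ⟨?_, ?_⟩
    · have := F.le_deriv B t
      nlinarith [F.le_k B t]
    · have := F.deriv_le B t
      nlinarith [F.pos t]
  refine ⟨-negRoot c 1 * k + |z - c| * k + p * W, fun t => ?_⟩
  have e : kappaFunctional p κ c τ φ φ₁ z t =
      φ₁ t + (z - c) * (φ t - κ) + p * expWindow z τ (fun s => φ s - κ) t := by
    simp only [kappaFunctional]; ring
  rw [e]
  refine (abs_add_three _ _ _).trans ?_
  rw [abs_mul, abs_mul, abs_of_pos B.p_pos]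
  exact add_le_add (add_le_add (h1 t) (mul_le_mul_of_nonneg_left (hψ t) (abs_nonneg _)))
    (mul_le_mul_of_nonneg_left (hW t) B.p_pos.le)

theorem residual_nonneg (F : Front g κ c τ φ φ₁) (B : BirthProps g k p Q κ θ₁) {t : ℝ}
    (h : 1 ≤ φ t) : 0 ≤ g (φ t) - Q + p * φ t := by
  linarith [B.right_ge h (F.le_k B t)]

/-- The functional at the positive root is eventually nonnegative. -/
theorem kappaFunctional_nonneg (F : Front g κ c τ φ φ₁) (B : BirthProps g k p Q κ θ₁)
    (hτ : 0 < τ) (hν : 0 < ν) (hroot : ν ^ 2 - c * ν - 1 + -p * exp (-(ν * τ)) = 0) :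
    ∃ S, ∀ t ≥ S, 0 ≤ kappaFunctional p κ c τ φ φ₁ ν t := by
  obtain ⟨Y, hY⟩ := F.eventually_right B
  obtain ⟨A, hA⟩ := F.kappaFunctional_bounds B hτ hν.ne'
  refine ⟨Y + τ, fun t ht => ?_⟩
  have := nonpos_of_exp_growth (w := fun t => -kappaFunctional p κ c τ φ φ₁ ν t) (a := t) hν
    (fun s _ => (F.hasDerivAt_kappaFunctional B hroot s).fun_neg)
    (fun s hs => by
      have h1 := F.residual_nonneg B (t := s - τ)
        (B.one_lt.le.trans (hY _ (by linarith)))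
      linarith)
    (fun s _ => (neg_le_abs _).trans (hA s))
  linarith

/-- The functional at the negative root becomes and stays negative, with the precise rate. -/
theorem kappaFunctional_neg (F : Front g κ c τ φ φ₁) (B : BirthProps g k p Q κ θ₁)
    (R : CharRoots k c τ μ₂ μ₁) (hτ : 0 < τ) (hl : l < 0)
    (hroot : l ^ 2 - c * l - 1 + -p * exp (-(l * τ)) = 0)
    (hbig : Q * (μ₂ - l) < -l * (k + p)) :
    ∃ C > 0, ∃ T, ∀ t ≥ T, kappaFunctional p κ c τ φ φ₁ l t ≤ -C * exp (l * t) := by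
  obtain ⟨t₀, b, ht₀, hlt, hge, hb, hlin⟩ := F.shape B R hτ
  obtain ⟨A, hA⟩ := F.kappaFunctional_bounds B hτ hl.ne
  set T := t₀ + τ with hT
  set E := kappaFunctional p κ c τ φ φ₁ l with hE
  have hgap : 0 < μ₂ - l := by linarith [R.pos]
  have hkp : 0 < k + p := by linarith [B.one_lt_k, B.p_pos]
  have hlow : ∀ s ≤ t₀, exp (μ₂ * (s - t₀)) ≤ φ s := by
    intro s hs
    have := mul_exp_le_of_hasDerivAt (w := fun t => -φ t) (w' := fun t => -φ₁ t) (β := μ₂)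
      (a := s) (b := t₀) hs (fun t _ => (F.d1 t).fun_neg)
      (fun t ht => by
        have h1 := hlin t (by linarith [ht.2])
        have := mul_pos hb (exp_pos (μ₁ * t))
        linarith)
    rw [ht₀] at this
    have h2 : 1 ≤ φ s * exp (μ₂ * (t₀ - s)) := by linarith
    have h3 := mul_le_mul_of_nonneg_right h2 (exp_pos (μ₂ * (s - t₀))).le
    rwa [mul_assoc, ← exp_add, show μ₂ * (t₀ - s) + μ₂ * (s - t₀) = 0 by ring, exp_zero, one_mul,
      mul_one] at h3
  set w : ℝ → ℝ := fun t => E t + (k + p) / (μ₂ - l) * exp (μ₂ * (t - T)) + Q / l with hw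
  have hQ : 0 < Q := by nlinarith [B.fixed, B.one_lt, B.lt_kappa, B.p_pos]
  have hwd : ∀ t, HasDerivAt w (l * E t - (g (φ (t - τ)) - Q + p * φ (t - τ)) +
      (k + p) / (μ₂ - l) * (μ₂ * exp (μ₂ * (t - T)))) t := by
    intro t
    have h1 : HasDerivAt (fun t => exp (μ₂ * (t - T))) (exp (μ₂ * (t - T)) * (μ₂ * 1)) t :=
      (((hasDerivAt_id t).sub_const T).const_mul μ₂).exp
    exact (((F.hasDerivAt_kappaFunctional B hroot t).fun_add
      (h1.const_mul ((k + p) / (μ₂ - l)))).add_const (Q / l)).congr_deriv (by ring)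
  have hwA : ∀ t ≤ T, w t ≤ A + (k + p) / (μ₂ - l) := by
    intro t ht
    have h1 : exp (μ₂ * (t - T)) ≤ 1 := exp_le_one_iff.2 (by nlinarith [R.pos])
    have h2 := mul_le_mul_of_nonneg_left h1 (div_pos hkp hgap).le
    have h3 : Q / l ≤ 0 := div_nonpos_of_nonneg_of_nonpos hQ.le hl.le
    have h4 := (le_abs_self _).trans (hA t)
    simp only [hw]
    linarith
  have hwT : ∀ a ≤ T, w T ≤ w a * exp (l * (T - a)) := by
    intro a ha
    have := mul_exp_le_of_hasDerivAt (w := fun t => -w t) (β := l) ha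
      (fun t _ => (hwd t).fun_neg)
      (fun t ht => by
        have h1 := B.lin (φ (t - τ)) (F.pos _).le (by
          rcases eq_or_lt_of_le (show t - τ ≤ t₀ by linarith [ht.2]) with h | h
          · rw [h, ht₀]
          · exact (hlt _ h).le)
        have h2 := hlow (t - τ) (by linarith [ht.2])
        rw [show t - τ - t₀ = t - T by rw [hT]; ring] at h2
        have h3 := mul_le_mul_of_nonneg_left h2 hkp.le
        have h4 : (k + p) / (μ₂ - l) * (μ₂ - l) = k + p := div_mul_cancel₀ _ hgap.ne'
        have h5 : l * (Q / l) = Q := mul_div_cancel₀ Q hl.ne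
        simp only [hw]
        rw [h1]
        linear_combination h3 + exp (μ₂ * (t - T)) * h4 - h5)
    linarith
  have hwT0 : w T ≤ 0 := by
    have hlim : Tendsto (fun a => (A + (k + p) / (μ₂ - l)) * exp (l * (T - a))) atBot (𝓝 0) := by
      rw [← mul_zero (A + (k + p) / (μ₂ - l))]
      refine (tendsto_exp_atBot.comp ?_).const_mul _
      have : Tendsto (fun a : ℝ => T + -a) atBot atTop :=
        tendsto_atTop_add_const_left _ _ tendsto_neg_atBot_atTop
      exact (this.const_mul_atTop_of_neg hl).congr fun a => by ring
    refine ge_of_tendsto hlim ?_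
    filter_upwards [eventually_le_atBot T] with a ha
    exact (hwT a ha).trans (mul_le_mul_of_nonneg_right (hwA a ha) (exp_pos _).le)
  have hET : E T < 0 := by
    have h1 : w T = E T + (k + p) / (μ₂ - l) + Q / l := by simp [hw]
    have h2 : 0 < (k + p) / (μ₂ - l) + Q / l := by
      have e : (k + p) / (μ₂ - l) + Q / l =
          (-l * (k + p) - Q * (μ₂ - l)) / ((μ₂ - l) * -l) := by
        have := hl.ne
        have := hgap.ne'
        field_simp
        ring
      rw [e]
      exact div_pos (by linarith) (mul_pos hgap (by linarith))
    linarith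
  refine ⟨-E T * exp (-(l * T)), mul_pos (by linarith) (exp_pos _), T, fun t ht => ?_⟩
  have := mul_exp_le_of_hasDerivAt (w := fun t => -E t) (β := l) ht
    (fun s _ => (F.hasDerivAt_kappaFunctional B hroot s).fun_neg)
    (fun s hs => by
      have h1 := F.residual_nonneg B (t := s - τ) (hge _ (by linarith [hs.1]))
      linarith)
  rw [show l * (t - T) = -(l * T) + l * t by ring, exp_add] at this
  linarith

/-- The weighted deviation improves over one delay. -/
theorem weighted_improve (F : Front g κ c τ φ φ₁) (B : BirthProps g k p Q κ θ₁)
    (hτ : 0 < τ) (hl : l < 0) (hν : 0 < ν)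
    (hrootl : l ^ 2 - c * l - 1 + -p * exp (-(l * τ)) = 0)
    (hrootν : ν ^ 2 - c * ν - 1 + -p * exp (-(ν * τ)) = 0)
    (hslope : 2 * l - c + p * τ * exp (-(l * τ)) ≤ 0) {C K t : ℝ} (hK : 0 ≤ K)
    (hEν : 0 ≤ kappaFunctional p κ c τ φ φ₁ ν t)
    (hEl : kappaFunctional p κ c τ φ φ₁ l t ≤ -C * exp (l * t))
    (hw : ∀ s ∈ Icc (t - τ) t, -K * exp (l * s) ≤ φ s - κ) :
    (C / (ν - l) - K) * exp (l * t) ≤ φ t - κ := by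
  have hcont : Continuous fun s => φ s - κ := F.continuous.sub continuous_const
  have h1 := expWindow_anti_rate (u := fun s => (φ s - κ) + K * exp (l * s)) (by fun_prop) hτ.le
    (show l ≤ ν by linarith) (fun s hs => by linarith [hw s hs])
  rw [expWindow_add hcont (by fun_prop), expWindow_add hcont (by fun_prop), expWindow_const_mul,
    expWindow_const_mul, expWindow_exp_self, expWindow_exp (by linarith)] at h1
  have h2 : p * ((exp (-(ν * τ)) - exp (-(l * τ))) / (l - ν)) = c - ν - l := by
    rw [← mul_div_assoc, div_eq_iff (by linarith)]
    linear_combination hrootl - hrootν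
  simp only [kappaFunctional] at hEν hEl
  have h3 := mul_le_mul_of_nonneg_left h1 B.p_pos.le
  have h4 := mul_le_mul_of_nonneg_left hslope (mul_nonneg hK (exp_pos (l * t)).le)
  have hgap : 0 < ν - l := by linarith
  have h5 : C / (ν - l) * (ν - l) = C := div_mul_cancel₀ _ hgap.ne'
  refine le_of_mul_le_mul_left ?_ hgap
  linear_combination hEν + hEl + h3 + h4 + exp (l * t) * h5 - K * exp (l * t) * h2

/-- Under the root conditions at `κ`, the front is eventually above `κ` and nonincreasing. -/
theorem eventually_above (F : Front g κ c τ φ φ₁) (B : BirthProps g k p Q κ θ₁)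
    (R : CharRoots k c τ μ₂ μ₁) (hτ : 0 < τ) (hl : l < 0) (hν : 0 < ν)
    (hrootl : l ^ 2 - c * l - 1 + -p * exp (-(l * τ)) = 0)
    (hrootν : ν ^ 2 - c * ν - 1 + -p * exp (-(ν * τ)) = 0)
    (hslope : 2 * l - c + p * τ * exp (-(l * τ)) ≤ 0)
    (hbig : Q * (μ₂ - l) < -l * (k + p)) :
    ∃ T, ∀ t ≥ T, κ < φ t ∧ φ₁ t ≤ 0 := by
  obtain ⟨S₁, hS₁⟩ := F.kappaFunctional_nonneg B hτ hν hrootν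
  obtain ⟨C, hC, S₂, hS₂⟩ := F.kappaFunctional_neg B R hτ hl hrootl hbig
  obtain ⟨Y, hY⟩ := F.eventually_right B
  set S := max S₁ (max S₂ (Y + τ)) with hS
  have hSS₁ : S₁ ≤ S := le_max_left _ _
  have hSS₂ : S₂ ≤ S := (le_max_left _ _).trans (le_max_right _ _)
  have hSY : Y + τ ≤ S := (le_max_right _ _).trans (le_max_right _ _)
  set δ := C / (ν - l) with hδ
  have hδ0 : 0 < δ := div_pos hC (by linarith)
  have himp : ∀ K ≥ 0, ∀ t ≥ S, (∀ s ∈ Icc (t - τ) t, -K * exp (l * s) ≤ φ s - κ) →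
      (δ - K) * exp (l * t) ≤ φ t - κ := fun K hK t ht hw =>
    F.weighted_improve B hτ hl hν hrootl hrootν hslope hK (hS₁ t (hSS₁.trans ht))
      (hS₂ t (hSS₂.trans ht)) hw
  have hκ : 0 < κ := by linarith [B.one_lt, B.lt_kappa]
  set K₀ := κ * exp (-(l * S)) with hK₀
  have hK₀0 : 0 < K₀ := by positivity
  have hinit : ∀ s ≤ S, -K₀ * exp (l * s) ≤ φ s - κ := by
    intro s hs
    have h1 : 1 ≤ exp (-(l * S)) * exp (l * s) := by
      rw [← exp_add]; exact one_le_exp (by nlinarith)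
    have h2 := mul_le_mul_of_nonneg_left h1 hκ.le
    rw [hK₀]
    linarith [F.pos s]
  have hbase : ∀ t, -K₀ * exp (l * t) ≤ φ t - κ := by
    intro t
    by_contra hcon
    push Not at hcon
    have hSt : S < t := by
      by_contra h
      linarith [hinit t (not_lt.1 h)]
    have hZc : Continuous fun s => exp (-(l * s)) * (φ s - κ) := by
      have := F.continuous
      fun_prop
    have hZ : ∀ s K, -K * exp (l * s) ≤ φ s - κ ↔ -K ≤ exp (-(l * s)) * (φ s - κ) := by
      intro s K
      rw [exp_neg, ← div_eq_inv_mul, le_div_iff₀ (exp_pos _)]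
    obtain ⟨x, hx, hmin⟩ := isCompact_Icc.exists_isMinOn (nonempty_Icc.2 (show S - τ ≤ t by linarith))
      hZc.continuousOn
    set K₁ := -(exp (-(l * x)) * (φ x - κ)) with hK₁
    have h1 : K₀ < K₁ := by
      have h2 := (not_congr (hZ t K₀)).1 (not_le.2 hcon)
      have h3 : exp (-(l * x)) * (φ x - κ) ≤ exp (-(l * t)) * (φ t - κ) :=
        hmin ⟨by linarith, le_rfl⟩
      push Not at h2
      linarith
    have hSx : S < x := by
      by_contra h
      have := (hZ x K₀).1 (hinit x (not_lt.1 h))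
      linarith
    have h4 := himp K₁ (by linarith) x hSx.le fun s hs => (hZ s K₁).2 (by
      rw [hK₁, neg_neg]
      exact hmin ⟨by linarith [hs.1], hs.2.trans hx.2⟩)
    have h5 := (hZ x (K₁ - δ)).1 (by linarith)
    linarith
  have hstep : ∀ n : ℕ, ∀ t ≥ S + n * τ, -max (K₀ - n * δ) 0 * exp (l * t) ≤ φ t - κ := by
    intro n
    induction n with
    | zero =>
      intro t _
      simpa [hK₀0.le] using hbase t
    | succ n ih =>
      intro t ht
      push_cast at ht ⊢
      have hnτ : 0 ≤ (n : ℝ) * τ := by positivity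
      have := himp _ (le_max_right (K₀ - n * δ) 0) t (by linarith)
        fun s hs => ih s (by linarith [hs.1])
      refine (mul_le_mul_of_nonneg_right ?_ (exp_pos _).le).trans this
      rcases le_total (K₀ - n * δ) 0 with h | h
      · rw [max_eq_right h]
        linarith [le_max_right (K₀ - (n + 1) * δ) 0]
      · rw [max_eq_left h]
        linarith [le_max_left (K₀ - (n + 1) * δ) 0]
  obtain ⟨n, hn⟩ := exists_nat_gt (K₀ / δ)
  rw [div_lt_iff₀ hδ0] at hn
  have hnτ : 0 ≤ (n : ℝ) * τ := by positivity
  have habove : ∀ t ≥ S + n * τ + τ, κ < φ t := by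
    intro t ht
    have := himp 0 le_rfl t (by linarith) fun s hs => by
      have := hstep n s (by linarith [hs.1])
      rwa [max_eq_right (by linarith)] at this
    have h2 : 0 < (δ - 0) * exp (l * t) := mul_pos (by linarith) (exp_pos _)
    linarith
  refine ⟨S + n * τ + τ + τ, fun t ht => ⟨habove t (by linarith), ?_⟩⟩
  have := deriv_le_of_bounded (u := fun t => φ t - κ) (c := c) (a := S + n * τ + τ + τ) (C := k)
    (fun s _ => (F.d1 s).sub_const κ)
    (fun s hs => (F.hasDerivAt_right B 1 (hY _ (by linarith))).congr_of_eventuallyEq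
      (Eventually.of_forall fun x => (one_mul (φ₁ x)).symm))
    (fun s hs => by
      have := mul_nonneg B.p_pos.le (sub_nonneg.2 (habove (s - τ) (by linarith)).le)
      linarith)
    (fun s _ => by linarith [F.le_k B s]) t ht
  exact this.trans (mul_nonpos_of_nonpos_of_nonneg (negRoot_nonpos zero_le_one)
    (by linarith [habove t (by linarith)]))

end Front

theorem charFun_ge (c z : ℝ) :
    (z - c) ^ 2 + 3 - c ^ 2 ≤ z ^ 2 - c * z - 1 + exp 3 * exp (-(z * c)) := by
  have h := add_one_le_exp (3 + -(z * c))
  rw [exp_add] at h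
  linarith

theorem charFun_pos {c : ℝ} (hc : c ^ 2 < 3) (z : ℝ) :
    0 < z ^ 2 - c * z - 1 + exp 3 * exp (-(z * c)) := by
  nlinarith [charFun_ge c z, sq_nonneg (z - c)]

theorem charFun_convex {k c τ x y a : ℝ} (hk : 0 ≤ k) (h0 : 0 ≤ a) (h1 : a ≤ 1) :
    ((1 - a) * x + a * y) ^ 2 - c * ((1 - a) * x + a * y) - 1 +
        k * exp (-(((1 - a) * x + a * y) * τ)) ≤
      (1 - a) * (x ^ 2 - c * x - 1 + k * exp (-(x * τ))) +
        a * (y ^ 2 - c * y - 1 + k * exp (-(y * τ))) := by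
  have h := convexOn_exp.2 (mem_univ (-(x * τ))) (mem_univ (-(y * τ))) (sub_nonneg.2 h1) h0
    (by ring)
  simp only [smul_eq_mul] at h
  rw [show (1 - a) * -(x * τ) + a * -(y * τ) = -(((1 - a) * x + a * y) * τ) by ring] at h
  have h2 := mul_le_mul_of_nonneg_left h hk
  have h3 : 0 ≤ a * (1 - a) * (x - y) ^ 2 :=
    mul_nonneg (mul_nonneg h0 (sub_nonneg.2 h1)) (sq_nonneg _)
  linear_combination h2 + h3

theorem exists_charRoots {c : ℝ} (hc : 0 < c) (hc3 : 3 ≤ c ^ 2) :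
    ∃ μ₂ μ₁, CharRoots (exp 3) c c μ₂ μ₁ ∧ μ₂ * c ≤ 3 := by
  rcases hc3.eq_or_lt with h | h
  · have he : exp 3 * exp (-(c * c)) = 1 := by
      rw [← exp_add, show (3:ℝ) + -(c * c) = 0 by rw [h]; ring, exp_zero]
    refine ⟨c, c, ⟨hc, le_rfl, by rw [he]; ring, by rw [he]; ring, fun _ => ?_, fun z hz => ?_⟩, ?_⟩
    · linear_combination c * he
    · have := charFun_ge c z
      have : 0 < (z - c) ^ 2 := pow_pos (sub_pos.2 hz) 2
      linarith
    · rw [h]; exact le_of_eq (by ring)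
  · set f : ℝ → ℝ := fun z => z ^ 2 - c * z - 1 + exp 3 * exp (-(z * c)) with hf
    have hcont : Continuous f := by fun_prop
    have hz0 : 0 < 3 / c := by positivity
    have hzc : 3 / c * c = 3 := div_mul_cancel₀ _ hc.ne'
    have hmid : f (3 / c) < 0 := by
      have h1 : exp 3 * exp (-(3 / c * c)) = 1 := by rw [hzc, ← exp_add]; simp
      have h2 : f (3 / c) = 9 / c ^ 2 - 3 := by
        simp only [hf]
        rw [h1]
        field_simp
        ring
      rw [h2, sub_neg, div_lt_iff₀ (by positivity)]
      linarith
    have hzero : 0 < f 0 := by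
      have : (1:ℝ) < exp 3 := one_lt_exp_iff.2 (by norm_num)
      simp only [hf, zero_mul, neg_zero, exp_zero]
      linarith
    have htop : 0 < f (2 * c) := by
      have := charFun_ge c (2 * c)
      simp only [hf]
      linarith
    have hlt : 3 / c < 2 * c := by
      rw [div_lt_iff₀ hc]; nlinarith
    obtain ⟨μ₂, hμ₂, h2⟩ := intermediate_value_Icc' hz0.le hcont.continuousOn
      (show (0:ℝ) ∈ Icc (f (3 / c)) (f 0) from ⟨hmid.le, hzero.le⟩)
    obtain ⟨μ₁, hμ₁, h1⟩ := intermediate_value_Icc hlt.le hcont.continuousOn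
      (show (0:ℝ) ∈ Icc (f (3 / c)) (f (2 * c)) from ⟨hmid.le, htop.le⟩)
    have hμ₂0 : 0 < μ₂ := lt_of_le_of_ne hμ₂.1 (by rintro rfl; linarith)
    have hμ₁0 : 3 / c < μ₁ := lt_of_le_of_ne hμ₁.1 (by rintro rfl; linarith)
    refine ⟨μ₂, μ₁, ⟨hμ₂0, hμ₂.2.trans hμ₁.1, h2, h1, fun h => ?_, fun z hz => ?_⟩, ?_⟩
    · linarith [hμ₂.2]
    · by_contra hcon
      push Not at hcon
      have hd : 0 < z - 3 / c := by linarith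
      set a := (μ₁ - 3 / c) / (z - 3 / c) with ha
      have ha1 : a < 1 := by rw [ha, div_lt_one hd]; linarith
      have ha0 : 0 ≤ a := div_nonneg (by linarith) hd.le
      have had : a * (z - 3 / c) = μ₁ - 3 / c := div_mul_cancel₀ _ hd.ne'
      have hconv := charFun_convex (k := exp 3) (c := c) (τ := c) (x := 3 / c) (y := z)
        (exp_pos 3).le ha0 ha1.le
      rw [show (1 - a) * (3 / c) + a * z = μ₁ by linear_combination had] at hconv
      have h3 : (1 - a) * f (3 / c) < 0 := mul_neg_of_pos_of_neg (by linarith) hmid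
      have h4 := mul_nonpos_of_nonneg_of_nonpos ha0 hcon
      have h5 : μ₁ ^ 2 - c * μ₁ - 1 + exp 3 * exp (-(μ₁ * c)) = 0 := h1
      have h6 : f (3 / c) = (3 / c) ^ 2 - c * (3 / c) - 1 + exp 3 * exp (-(3 / c * c)) := rfl
      rw [← h6] at hconv
      linarith
    · have := mul_le_mul_of_nonneg_right hμ₂.2 hc.le
      linarith

/-- For moderate speeds, the linearization at `κ` has a suitable negative and a positive root. -/
theorem exists_kappaRoots {c p : ℝ} (hc : 0 < c) (hc3 : 3 ≤ c ^ 2) (hc16 : c ^ 2 ≤ 16)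
    (hp : p = 5 / 4 * exp (-2)) :
    ∃ l ν : ℝ, 0 < ν ∧ 1 ≤ -l * c ∧ l ^ 2 - c * l - 1 + -p * exp (-(l * c)) = 0 ∧
      ν ^ 2 - c * ν - 1 + -p * exp (-(ν * c)) = 0 ∧
      2 * l - c + p * c * exp (-(l * c)) ≤ 0 := by
  have hp0 : 0 < p := by rw [hp]; positivity
  have hp1 : p < 2 := by
    have : exp (-2 : ℝ) ≤ 1 := exp_le_one_iff.2 (by norm_num)
    rw [hp]; linarith
  obtain ⟨y, hy, hroot⟩ : ∃ y ∈ Icc (1:ℝ) 2, y ^ 2 / c ^ 2 + y - 1 - p * exp y = 0 := by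
    have hcont : Continuous fun y : ℝ => y ^ 2 / c ^ 2 + y - 1 - p * exp y := by fun_prop
    refine intermediate_value_Icc (by norm_num) hcont.continuousOn ⟨?_, ?_⟩
    · have h1 : 1 / c ^ 2 ≤ 1 / 3 := one_div_le_one_div_of_le (by norm_num) hc3
      have h2 : p * exp 1 = 5 / 4 * exp (-1) := by
        rw [hp, mul_assoc, ← exp_add]; norm_num
      have h3 : 1 / 3 ≤ exp (-1 : ℝ) := by
        rw [exp_neg, ← one_div]
        exact one_div_le_one_div_of_le (exp_pos 1) (by linarith [exp_one_lt_d9])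
      simp only [one_pow]
      linarith
    · have h1 : 1 / 16 ≤ 1 / c ^ 2 := one_div_le_one_div_of_le (by positivity) hc16
      have h2 : p * exp 2 = 5 / 4 := by
        rw [hp, mul_assoc, ← exp_add]; norm_num
      have h3 : (2:ℝ) ^ 2 / c ^ 2 = 4 * (1 / c ^ 2) := by ring
      simp only [h3]
      linarith
  obtain ⟨ν, hν, hνroot⟩ : ∃ ν ∈ Icc (0:ℝ) (c + 2), ν ^ 2 - c * ν - 1 + -p * exp (-(ν * c)) = 0 := by
    have hcont : Continuous fun ν : ℝ => ν ^ 2 - c * ν - 1 + -p * exp (-(ν * c)) := by fun_prop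
    refine intermediate_value_Icc (by linarith) hcont.continuousOn ⟨?_, ?_⟩
    · simp only [zero_mul, neg_zero, exp_zero]
      linarith
    · have h1 : exp (-((c + 2) * c)) ≤ 1 := exp_le_one_iff.2 (by nlinarith)
      nlinarith
  have hν0 : ν ≠ 0 := by
    rintro rfl
    simp only [zero_mul, neg_zero, exp_zero] at hνroot
    linarith
  have hlc : -(-y / c * c) = y := by field_simp
  have hsq : (-y / c) ^ 2 = y ^ 2 / c ^ 2 := by rw [div_pow, neg_sq]
  refine ⟨-y / c, ν, lt_of_le_of_ne hν.1 hν0.symm, ?_, ?_, hνroot, ?_⟩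
  · rw [neg_mul, hlc]; exact hy.1
  · rw [hlc, hsq]
    linear_combination hroot - hlc + 2 * hlc
  · rw [hlc]
    have h1 : (y - 2) * (y / c ^ 2 + 1) ≤ 0 :=
      mul_nonpos_of_nonpos_of_nonneg (by linarith [hy.2]) (by have := hy.1; positivity)
    have h2 : 2 * (-y / c) - c + p * c * exp y = c * ((y - 2) * (y / c ^ 2 + 1)) := by
      have h3 : p * exp y = y ^ 2 / c ^ 2 + y - 1 := by linarith
      rw [mul_right_comm, h3]
      field_simp
      ring
    rw [h2]
    exact mul_nonpos_of_nonneg_of_nonpos hc.le h1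

/-- For large speeds, the linearization at `κ` has no negative real root, quantitatively. -/
theorem exists_gap {c p : ℝ} (hc : 4 < c) (hp : p = 5 / 4 * exp (-2)) :
    ∃ η > 0, ∀ x ≥ 0, η * (c + 2 * x + η) ≤ p * exp (x * c) + 1 - c * x - x ^ 2 := by
  have hc16 : 1 / c ^ 2 < 1 / 16 := one_div_lt_one_div_of_lt (by norm_num) (by nlinarith)
  set a := 1 / 16 - 1 / c ^ 2 with ha
  have ha0 : 0 < a := by linarith
  have ha1 : a ≤ 1 := by
    have : 0 < 1 / c ^ 2 := by positivity
    linarith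
  have hmin : 0 < min a (1 / 4) := lt_min ha0 (by norm_num)
  have hc3 : 0 < c + 3 := by linarith
  refine ⟨min a (1 / 4) / (c + 3), div_pos hmin hc3, fun x hx => ?_⟩
  set η := min a (1 / 4) / (c + 3) with hη
  have hη0 : 0 < η := div_pos hmin hc3
  have hηm : η * (c + 3) = min a (1 / 4) := div_mul_cancel₀ _ hc3.ne'
  have hη1 : η ≤ 1 := by
    rw [hη, div_le_one hc3]
    linarith [min_le_left a (1 / 4)]
  set y := x * c with hy
  have hy0 : 0 ≤ y := by positivity
  have hxy : 4 * x ≤ y := by rw [hy]; nlinarith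
  have hx2 : x ^ 2 = y ^ 2 * (1 / c ^ 2) := by rw [hy]; field_simp
  have hexp : 5 / 16 * y ^ 2 ≤ p * exp y := by
    have h1 : y / 2 ≤ exp (y / 2 - 1) := by linarith [add_one_le_exp (y / 2 - 1)]
    have h2 : exp (-2) * exp y = exp (y / 2 - 1) ^ 2 := by
      rw [← exp_add, sq, ← exp_add]; congr 1; ring
    have h3 := pow_le_pow_left₀ (by positivity) h1 2
    rw [hp, mul_assoc, h2]
    linarith
  have hlow : (y / 2 - 1) ^ 2 + a * y ^ 2 ≤ p * exp y + 1 - c * x - x ^ 2 := by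
    rw [hx2, show c * x = y by rw [hy]; ring, ha]
    linarith
  refine le_trans ?_ hlow
  rcases le_total y 1 with h | h
  · have h1 : η * (c + 2 * x + η) ≤ η * (c + 3) := mul_le_mul_of_nonneg_left (by linarith) hη0.le
    have h2 : 0 ≤ a * y ^ 2 := by positivity
    nlinarith [min_le_right a (1 / 4)]
  · have h1 : c + 2 * x + η ≤ (c + 3) * y := by nlinarith
    have h2 := mul_le_mul_of_nonneg_left h1 hη0.le
    have h3 : min a (1 / 4) * y ≤ a * y := mul_le_mul_of_nonneg_right (min_le_left _ _) hy0
    have h4 : a * y ≤ a * y ^ 2 := mul_le_mul_of_nonneg_left (by nlinarith) ha0.le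
    have h5 : η * ((c + 3) * y) = min a (1 / 4) * y := by rw [← hηm]; ring
    linarith [sq_nonneg (y / 2 - 1)]

/-- The solution of `w' = z w + f`, `w 0 = 0`. -/
def expPrim (z : ℝ) (f : ℝ → ℝ) (t : ℝ) : ℝ := exp (z * t) * ∫ s in (0:ℝ)..t, exp (-(z * s)) * f s

theorem hasDerivAt_expPrim {f : ℝ → ℝ} (hf : Continuous f) (z t : ℝ) :
    HasDerivAt (expPrim z f) (z * expPrim z f t + f t) t := by
  have h1 : HasDerivAt (fun t => exp (z * t)) (exp (z * t) * (z * 1)) t :=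
    ((hasDerivAt_id t).const_mul z).exp
  have hc : Continuous fun s => exp (-(z * s)) * f s := by fun_prop
  have h3 : HasDerivAt (fun t => ∫ s in (0:ℝ)..t, exp (-(z * s)) * f s)
      (exp (-(z * t)) * f t) t :=
    intervalIntegral.integral_hasDerivAt_right (hc.intervalIntegrable _ _)
      (hc.stronglyMeasurableAtFilter _ _) hc.continuousAt
  refine (h1.fun_mul h3).congr_deriv ?_
  have h4 : exp (z * t) * exp (-(z * t)) = 1 := by rw [← exp_add]; simp
  simp only [expPrim]
  linear_combination f t * h4

theorem expPrim_congr {f f' : ℝ → ℝ} {X t : ℝ} (z : ℝ) (hX : 0 ≤ X) (ht : t ≤ X)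
    (h : ∀ s ≤ X, f s = f' s) : expPrim z f t = expPrim z f' t := by
  simp only [expPrim]
  congr 1
  refine intervalIntegral.integral_congr fun s hs => ?_
  have : s ≤ X := hs.2.trans (max_le hX ht)
  simp only [h s this]

theorem continuous_expPrim {f : ℝ → ℝ → ℝ} (hf : Continuous fun x : ℝ × ℝ => f x.1 x.2) (z : ℝ) :
    Continuous fun x : ℝ × ℝ => expPrim z (f x.1) x.2 := by
  have : Continuous (Function.uncurry fun b s => exp (-(z * s)) * f b s) := by
    simp only [Function.uncurry_def]
    fun_prop
  have h2 := intervalIntegral.continuous_parametric_primitive_of_continuous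
    (μ := MeasureTheory.volume) (a₀ := 0) this
  simp only [expPrim]
  fun_prop

/-- The solution of `w'' = c w' + w + f` with zero data at `0`. -/
def duhamel (c : ℝ) (f : ℝ → ℝ) (t : ℝ) : ℝ :=
  (expPrim (c - negRoot c 1) f t - expPrim (negRoot c 1) f t) / (c - 2 * negRoot c 1)

/-- The derivative of `duhamel`. -/
def duhamelDeriv (c : ℝ) (f : ℝ → ℝ) (t : ℝ) : ℝ :=
  ((c - negRoot c 1) * expPrim (c - negRoot c 1) f t - negRoot c 1 * expPrim (negRoot c 1) f t) /
    (c - 2 * negRoot c 1)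

theorem hasDerivAt_duhamel {c : ℝ} {f : ℝ → ℝ} (hf : Continuous f) (t : ℝ) :
    HasDerivAt (duhamel c f) (duhamelDeriv c f t) t := by
  refine (((hasDerivAt_expPrim hf (c - negRoot c 1) t).fun_sub
    (hasDerivAt_expPrim hf (negRoot c 1) t)).div_const (c - 2 * negRoot c 1)).congr_deriv ?_
  simp only [duhamelDeriv]
  ring

theorem hasDerivAt_duhamelDeriv {c : ℝ} (hc : 0 < c) {f : ℝ → ℝ} (hf : Continuous f) (t : ℝ) :
    HasDerivAt (duhamelDeriv c f) (c * duhamelDeriv c f t + duhamel c f t + f t) t := by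
  refine ((((hasDerivAt_expPrim hf (c - negRoot c 1) t).const_mul (c - negRoot c 1)).fun_sub
    ((hasDerivAt_expPrim hf (negRoot c 1) t).const_mul (negRoot c 1))).div_const
    (c - 2 * negRoot c 1)).congr_deriv ?_
  have hn := negRoot_nonpos (c := c) zero_le_one
  have hsq := negRoot_sq (c := c) zero_le_one
  have hd : c - 2 * negRoot c 1 ≠ 0 := by
    have : 0 < c - 2 * negRoot c 1 := by linarith
    exact this.ne'
  simp only [duhamelDeriv, duhamel]
  rw [div_eq_iff hd, add_mul, add_mul, mul_assoc c, div_mul_cancel₀ _ hd, div_mul_cancel₀ _ hd]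
  linear_combination
    (expPrim (c - negRoot c 1) f t - expPrim (negRoot c 1) f t) * hsq

theorem duhamel_congr {c : ℝ} {f f' : ℝ → ℝ} {X t : ℝ} (hX : 0 ≤ X) (ht : t ≤ X)
    (h : ∀ s ≤ X, f s = f' s) :
    duhamel c f t = duhamel c f' t ∧ duhamelDeriv c f t = duhamelDeriv c f' t := by
  simp only [duhamel, duhamelDeriv, expPrim_congr _ hX ht h, and_self]

theorem duhamel_zero (c t : ℝ) : duhamel c (fun _ => 0) t = 0 ∧ duhamelDeriv c (fun _ => 0) t = 0 := by
  simp [duhamel, duhamelDeriv, expPrim]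

theorem continuous_duhamel {c : ℝ} {f : ℝ → ℝ → ℝ}
    (hf : Continuous fun x : ℝ × ℝ => f x.1 x.2) :
    (Continuous fun x : ℝ × ℝ => duhamel c (f x.1) x.2) ∧
      Continuous fun x : ℝ × ℝ => duhamelDeriv c (f x.1) x.2 := by
  have h1 := continuous_expPrim hf (c - negRoot c 1)
  have h2 := continuous_expPrim hf (negRoot c 1)
  simp only [duhamel, duhamelDeriv]
  constructor <;> fun_prop

/-- The solutions of the linearization at `0` used as initial data. -/
def linSol (μ₂ μ₁ b t : ℝ) : ℝ := exp (μ₂ * t) * (1 - b * ∫ s in (0:ℝ)..t, exp ((μ₁ - μ₂) * s))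

theorem linSol_zero_right (μ₂ μ₁ b : ℝ) : linSol μ₂ μ₁ b 0 = 1 := by simp [linSol]

theorem hasDerivAt_linSol (μ₂ μ₁ b t : ℝ) :
    HasDerivAt (linSol μ₂ μ₁ b) (μ₂ * linSol μ₂ μ₁ b t - b * exp (μ₁ * t)) t := by
  have h1 : HasDerivAt (fun t => exp (μ₂ * t)) (exp (μ₂ * t) * (μ₂ * 1)) t :=
    ((hasDerivAt_id t).const_mul μ₂).exp
  have hc : Continuous fun s => exp ((μ₁ - μ₂) * s) := by fun_prop
  have h3 : HasDerivAt (fun t => ∫ s in (0:ℝ)..t, exp ((μ₁ - μ₂) * s))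
      (exp ((μ₁ - μ₂) * t)) t :=
    intervalIntegral.integral_hasDerivAt_right (hc.intervalIntegrable _ _)
      (hc.stronglyMeasurableAtFilter _ _) hc.continuousAt
  refine (h1.fun_mul ((h3.const_mul b).const_sub 1)).congr_deriv ?_
  have h4 : exp (μ₁ * t) = exp (μ₂ * t) * exp ((μ₁ - μ₂) * t) := by
    rw [← exp_add]; congr 1; ring
  rw [h4]
  simp only [linSol]
  ring

theorem continuous_linSol (μ₂ μ₁ : ℝ) : Continuous fun x : ℝ × ℝ => linSol μ₂ μ₁ x.1 x.2 := by
  have : Continuous (Function.uncurry fun (_ : ℝ) s => exp ((μ₁ - μ₂) * s)) := by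
    simp only [Function.uncurry_def]
    fun_prop
  have h2 := intervalIntegral.continuous_parametric_primitive_of_continuous
    (μ := MeasureTheory.volume) (a₀ := 0) this
  simp only [linSol]
  fun_prop

theorem linSol_delay {k c τ μ₂ μ₁ : ℝ} (R : CharRoots k c τ μ₂ μ₁) (b t : ℝ) :
    k * linSol μ₂ μ₁ b (t - τ) =
      k * exp (-(μ₂ * τ)) * linSol μ₂ μ₁ b t + b * (μ₁ + μ₂ - c) * exp (μ₁ * t) := by
  have hw := R.window₂ t
  rw [expWindow_eq] at hw
  have hc : Continuous fun s => exp ((μ₁ - μ₂) * s) := by fun_prop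
  have e1 : (∫ s in (t - τ)..t, exp (-(μ₂ * s)) * exp (μ₁ * s)) =
      (∫ s in (0:ℝ)..t, exp ((μ₁ - μ₂) * s)) - ∫ s in (0:ℝ)..(t - τ), exp ((μ₁ - μ₂) * s) := by
    rw [intervalIntegral.integral_interval_sub_left (hc.intervalIntegrable _ _)
      (hc.intervalIntegrable _ _)]
    refine intervalIntegral.integral_congr fun s _ => ?_
    rw [← exp_add]; congr 1; ring
  rw [e1] at hw
  have e2 : exp (μ₂ * (t - τ)) = exp (-(μ₂ * τ)) * exp (μ₂ * t) := by
    rw [← exp_add]; congr 1; ring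
  simp only [linSol]
  rw [e2] at hw ⊢
  linear_combination b * hw

theorem hasDerivAt_linSol_deriv {k c τ μ₂ μ₁ : ℝ} (R : CharRoots k c τ μ₂ μ₁) (b t : ℝ) :
    HasDerivAt (fun t => μ₂ * linSol μ₂ μ₁ b t - b * exp (μ₁ * t))
      (c * (μ₂ * linSol μ₂ μ₁ b t - b * exp (μ₁ * t)) + linSol μ₂ μ₁ b t -
        k * linSol μ₂ μ₁ b (t - τ)) t := by
  have h1 : HasDerivAt (fun t => exp (μ₁ * t)) (exp (μ₁ * t) * (μ₁ * 1)) t :=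
    ((hasDerivAt_id t).const_mul μ₁).exp
  refine (((hasDerivAt_linSol μ₂ μ₁ b t).const_mul μ₂).fun_sub (h1.const_mul b)).congr_deriv ?_
  rw [linSol_delay R]
  linear_combination linSol μ₂ μ₁ b t * R.root₂

theorem linSol_of_nonpos {μ₂ μ₁ b t : ℝ} (hμ : 0 < μ₂) (hle : μ₂ ≤ μ₁) (hb : b ∈ Icc 0 μ₂)
    (ht : t ≤ 0) : exp (μ₂ * t) ≤ linSol μ₂ μ₁ b t ∧ linSol μ₂ μ₁ b t ≤ 1 ∧
      linSol μ₂ μ₁ b t ≤ exp (μ₂ * t) * (1 + b * -t) := by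
  have hc : Continuous fun s => exp ((μ₁ - μ₂) * s) := by fun_prop
  have hlower : ∀ t ≤ (0:ℝ), t ≤ ∫ s in (0:ℝ)..t, exp ((μ₁ - μ₂) * s) := by
    intro t ht
    rw [intervalIntegral.integral_symm]
    have := intervalIntegral.integral_mono_on ht (hc.intervalIntegrable _ _)
      (intervalIntegrable_const (μ := MeasureTheory.volume) (c := (1:ℝ)))
      (fun s hs => exp_le_one_iff.2 (mul_nonpos_of_nonneg_of_nonpos (by linarith) hs.2))
    simp only [intervalIntegral.integral_const, smul_eq_mul, mul_one] at this
    linarith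
  have hneg : ∀ t ≤ (0:ℝ), (∫ s in (0:ℝ)..t, exp ((μ₁ - μ₂) * s)) ≤ 0 := by
    intro t ht
    rw [intervalIntegral.integral_symm, neg_nonpos]
    exact intervalIntegral.integral_nonneg ht fun s _ => (exp_pos _).le
  have hlow : ∀ t ≤ (0:ℝ), exp (μ₂ * t) ≤ linSol μ₂ μ₁ b t := by
    intro t ht
    refine le_mul_of_one_le_right (exp_pos _).le ?_
    have := mul_nonpos_of_nonneg_of_nonpos hb.1 (hneg t ht)
    linarith
  refine ⟨hlow t ht, ?_, ?_⟩
  · rw [← linSol_zero_right μ₂ μ₁ b]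
    refine le_of_hasDerivAt_nonneg ht (fun s _ => hasDerivAt_linSol μ₂ μ₁ b s) fun s hs => ?_
    have h1 := mul_le_mul_of_nonneg_left (hlow s hs.2) hμ.le
    have h2 : exp (μ₁ * s) ≤ exp (μ₂ * s) := exp_le_exp.2 (mul_le_mul_of_nonpos_right hle hs.2)
    have h3 := mul_le_mul hb.2 h2 (exp_pos _).le hμ.le
    linarith
  · refine mul_le_mul_of_nonneg_left ?_ (exp_pos _).le
    have := mul_le_mul_of_nonneg_left (hlower t ht) hb.1
    linarith

/-- Successive approximations of the forcing that turns `linSol` into a profile. -/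
def force (g : ℝ → ℝ) (k c τ μ₂ μ₁ : ℝ) : ℕ → ℝ → ℝ → ℝ
  | 0 => fun _ _ => 0
  | n + 1 => fun b s => k * linSol μ₂ μ₁ b (s - τ) -
      g (linSol μ₂ μ₁ b (s - τ) + duhamel c (force g k c τ μ₂ μ₁ n b) (s - τ))

section Family
variable {g : ℝ → ℝ} {k p Q κ θ₁ c τ μ₂ μ₁ : ℝ}

theorem continuous_force (hg : Continuous g) (n : ℕ) :
    Continuous fun x : ℝ × ℝ => force g k c τ μ₂ μ₁ n x.1 x.2 := by
  induction n with
  | zero => exact continuous_const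
  | succ n ih =>
    have h1 : Continuous fun x : ℝ × ℝ => linSol μ₂ μ₁ x.1 (x.2 - τ) :=
      (continuous_linSol μ₂ μ₁).comp (continuous_fst.prodMk (continuous_snd.sub continuous_const))
    have h2 : Continuous fun x : ℝ × ℝ =>
        duhamel c (force g k c τ μ₂ μ₁ n x.1) (x.2 - τ) :=
      (continuous_duhamel ih).1.comp (continuous_fst.prodMk (continuous_snd.sub continuous_const))
    exact (h1.const_mul k).sub (hg.comp (h1.add h2))

theorem force_succ_eq (B : BirthProps g k p Q κ θ₁) (R : CharRoots k c τ μ₂ μ₁) (hτ : 0 < τ)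
    {b : ℝ} (hb : b ∈ Icc 0 μ₂) (n : ℕ) :
    ∀ s ≤ (n + 1) * τ, force g k c τ μ₂ μ₁ n b s = force g k c τ μ₂ μ₁ (n + 1) b s := by
  induction n with
  | zero =>
    intro s hs
    simp only [Nat.cast_zero, zero_add, one_mul] at hs
    obtain ⟨h1, h2, -⟩ := linSol_of_nonpos R.pos R.le hb (show s - τ ≤ 0 by linarith)
    simp only [force, (duhamel_zero c _).1, add_zero]
    rw [B.lin _ ((exp_pos _).le.trans h1) h2, sub_self]
  | succ n ih =>
    intro s hs
    push_cast at hs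
    have := (duhamel_congr (c := c) (X := (n + 1) * τ) (t := s - τ) (by positivity) (by linarith)
      ih).1
    change _ - g (_ + duhamel c (force g k c τ μ₂ μ₁ n b) (s - τ)) =
      _ - g (_ + duhamel c (force g k c τ μ₂ μ₁ (n + 1) b) (s - τ))
    rw [this]

theorem force_eq_of_le (B : BirthProps g k p Q κ θ₁) (R : CharRoots k c τ μ₂ μ₁) (hτ : 0 < τ)
    {b : ℝ} (hb : b ∈ Icc 0 μ₂) {n m : ℕ} (hnm : n ≤ m) :
    ∀ s ≤ (n + 1) * τ, force g k c τ μ₂ μ₁ n b s = force g k c τ μ₂ μ₁ m b s := by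
  induction m, hnm using Nat.le_induction with
  | base => intro s _; rfl
  | succ m hm ih =>
    intro s hs
    have : (n : ℝ) ≤ m := by exact_mod_cast hm
    rw [ih s hs, force_succ_eq B R hτ hb m s (hs.trans (by nlinarith))]

/-- The shooting family of global profiles, continuous in the parameter. -/
theorem exists_family (B : BirthProps g k p Q κ θ₁) (R : CharRoots k c τ μ₂ μ₁) (hτ : 0 < τ)
    (hc : 0 < c) : ∃ φ φ₁ : ℝ → ℝ → ℝ,
      (∀ b ∈ Icc 0 μ₂, Profile g c τ (φ b) (φ₁ b)) ∧
      (∀ b ∈ Icc 0 μ₂, ∀ t ≤ 0, φ b t = linSol μ₂ μ₁ b t ∧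
        φ₁ b t = μ₂ * linSol μ₂ μ₁ b t - b * exp (μ₁ * t)) ∧
      ∀ t, ContinuousOn (fun b => φ b t) (Icc 0 μ₂) ∧ ContinuousOn (fun b => φ₁ b t) (Icc 0 μ₂) := by
  set f := force g k c τ μ₂ μ₁ with hf
  set G : ℝ → ℝ → ℝ := fun b s => f ⌈s / τ⌉₊ b s with hG
  have hGf : ∀ b ∈ Icc 0 μ₂, ∀ n : ℕ, ∀ s ≤ (n + 1) * τ, G b s = f n b s := by
    intro b hb n s hs
    have h1 : s ≤ (⌈s / τ⌉₊ + 1) * τ := by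
      have := Nat.le_ceil (s / τ)
      rw [div_le_iff₀ hτ] at this
      linarith
    rcases le_total n ⌈s / τ⌉₊ with h | h
    · exact (force_eq_of_le B R hτ hb h s hs).symm
    · exact force_eq_of_le B R hτ hb h s h1
  have hcont : ∀ b ∈ Icc 0 μ₂, Continuous (G b) := by
    intro b hb
    rw [continuous_iff_continuousAt]
    intro s
    obtain ⟨n, hn⟩ := exists_nat_gt (s / τ)
    rw [div_lt_iff₀ hτ] at hn
    have h1 : G b =ᶠ[𝓝 s] f n b := by
      filter_upwards [Iio_mem_nhds (show s < (n + 1) * τ by linarith)] with x hx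
      exact hGf b hb n x (le_of_lt hx)
    refine ContinuousAt.congr ?_ h1.symm
    exact ((continuous_force B.cont n).comp (Continuous.prodMk_right b)).continuousAt
  have hdu : ∀ b ∈ Icc 0 μ₂, ∀ n : ℕ, ∀ t ≤ (n + 1) * τ,
      duhamel c (G b) t = duhamel c (f n b) t ∧ duhamelDeriv c (G b) t = duhamelDeriv c (f n b) t :=
    fun b hb n t ht => duhamel_congr (by positivity) ht (hGf b hb n)
  refine ⟨fun b t => linSol μ₂ μ₁ b t + duhamel c (G b) t,
    fun b t => μ₂ * linSol μ₂ μ₁ b t - b * exp (μ₁ * t) + duhamelDeriv c (G b) t,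
    fun b hb => ⟨fun t => (hasDerivAt_linSol μ₂ μ₁ b t).fun_add (hasDerivAt_duhamel (hcont b hb) t),
      fun t => ?_⟩, fun b hb t ht => ?_, fun t => ?_⟩
  · refine ((hasDerivAt_linSol_deriv R b t).fun_add
      (hasDerivAt_duhamelDeriv hc (hcont b hb) t)).congr_deriv ?_
    obtain ⟨n, hn⟩ := exists_nat_gt (t / τ)
    rw [div_lt_iff₀ hτ] at hn
    have h1 : G b t = f (n + 1) b t := hGf b hb (n + 1) t (by push_cast; linarith)
    have h2 := (hdu b hb n (t - τ) (by linarith)).1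
    have h3 : f (n + 1) b t = k * linSol μ₂ μ₁ b (t - τ) -
        g (linSol μ₂ μ₁ b (t - τ) + duhamel c (f n b) (t - τ)) := rfl
    beta_reduce
    rw [h1, h2, h3]
    ring
  · have h1 := hdu b hb 0 t (by push_cast; linarith)
    have h2 : f 0 b = fun _ => 0 := rfl
    rw [h2, (duhamel_zero c t).1, (duhamel_zero c t).2] at h1
    simp only [h1, add_zero, and_self]
  · obtain ⟨n, hn⟩ := exists_nat_gt (t / τ)
    rw [div_lt_iff₀ hτ] at hn
    have hD := continuous_duhamel (c := c) (continuous_force (k := k) (c := c) (τ := τ)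
      (μ₂ := μ₂) (μ₁ := μ₁) B.cont n)
    have hL : Continuous fun b => linSol μ₂ μ₁ b t :=
      (continuous_linSol μ₂ μ₁).comp (Continuous.prodMk_left t)
    have hD1 : Continuous fun b => duhamel c (f n b) t := hD.1.comp (Continuous.prodMk_left t)
    have hD2 : Continuous fun b => duhamelDeriv c (f n b) t := hD.2.comp (Continuous.prodMk_left t)
    constructor
    · refine (hL.add hD1).continuousOn.congr fun b hb => ?_
      simp only [(hdu b hb n t (by linarith)).1, Pi.add_apply]
    · have h3 : Continuous fun b => μ₂ * linSol μ₂ μ₁ b t - b * exp (μ₁ * t) +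
          duhamelDeriv c (f n b) t := by fun_prop
      refine h3.continuousOn.congr fun b hb => ?_
      simp only [(hdu b hb n t (by linarith)).2]

end Family

theorem exists_pos_deriv_pos {u u₁ : ℝ → ℝ} (h1 : ∀ t, HasDerivAt u (u₁ t) t) {x y : ℝ}
    (hxy : x ≤ y) (hx : u x ≤ 0) (hy : 0 < u y) : ∃ s ∈ Icc x y, 0 < u s ∧ 0 < u₁ s := by
  have hc : Continuous u := continuous_iff_continuousAt.2 fun t => (h1 t).continuousAt
  obtain ⟨z, ⟨hz, hzu⟩, hmax⟩ := (isCompact_Icc.inter_right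
    (isClosed_Iic.preimage hc) : IsCompact (Icc x y ∩ u ⁻¹' Iic 0)).exists_isGreatest
    ⟨x, left_mem_Icc.2 hxy, hx⟩
  simp only [mem_preimage, mem_Iic] at hzu
  have hzy : z < y := lt_of_le_of_ne hz.2 fun h => by rw [h] at hzu; linarith
  obtain ⟨s, hs, hs'⟩ := exists_hasDerivAt_eq_slope u u₁ hzy hc.continuousOn fun t _ => h1 t
  refine ⟨s, ⟨hz.1.trans hs.1.le, hs.2.le⟩, ?_, ?_⟩
  · by_contra h
    push Not at h
    exact absurd (hmax ⟨⟨hz.1.trans hs.1.le, hs.2.le⟩, h⟩) (not_le.2 hs.1)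
  · rw [hs']
    exact div_pos (by linarith) (by linarith)

/-- A bounded-above solution of `u'' ≥ c u' + u` is eventually below every positive level. -/
theorem eventually_le_of_bounded {u u₁ u₂ : ℝ → ℝ} {c a C ε : ℝ}
    (h1 : ∀ t ≥ a, HasDerivAt u (u₁ t) t) (h2 : ∀ t ≥ a, HasDerivAt u₁ (u₂ t) t)
    (h : ∀ t ≥ a, c * u₁ t + u t ≤ u₂ t) (hC : ∀ t ≥ a, u t ≤ C) (hε : 0 < ε) :
    ∀ᶠ t in atTop, u t ≤ ε := by
  have hα0 := negRoot_neg (c := c) zero_lt_one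
  have h3 : Tendsto (fun t => negRoot c 1 * (t - a)) atTop atBot :=
    (tendsto_atTop_add_const_right _ (-a) tendsto_id).const_mul_atTop_of_neg hα0
  have h4 := (tendsto_exp_atBot.comp h3).const_mul (u a)
  rw [mul_zero] at h4
  filter_upwards [h4.eventually (ge_mem_nhds hε), eventually_ge_atTop a] with t ht hta
  exact (le_mul_exp_of_bounded (c := c) h1 h2 h hC t hta).trans ht

section Critical
variable {μ₂ μ₁ : ℝ}

theorem linSol_of_nonneg {b t : ℝ} (hb : 0 ≤ b) (hle : μ₂ ≤ μ₁) (ht : 0 ≤ t) :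
    linSol μ₂ μ₁ b t ≤ exp (μ₂ * t) * (1 - b * t) := by
  have hc : Continuous fun s => exp ((μ₁ - μ₂) * s) := by fun_prop
  have := intervalIntegral.integral_mono_on ht
    (intervalIntegrable_const (μ := MeasureTheory.volume) (c := (1:ℝ)))
    (hc.intervalIntegrable _ _)
    (fun s hs => one_le_exp (mul_nonneg (by linarith) hs.1))
  simp only [intervalIntegral.integral_const, smul_eq_mul, mul_one] at this
  refine mul_le_mul_of_nonneg_left ?_ (exp_pos _).le
  have := mul_le_mul_of_nonneg_left this hb
  linarith

theorem linSol_le_one (hμ : 0 < μ₂) (hle : μ₂ ≤ μ₁) (t : ℝ) : linSol μ₂ μ₁ μ₂ t ≤ 1 := by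
  rcases le_total t 0 with h | h
  · exact (linSol_of_nonpos hμ hle ⟨hμ.le, le_rfl⟩ h).2.1
  · have := le_of_hasDerivAt_nonneg (f := fun t => -linSol μ₂ μ₁ μ₂ t) h
      (fun s _ => (hasDerivAt_linSol μ₂ μ₁ μ₂ s).fun_neg) (fun s hs => by
        have h1 := linSol_of_nonneg hμ.le hle hs.1
        have h2 : exp (μ₂ * s) ≤ exp (μ₁ * s) := exp_le_exp.2 (mul_le_mul_of_nonneg_right hle hs.1)
        have h3 : exp (μ₂ * s) * (1 - μ₂ * s) ≤ exp (μ₂ * s) :=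
          mul_le_of_le_one_right (exp_pos _).le (by linarith [mul_nonneg hμ.le hs.1])
        have := mul_le_mul_of_nonneg_left (h1.trans (h3.trans h2)) hμ.le
        linarith)
    simp only [linSol_zero_right] at this
    linarith

end Critical

section Shooting
variable {g : ℝ → ℝ} {k p Q κ θ₁ c τ μ₂ μ₁ : ℝ} {φ φ₁ : ℝ → ℝ}

theorem BirthProps.le_mul (B : BirthProps g k p Q κ θ₁) {x : ℝ} (hx : 0 ≤ x) : g x ≤ k * x := by
  have := B.slope x 0 hx
  rw [B.zero 0 le_rfl] at this
  linarith

theorem Profile.exceeds (F : Profile g c τ φ φ₁) (B : BirthProps g k p Q κ θ₁)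
    (R : CharRoots k c τ μ₂ μ₁) (hτ : 0 < τ)
    (h : ∀ t ≤ 0, φ t = linSol μ₂ μ₁ 0 t ∧ φ₁ t = μ₂ * linSol μ₂ μ₁ 0 t - 0 * exp (μ₁ * t)) :
    ∃ t, k < φ t ∧ 0 < φ₁ t := by
  have hg := growth_propagates (d := φ) (d₁ := φ₁) (Δ := fun t => g (φ (t - τ))) (X := 0)
    (by linarith [B.one_lt_k]) hτ R.root₂ F.d1 F.d2 (fun t ht => B.le_mul ht)
    (fun t ht => by
      rw [(h t ht).1, (h t ht).2]
      have := (linSol_of_nonpos R.pos R.le ⟨le_rfl, R.pos.le⟩ ht).1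
      exact ⟨(exp_pos _).le.trans this, by linarith⟩)
  have hk := B.one_lt_k
  have ht : 0 ≤ k / μ₂ := div_nonneg (by linarith) R.pos.le
  have h1 := mul_exp_le_of_hasDerivAt (w := φ) (β := μ₂) ht (fun t _ => F.d1 t)
    (fun t _ => (hg t).2)
  rw [(h 0 le_rfl).1, linSol_zero_right, one_mul, sub_zero, mul_div_cancel₀ _ R.pos.ne'] at h1
  have h2 := add_one_le_exp k
  have h3 : k < φ (k / μ₂) := by linarith
  exact ⟨k / μ₂, h3, (mul_pos R.pos (by linarith)).trans_le (hg _).2⟩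

theorem Profile.nonneg_of_not (F : Profile g c τ φ φ₁) (hneg : ∀ t ≤ 0, 0 ≤ φ t)
    (hN : ∀ t, ¬ (φ t < 0 ∧ φ₁ t < 0)) (t : ℝ) : 0 ≤ φ t := by
  rcases le_total t 0 with ht | ht
  · exact hneg t ht
  · by_contra hcon
    push Not at hcon
    obtain ⟨s, -, h1, h2⟩ := exists_pos_deriv_pos (u := fun t => -φ t) (fun t => (F.d1 t).fun_neg)
      ht (by linarith [hneg 0 le_rfl]) (by linarith)
    exact hN s ⟨by linarith, by linarith⟩

theorem Profile.becomes_neg (F : Profile g c τ φ φ₁) (B : BirthProps g k p Q κ θ₁)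
    (R : CharRoots k c τ μ₂ μ₁) (hτ : 0 < τ)
    (h : ∀ t ≤ 0, φ t = linSol μ₂ μ₁ μ₂ t ∧ φ₁ t = μ₂ * linSol μ₂ μ₁ μ₂ t - μ₂ * exp (μ₁ * t)) :
    ∃ t, φ t < 0 ∧ φ₁ t < 0 := by
  by_contra hcon
  push Not at hcon
  have h0 : ∀ t, 0 ≤ φ t := F.nonneg_of_not (fun t ht => by
    rw [(h t ht).1]
    exact (exp_pos _).le.trans (linSol_of_nonpos R.pos R.le ⟨R.pos.le, le_rfl⟩ ht).1)
    (fun t ht => absurd ht.2 (not_lt.2 (hcon t ht.1)))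
  have key : ∀ n : ℕ, ∀ t ≤ n * τ, φ t = linSol μ₂ μ₁ μ₂ t ∧
      φ₁ t = μ₂ * linSol μ₂ μ₁ μ₂ t - μ₂ * exp (μ₁ * t) := by
    intro n
    induction n with
    | zero => simpa using h
    | succ n ih =>
      intro t ht
      push_cast at ht
      rcases le_total t (n * τ) with htn | htn
      · exact ih t htn
      have hg : ∀ s ∈ Icc (n * τ) t, g (φ (s - τ)) = k * linSol μ₂ μ₁ μ₂ (s - τ) := by
        intro s hs
        have e := (ih (s - τ) (by linarith [hs.2])).1
        have h1 := h0 (s - τ)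
        rw [e] at h1 ⊢
        exact B.lin _ h1 (linSol_le_one R.pos R.le _)
      obtain ⟨i1, i2⟩ := ih (n * τ) le_rfl
      have hup := forward_nonneg (a := c) zero_le_one
        (fun s (_ : s ∈ Icc (n * τ) t) => (F.d1 s).fun_sub (hasDerivAt_linSol μ₂ μ₁ μ₂ s))
        (fun s _ => (F.d2 s).fun_sub (hasDerivAt_linSol_deriv R μ₂ s))
        (fun s hs => by rw [hg s hs]; linarith) (by linarith) (by linarith) t ⟨htn, le_rfl⟩
      have hlo := forward_nonneg (a := c) zero_le_one
        (fun s (_ : s ∈ Icc (n * τ) t) => (hasDerivAt_linSol μ₂ μ₁ μ₂ s).fun_sub (F.d1 s))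
        (fun s _ => (hasDerivAt_linSol_deriv R μ₂ s).fun_sub (F.d2 s))
        (fun s hs => by rw [hg s hs]; linarith) (by linarith) (by linarith) t ⟨htn, le_rfl⟩
      constructor <;> linarith
  obtain ⟨n, hn⟩ := exists_nat_gt (2 / μ₂ / τ)
  rw [div_lt_iff₀ hτ] at hn
  have h1 := linSol_of_nonneg (b := μ₂) R.pos.le R.le (show 0 ≤ 2 / μ₂ from div_nonneg zero_le_two R.pos.le)
  rw [← (key n _ hn.le).1, mul_div_cancel₀ _ R.pos.ne'] at h1
  linarith [h0 (2 / μ₂), exp_pos (2:ℝ)]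

theorem exists_bounded_profile (B : BirthProps g k p Q κ θ₁) (R : CharRoots k c τ μ₂ μ₁)
    (hτ : 0 < τ) (hc : 0 < c) : ∃ b ∈ Icc 0 μ₂, ∃ φ φ₁ : ℝ → ℝ, Profile g c τ φ φ₁ ∧
      (∀ t ≤ 0, φ t = linSol μ₂ μ₁ b t) ∧ ∀ t, 0 ≤ φ t ∧ φ t ≤ k := by
  obtain ⟨φ, φ₁, hP, hI, hC⟩ := exists_family B R hτ hc
  let N : Set (Icc 0 μ₂) := ⋃ t, {b | φ b t < 0 ∧ φ₁ b t < 0}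
  let U : Set (Icc 0 μ₂) := ⋃ t, {b | k < φ b t ∧ 0 < φ₁ b t}
  have hC1 : ∀ t, Continuous fun b : Icc 0 μ₂ => φ b t := fun t => (hC t).1.domRestrict
  have hC2 : ∀ t, Continuous fun b : Icc 0 μ₂ => φ₁ b t := fun t => (hC t).2.domRestrict
  have hN : IsOpen N := isOpen_iUnion fun t =>
    (isOpen_lt (hC1 t) continuous_const).inter (isOpen_lt (hC2 t) continuous_const)
  have hU : IsOpen U := isOpen_iUnion fun t =>
    (isOpen_lt continuous_const (hC1 t)).inter (isOpen_lt continuous_const (hC2 t))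
  have hk := B.one_lt_k
  have hdisj : ¬ (N ∩ U).Nonempty := by
    rintro ⟨⟨b, hb⟩, h1, h2⟩
    obtain ⟨t₁, h3, h4⟩ := mem_iUnion.1 h1
    obtain ⟨t₂, h5, h6⟩ := mem_iUnion.1 h2
    simp only at h3 h4 h5 h6
    have F := hP b hb
    have hlo := forward_nonneg (a := c) (Y := max t₁ t₂) zero_le_one
      (fun s (_ : s ∈ Icc t₁ _) => (F.d1 s).fun_neg) (fun s _ => (F.d2 s).fun_neg)
      (fun s _ => by linarith [B.nonneg (φ b (s - τ))]) (by linarith) (by linarith)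
      (max t₁ t₂) ⟨le_max_left _ _, le_rfl⟩
    have hup := forward_nonneg (a := c) (Y := max t₁ t₂) zero_le_one
      (fun s (_ : s ∈ Icc t₂ _) => (F.d1 s).sub_const k) (fun s _ => F.d2 s)
      (fun s _ => by linarith [B.le_k (φ b (s - τ))]) (by linarith) (by linarith)
      (max t₁ t₂) ⟨le_max_right _ _, le_rfl⟩
    linarith
  have hmem0 : (0:ℝ) ∈ Icc 0 μ₂ := ⟨le_rfl, R.pos.le⟩
  have hmem1 : μ₂ ∈ Icc 0 μ₂ := ⟨R.pos.le, le_rfl⟩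
  have hUne : U.Nonempty := by
    obtain ⟨t, ht⟩ := (hP 0 hmem0).exceeds B R hτ (hI 0 hmem0)
    exact ⟨⟨0, hmem0⟩, mem_iUnion.2 ⟨t, ht⟩⟩
  have hNne : N.Nonempty := by
    obtain ⟨t, ht⟩ := (hP μ₂ hmem1).becomes_neg B R hτ (hI μ₂ hmem1)
    exact ⟨⟨μ₂, hmem1⟩, mem_iUnion.2 ⟨t, ht⟩⟩
  have hcov : N ∪ U ≠ univ := fun h => by
    have : PreconnectedSpace (Icc 0 μ₂) := Subtype.preconnectedSpace isPreconnected_Icc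
    exact hdisj (nonempty_inter hN hU h hNne hUne)
  obtain ⟨⟨b, hb⟩, hbn⟩ := (ne_univ_iff_exists_notMem _).1 hcov
  have hbN : ∀ t, ¬ (φ b t < 0 ∧ φ₁ b t < 0) := fun t ht =>
    hbn (Or.inl (mem_iUnion.2 ⟨t, ht⟩))
  have hbU : ∀ t, ¬ (k < φ b t ∧ 0 < φ₁ b t) := fun t ht =>
    hbn (Or.inr (mem_iUnion.2 ⟨t, ht⟩))
  have F := hP b hb
  have hl := fun t ht => linSol_of_nonpos R.pos R.le hb (t := t) ht
  refine ⟨b, hb, φ b, φ₁ b, F, fun t ht => (hI b hb t ht).1, fun t =>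
    ⟨F.nonneg_of_not (fun s hs => ?_) hbN t, ?_⟩⟩
  · rw [(hI b hb s hs).1]
    exact (exp_pos _).le.trans (hl s hs).1
  · have hle1 : ∀ s ≤ 0, φ b s ≤ 1 := fun s hs => by
      rw [(hI b hb s hs).1]
      exact (hl s hs).2.1
    rcases le_total t 0 with ht | ht
    · linarith [hle1 t ht]
    · by_contra hcon
      push Not at hcon
      obtain ⟨s, -, h1, h2⟩ := exists_pos_deriv_pos (u := fun t => φ b t - k)
        (fun t => (F.d1 t).sub_const k) ht (by linarith [hle1 0 le_rfl]) (by linarith)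
      exact hbU s ⟨by linarith, h2⟩

theorem Profile.pos_of_nonneg (F : Profile g c τ φ φ₁) (B : BirthProps g k p Q κ θ₁) (hτ : 0 < τ)
    (h0 : ∀ t, 0 ≤ φ t) (hneg : ∀ t ≤ 0, 0 < φ t) (t : ℝ) : 0 < φ t := by
  by_contra hcon
  push Not at hcon
  have ht : 0 ≤ t := by
    by_contra h
    push Not at h
    linarith [hneg t h.le]
  obtain ⟨a, ⟨ha, hau⟩, hmin⟩ := (isCompact_Icc.inter_right
    (isClosed_Iic.preimage F.continuous) : IsCompact (Icc 0 t ∩ φ ⁻¹' Iic 0)).exists_isLeast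
    ⟨t, right_mem_Icc.2 ht, hcon⟩
  simp only [mem_preimage, mem_Iic] at hau
  have hloc : IsLocalMin φ a := Eventually.of_forall fun s => hau.trans (h0 s)
  obtain ⟨h1, h2⟩ := hloc.second_deriv_nonneg F.d1 (F.d2 a)
  have h3 : 0 < φ (a - τ) := by
    rcases le_total (a - τ) 0 with h | h
    · exact hneg _ h
    · by_contra h'
      push Not at h'
      linarith [hmin ⟨⟨h, by linarith [ha.2]⟩, h'⟩]
  rw [h1] at h2
  linarith [B.pos _ h3]

theorem Profile.persists (F : Profile g c τ φ φ₁) (B : BirthProps g k p Q κ θ₁) (hτ : 0 < τ)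
    (hc : 0 < c) (h0 : ∀ t, 0 < φ t) (hk : ∀ t, φ t ≤ k) : ∃ y > 0, ∀ t ≥ 0, y ≤ φ t := by
  obtain ⟨z, -, hz⟩ := isCompact_Icc.exists_isMinOn (nonempty_Icc.2 hτ.le) F.continuous.continuousOn
  set y := min (φ z) 1 / 2 with hy
  have hm : 0 < min (φ z) 1 := lt_min (h0 z) one_pos
  have hy0 : 0 < y := by positivity
  have hy1 : y < 1 := by linarith [min_le_right (φ z) 1]
  have hyw : ∀ s ∈ Icc 0 τ, y < φ s := fun s hs => by
    have := hz hs
    simp only [mem_ofPred_eq] at this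
    linarith [min_le_left (φ z) 1]
  refine ⟨y, hy0, fun t ht => ?_⟩
  by_contra hcon
  push Not at hcon
  have htτ : τ ≤ t := by
    by_contra h
    push Not at h
    linarith [hyw t ⟨ht, h.le⟩]
  obtain ⟨r, hr, hr1, hr2⟩ := exists_pos_deriv_pos (u := fun t => y - φ t)
    (fun t => (F.d1 t).const_sub y) htτ (by linarith [hyw τ ⟨hτ.le, le_rfl⟩]) (by linarith)
  have hgrow : ∀ a x, φ a < y → φ a ≤ φ x → φ a < g (φ x) := by
    intro a x ha hx
    rcases le_total (φ x) 1 with h | h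
    · rw [B.lin _ (h0 x).le h]
      nlinarith [B.one_lt_k, h0 a, h0 x]
    · linarith [B.min_le h (hk x), B.lt_min, B.one_lt]
  have hlast : ∀ T ≥ r, ∀ s ∈ Icc 0 T, φ T ≤ φ s := by
    intro T hT
    obtain ⟨a, ha, hmin⟩ := (isCompact_Icc (a := (0:ℝ)) (b := T)).exists_isMinOn
      (nonempty_Icc.2 (by linarith [hr.1])) F.continuous.continuousOn
    have hmin' : ∀ s ∈ Icc 0 T, φ a ≤ φ s := fun s hs => hmin hs
    have har : φ a < y := by
      linarith [hmin' r ⟨by linarith [hr.1], hT⟩]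
    have haτ : τ < a := by
      by_contra h
      push Not at h
      linarith [hyw a ⟨ha.1, h⟩]
    rcases ha.2.eq_or_lt with h | h
    · subst h
      exact hmin'
    · have hloc : IsLocalMin φ a := by
        filter_upwards [Ioo_mem_nhds (show 0 < a by linarith) h] with s hs
        exact hmin' s ⟨hs.1.le, hs.2.le⟩
      obtain ⟨h1, h2⟩ := hloc.second_deriv_nonneg F.d1 (F.d2 a)
      rw [h1] at h2
      linarith [hgrow a (a - τ) har (hmin' _ ⟨by linarith, by linarith⟩)]
  have hd : ∀ T ≥ r, φ₁ T ≤ φ₁ r := by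
    intro T hT
    have := mul_exp_le_of_hasDerivAt (β := c) hT (fun t _ => (F.d2 t).fun_neg) (fun s hs => by
      have h1 := hlast s hs.1
      have h2 := hgrow s (s - τ) (by linarith [h1 r ⟨by linarith [hr.1], hs.1⟩])
        (h1 _ ⟨by linarith [hr.1, hs.1], by linarith⟩)
      linarith)
    have h2 : 1 ≤ exp (c * (T - r)) := one_le_exp (mul_nonneg hc.le (by linarith))
    nlinarith
  have hδ : 0 < -φ₁ r := hr2
  have hlen := div_pos (h0 r) hδ
  have := add_mul_le_of_hasDerivAt (f := fun t => -φ t) (m := -φ₁ r) (a := r)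
    (b := r + φ r / -φ₁ r) (by linarith) (fun t _ => (F.d1 t).fun_neg)
    (fun t ht => by linarith [hd t ht.1])
  rw [add_sub_cancel_left, mul_div_cancel₀ _ hδ.ne'] at this
  linarith [h0 (r + φ r / -φ₁ r)]

theorem Profile.eventually_ge (F : Profile g c τ φ φ₁) (h0 : ∀ t, 0 ≤ φ t) {D D' : ℝ}
    (hD : ∀ᶠ t in atTop, D ≤ g (φ t)) (hlt : D' < D) : ∀ᶠ t in atTop, D' ≤ φ t := by
  obtain ⟨T, hT⟩ := eventually_atTop.1 hD
  have := eventually_le_of_bounded (c := c) (a := T + τ) (C := D) (ε := D - D')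
    (fun t _ => (F.d1 t).const_sub D) (fun t _ => (F.d2 t).fun_neg)
    (fun t ht => by linarith [hT (t - τ) (by linarith)]) (fun t _ => by linarith [h0 t])
    (by linarith)
  filter_upwards [this] with t ht
  linarith

theorem Profile.eventually_le (F : Profile g c τ φ φ₁) (hk : ∀ t, φ t ≤ k) {D D' : ℝ}
    (hD : ∀ᶠ t in atTop, g (φ t) ≤ D) (hlt : D < D') : ∀ᶠ t in atTop, φ t ≤ D' := by
  obtain ⟨T, hT⟩ := eventually_atTop.1 hD
  have := eventually_le_of_bounded (c := c) (a := T + τ) (C := k - D) (ε := D' - D)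
    (fun t _ => (F.d1 t).sub_const D) (fun t _ => F.d2 t)
    (fun t ht => by linarith [hT (t - τ) (by linarith)]) (fun t _ => by linarith [hk t])
    (by linarith)
  filter_upwards [this] with t ht
  linarith

theorem Profile.eventually_right (F : Profile g c τ φ φ₁) (B : BirthProps g k p Q κ θ₁)
    (hk2 : 2 < k) (h0 : ∀ t, 0 < φ t) (hk : ∀ t, φ t ≤ k) {y : ℝ} (hy : 0 < y)
    (hφ : ∀ t ≥ 0, y ≤ φ t) : ∀ᶠ t in atTop, θ₁ ≤ φ t := by
  have hθ := B.one_lt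
  have key : ∀ n : ℕ, ∀ᶠ t in atTop, min (2 ^ n * y) θ₁ ≤ φ t := by
    intro n
    induction n with
    | zero =>
      filter_upwards [eventually_ge_atTop 0] with t ht
      exact (min_le_left _ _).trans (by simpa using hφ t ht)
    | succ n ih =>
      set x := min (2 ^ n * y) θ₁ with hx
      have hx0 : 0 < x := lt_min (by positivity) (by linarith)
      refine F.eventually_ge (fun t => (h0 t).le) (D := min (k * x) (Q - p * k)) ?_ ?_
      · filter_upwards [ih] with t ht
        rcases le_total (φ t) 1 with h | h
        · rw [B.lin _ (h0 t).le h]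
          exact (min_le_left _ _).trans (mul_le_mul_of_nonneg_left ht (by linarith))
        · exact (min_le_right _ _).trans (B.min_le h (hk t))
      · refine lt_min ?_ ((min_le_right _ _).trans_lt B.lt_min)
        have h1 : min (2 ^ (n + 1) * y) θ₁ ≤ 2 * x := by
          rcases min_choice (2 ^ n * y) θ₁ with h | h
          · rw [hx, h]
            exact (min_le_left _ _).trans (by rw [pow_succ]; linarith)
          · rw [hx, h]
            exact (min_le_right _ _).trans (by linarith)
        nlinarith
  obtain ⟨n, hn⟩ := pow_unbounded_of_one_lt (θ₁ / y) one_lt_two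
  rw [div_lt_iff₀ hy] at hn
  have := key n
  rwa [min_eq_right hn.le] at this

theorem Profile.tendsto_kappa (F : Profile g c τ φ φ₁) (B : BirthProps g k p Q κ θ₁)
    (h0 : ∀ t, 0 < φ t) (hk : ∀ t, φ t ≤ k) (hr : ∀ᶠ t in atTop, θ₁ ≤ φ t) :
    Tendsto φ atTop (𝓝 κ) := by
  have hp := B.p_pos
  have hp1 := B.p_lt
  have hk1 := B.one_lt_k
  have key : ∀ n : ℕ, ∀ᶠ t in atTop, |φ t - κ| ≤ ((1 + p) / 2) ^ n * k := by
    intro n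
    induction n with
    | zero =>
      refine Eventually.of_forall fun t => ?_
      rw [pow_zero, one_mul, abs_le]
      constructor <;> linarith [h0 t, hk t, B.kappa_lt, B.lt_kappa, B.one_lt]
    | succ n ih =>
      set A := ((1 + p) / 2) ^ n * k with hA
      have hA0 : 0 < A := by positivity
      have hA' : ((1 + p) / 2) ^ (n + 1) * k = (1 + p) / 2 * A := by rw [hA, pow_succ]; ring
      have hg : ∀ᶠ t in atTop, |g (φ t) - κ| ≤ p * A := by
        filter_upwards [ih, hr] with t ht htr
        have e : g (φ t) - κ = -(p * (φ t - κ)) := by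
          rw [B.right _ htr (hk t)]
          linear_combination -B.fixed
        rw [e, abs_neg, abs_mul, abs_of_pos hp]
        exact mul_le_mul_of_nonneg_left ht hp.le
      have h1 : p * A < (1 + p) / 2 * A := mul_lt_mul_of_pos_right (by linarith) hA0
      have hlo := F.eventually_ge (fun t => (h0 t).le) (D := κ - p * A)
        (D' := κ - (1 + p) / 2 * A)
        (hg.mono fun t ht => by linarith [(abs_le.1 ht).1]) (by linarith)
      have hup := F.eventually_le hk (D := κ + p * A) (D' := κ + (1 + p) / 2 * A)
        (hg.mono fun t ht => by linarith [(abs_le.1 ht).2]) (by linarith)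
      filter_upwards [hlo, hup] with t h2 h3
      rw [hA', abs_le]
      constructor <;> linarith
  rw [Metric.tendsto_nhds]
  intro ε hε
  obtain ⟨n, hn⟩ := exists_pow_lt_of_lt_one (show 0 < ε / k by positivity)
    (show (1 + p) / 2 < 1 by linarith)
  rw [lt_div_iff₀ (by linarith)] at hn
  filter_upwards [key n] with t ht
  rw [Real.dist_eq]
  exact ht.trans_lt hn

theorem exists_front (B : BirthProps g k p Q κ θ₁) (R : CharRoots k c τ μ₂ μ₁)
    (hτ : 0 < τ) (hc : 0 < c) (hk2 : 2 < k) : ∃ φ φ₁ : ℝ → ℝ, Front g κ c τ φ φ₁ := by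
  obtain ⟨b, hb, φ, φ₁, F, hI, hB⟩ := exists_bounded_profile B R hτ hc
  have hl := fun t ht => linSol_of_nonpos R.pos R.le hb (t := t) ht
  have hneg : ∀ t ≤ 0, 0 < φ t := fun t ht => by
    rw [hI t ht]
    exact (exp_pos _).trans_le (hl t ht).1
  have hpos := F.pos_of_nonneg B hτ (fun t => (hB t).1) hneg
  have hle := fun t => (hB t).2
  obtain ⟨y, hy, hφ⟩ := F.persists B hτ hc hpos hle
  refine ⟨φ, φ₁, F, hpos, ?_,
    F.tendsto_kappa B hpos hle (F.eventually_right B hk2 hpos hle hy hφ)⟩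
  have h1 : Tendsto (fun t : ℝ => exp (μ₂ * t) * (1 + b * -t)) atBot (𝓝 0) := by
    have e1 : Tendsto (fun t : ℝ => μ₂ * -t) atBot atTop :=
      tendsto_neg_atBot_atTop.const_mul_atTop R.pos
    have e2 := (tendsto_pow_mul_exp_neg_atTop_nhds_zero 0).comp e1
    have e3 := ((tendsto_pow_mul_exp_neg_atTop_nhds_zero 1).comp e1).const_mul (b / μ₂)
    have e4 := e2.add e3
    simp only [mul_zero, add_zero] at e4
    refine e4.congr fun t => ?_
    have h2 : -(μ₂ * -t) = μ₂ * t := by ring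
    have h3 : b / μ₂ * μ₂ = b := div_mul_cancel₀ _ R.pos.ne'
    simp only [Function.comp_apply, pow_zero, pow_one, h2]
    linear_combination (-t * exp (μ₂ * t)) * h3
  refine tendsto_of_tendsto_of_tendsto_of_le_of_le' tendsto_const_nhds h1
    (Eventually.of_forall fun t => (hpos t).le) ?_
  filter_upwards [eventually_le_atBot 0] with t ht
  rw [hI t ht]
  exact (hl t ht).2.2

end Shooting

theorem not_isLocalExtr_of_strictMonoOn {f : ℝ → ℝ} {s : Set ℝ} {x : ℝ} (h : StrictMonoOn f s)
    (hs : s ∈ 𝓝 x) : ¬ IsLocalMax f x ∧ ¬ IsLocalMin f x := by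
  have hx := mem_of_mem_nhds hs
  constructor <;> intro hm
  · obtain ⟨y, ⟨hy1, hy2⟩, hy3⟩ := (((hm.and hs).filter_mono nhdsWithin_le_nhds).and
      (self_mem_nhdsWithin (a := x) (s := Ioi x))).exists
    exact absurd hy1 (not_le.2 (h hx hy2 hy3))
  · obtain ⟨y, ⟨hy1, hy2⟩, hy3⟩ := (((hm.and hs).filter_mono nhdsWithin_le_nhds).and
      (self_mem_nhdsWithin (a := x) (s := Iio x))).exists
    exact absurd hy1 (not_le.2 (h hy2 hx hy3))

section Model

/-- The birth function: linear, steeply decreasing, slowly decreasing, exponential tail. -/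
def birth (k p Q θ₁ x : ℝ) : ℝ :=
  if x ≤ 0 then 0 else if x ≤ 1 then k * x
  else if x ≤ θ₁ then Q - p * x + (k + p - Q) / (θ₁ - 1) * (θ₁ - x)
  else if x ≤ k then Q - p * x else (Q - p * k) * exp (k - x)

variable {k p Q κ θ₁ : ℝ}

theorem birth_lin {x : ℝ} (h0 : 0 ≤ x) (h1 : x ≤ 1) : birth k p Q θ₁ x = k * x := by
  rcases h0.eq_or_lt with h | h
  · simp [birth, ← h]
  · simp [birth, not_le.2 h, h1]

theorem birth_mid {x : ℝ} (hθ : 1 < θ₁) (h1 : 1 ≤ x) (h2 : x ≤ θ₁) :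
    birth k p Q θ₁ x = Q - p * x + (k + p - Q) / (θ₁ - 1) * (θ₁ - x) := by
  rcases h1.eq_or_lt with h | h
  · rw [← h, birth_lin zero_le_one le_rfl, div_mul_cancel₀ _ (by linarith)]
    ring
  · simp [birth, not_le.2 h, not_le.2 (zero_lt_one.trans h), h2]

theorem birth_right {x : ℝ} (hθ : 1 < θ₁) (h1 : θ₁ ≤ x) (h2 : x ≤ k) :
    birth k p Q θ₁ x = Q - p * x := by
  rcases h1.eq_or_lt with h | h
  · rw [← h, birth_mid hθ hθ.le le_rfl]
    ring
  · simp [birth, not_le.2 h, not_le.2 (hθ.trans h), not_le.2 (zero_lt_one.trans (hθ.trans h)), h2]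

theorem birth_tail {x : ℝ} (hθ : 1 < θ₁) (hk : θ₁ < k) (h : k ≤ x) :
    birth k p Q θ₁ x = (Q - p * k) * exp (k - x) := by
  rcases h.eq_or_lt with h | h
  · rw [← h, birth_right hθ hk.le le_rfl, sub_self, exp_zero, mul_one]
  · have h1 := hk.trans h
    simp [birth, not_le.2 h, not_le.2 h1, not_le.2 (hθ.trans h1),
      not_le.2 (zero_lt_one.trans (hθ.trans h1))]

theorem continuous_birth (hθ : 1 < θ₁) (hk : θ₁ < k) : Continuous (birth k p Q θ₁) := by
  unfold birth
  refine Continuous.if_le continuous_const (Continuous.if_le (by fun_prop)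
    (Continuous.if_le (by fun_prop) (Continuous.if_le (by fun_prop) (by fun_prop)
      continuous_id continuous_const fun x hx => ?_) continuous_id continuous_const fun x hx => ?_)
    continuous_id continuous_const fun x hx => ?_) continuous_id continuous_const fun x hx => ?_
  · rw [hx, sub_self, exp_zero, mul_one]
  · rw [hx, if_pos hk.le, sub_self, mul_zero, add_zero]
  · rw [hx, if_pos hθ.le, div_mul_cancel₀ _ (by linarith)]
    ring
  · rw [hx]; simp

theorem strictAntiOn_birth (hθ : 1 < θ₁) (hk : θ₁ < k) (hp : 0 < p) (hQ : Q < k + p)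
    (hm : 0 < Q - p * k) : StrictAntiOn (birth k p Q θ₁) (Ici 1) := by
  have h1 : StrictAntiOn (birth k p Q θ₁) (Icc 1 θ₁) := by
    intro x hx y hy hxy
    rw [birth_mid hθ hx.1 hx.2, birth_mid hθ hy.1 hy.2]
    have : 0 < (k + p - Q) / (θ₁ - 1) := div_pos (by linarith) (by linarith)
    nlinarith
  have h2 : StrictAntiOn (birth k p Q θ₁) (Icc θ₁ k) := by
    intro x hx y hy hxy
    rw [birth_right hθ hx.1 hx.2, birth_right hθ hy.1 hy.2]
    nlinarith
  have h3 : StrictAntiOn (birth k p Q θ₁) (Ici k) := by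
    intro x hx y hy hxy
    rw [birth_tail hθ hk hx, birth_tail hθ hk hy]
    exact mul_lt_mul_of_pos_left (exp_lt_exp.2 (by linarith)) hm
  have h4 := (h1.union h2 (isGreatest_Icc hθ.le) (isLeast_Icc hk.le))
  rw [Icc_union_Icc_eq_Icc hθ.le hk.le] at h4
  have h5 := h4.union h3 (isGreatest_Icc (hθ.trans hk).le) isLeast_Ici
  rwa [Icc_union_Ici_eq_Ici (hθ.trans hk).le] at h5

theorem birthProps_birth (hθ : 1 < θ₁) (hθκ : θ₁ < κ) (hκ : κ < k) (hfix : κ * (1 + p) = Q)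
    (hp : 0 < p) (hp1 : p < 1) (hQ : Q < k + p) (hm : θ₁ < Q - p * k) :
    BirthProps (birth k p Q θ₁) k p Q κ θ₁ := by
  have hanti := strictAntiOn_birth hθ (hθκ.trans hκ) hp hQ (by linarith)
  have hone : birth k p Q θ₁ 1 = k := by rw [birth_lin zero_le_one le_rfl, mul_one]
  have hzero : ∀ x ≤ 0, birth k p Q θ₁ x = 0 := fun x hx => by simp [birth, hx]
  have hge : ∀ x, 1 ≤ x → birth k p Q θ₁ x ≤ k := fun x hx => by
    exact (hanti.antitoneOn self_mem_Ici hx hx).trans_eq hone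
  have hmid : ∀ x, 1 ≤ x → x ≤ θ₁ → Q - p * x ≤ birth k p Q θ₁ x := fun x h1 h2 => by
    rw [birth_mid hθ h1 h2]
    have : 0 < (k + p - Q) / (θ₁ - 1) := div_pos (by linarith) (by linarith)
    nlinarith
  have hpos : ∀ x, 0 < x → 0 < birth k p Q θ₁ x := by
    intro x hx
    rcases le_total x k with h | h
    · rcases le_total x 1 with h1 | h1
      · rw [birth_lin hx.le h1]
        exact mul_pos (by linarith) hx
      · have := mul_le_mul_of_nonneg_left h hp.le
        rcases le_total x θ₁ with h2 | h2
        · linarith [hmid x h1 h2]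
        · rw [birth_right hθ h2 h]
          linarith
    · rw [birth_tail hθ (hθκ.trans hκ) h]
      exact mul_pos (by linarith) (exp_pos _)
  have hlow : ∀ y ≤ 1, k * y ≤ birth k p Q θ₁ y := by
    intro y hy
    rcases le_total y 0 with h | h
    · rw [hzero y h]
      nlinarith
    · rw [birth_lin h hy]
  refine ⟨continuous_birth hθ (hθκ.trans hκ), hzero, fun x => birth_lin, hmid, fun x => birth_right hθ,
    fun x => ?_, hpos, fun x y hyx => ?_, hfix, hθ, hθκ, hκ, hm, hp, hp1⟩
  · rcases le_total x 1 with h | h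
    · rcases le_total x 0 with h0 | h0
      · rw [hzero x h0]
        linarith
      · rw [birth_lin h0 h]
        nlinarith
    · exact hge x h
  · rcases le_total y 1 with hy | hy
    · have := hlow y hy
      rcases le_total x 1 with hx | hx
      · rcases le_total x 0 with h0 | h0
        · rw [hzero x h0, hzero y (hyx.trans h0)]
          nlinarith
        · rw [birth_lin h0 hx]
          linarith
      · nlinarith [hge x hx]
    · have := hanti.antitoneOn hy (hy.trans hyx) hyx
      nlinarith

end Model

section Hypotheses
variable {g : ℝ → ℝ} {k p Q κ θ₁ : ℝ}

theorem BirthProps.umHyp (B : BirthProps g k p Q κ θ₁) (hanti : StrictAntiOn g (Ici 1)) :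
    UMHyp g 1 κ k (-p) := by
  have hk := B.one_lt_k
  have hκ0 : 1 < κ := B.one_lt.trans B.lt_kappa
  have hp := B.p_pos
  have hone : g 1 = k := by rw [B.lin 1 zero_le_one le_rfl, mul_one]
  have hmono : StrictMonoOn g (Icc 0 1) := by
    intro x hx y hy hxy
    rw [B.lin x hx.1 hx.2, B.lin y hy.1 hy.2]
    exact mul_lt_mul_of_pos_left hxy (by linarith)
  have hmax : ∀ x, g x ≤ g 1 := fun x => hone ▸ B.le_k x
  have hgκ : g κ = κ := by
    rw [B.right κ B.lt_kappa.le B.kappa_lt.le]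
    linear_combination -B.fixed
  have habove : ∀ x, 0 < x → x < κ → x < g x := by
    intro x h0 hx
    rcases le_total x 1 with h | h
    · rw [B.lin x h0.le h]
      nlinarith
    · have := B.right_ge h (hx.le.trans B.kappa_lt.le)
      nlinarith [B.fixed]
  have hbelow : ∀ x, κ < x → g x < x := by
    intro x hx
    rcases le_or_gt x k with h | h
    · rw [B.right x (B.lt_kappa.trans hx).le h]
      nlinarith [B.fixed]
    · exact (B.le_k x).trans_lt h
  refine ⟨B.cont.continuousOn, fun x _ => B.nonneg x, one_pos, by linarith, fun x hx => ⟨?_, ?_⟩,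
    fun x _ => hmax x, fun x hx => ⟨fun h => ?_, ?_⟩, ?_, ?_, hk, by linarith, habove, hbelow⟩
  · intro h
    by_contra hne
    rcases lt_or_gt_of_ne hne with h1 | h1
    · obtain ⟨h2, h3⟩ := not_isLocalExtr_of_strictMonoOn hmono (Icc_mem_nhds hx h1)
      exact h.elim h2 h3
    · have := not_isLocalExtr_of_strictMonoOn hanti.neg (Ici_mem_nhds h1)
      exact h.elim (fun h => this.2 h.neg) (fun h => this.1 h.neg)
  · rintro rfl
    exact Or.inl (Eventually.of_forall hmax)
  · by_contra hne
    push Not at hne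
    have h0 : 0 < x := lt_of_le_of_ne hx (Ne.symm hne.1)
    rcases lt_or_gt_of_ne hne.2 with h1 | h1
    · exact (habove x h0 h1).ne' h
    · exact (hbelow x h1).ne h
  · rintro (rfl | rfl)
    · exact B.zero 0 le_rfl
    · exact hgκ
  · have h1 : HasDerivWithinAt (fun x => k * x) k (Ici 0) 0 := by
      simpa using ((hasDerivAt_id (0:ℝ)).const_mul k).hasDerivWithinAt
    refine h1.congr_of_eventuallyEq ?_ (by rw [B.zero 0 le_rfl, mul_zero])
    filter_upwards [self_mem_nhdsWithin, nhdsWithin_le_nhds (Iic_mem_nhds one_pos)] with x h2 h3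
    exact B.lin x h2 h3
  · have h1 : HasDerivAt (fun x => Q - p * x) (-p) κ := by
      simpa using ((hasDerivAt_id κ).const_mul p).const_sub Q
    refine (h1.congr_of_eventuallyEq ?_).hasDerivWithinAt
    filter_upwards [Icc_mem_nhds B.lt_kappa B.kappa_lt] with x h2
    exact B.right x h2.1 h2.2

theorem BirthProps.fcHyp (B : BirthProps g k p Q κ θ₁) : FCHyp g 1 κ := by
  have hone : g 1 = k := by rw [B.lin 1 zero_le_one le_rfl, mul_one]
  have hk : g k = Q - p * k := B.right k (B.lt_kappa.trans B.kappa_lt).le le_rfl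
  intro x hx hne
  rw [hone, hk] at hx
  rw [B.right x (B.lt_min.le.trans hx.1) hx.2]
  have e : (Q - p * x - κ) * (x - κ) = -(p * (x - κ) ^ 2) := by
    linear_combination -(x - κ) * B.fixed
  rw [e]
  have : 0 < (x - κ) ^ 2 := by
    have := sub_ne_zero.2 hne
    positivity
  nlinarith [B.p_pos]

end Hypotheses

section Translation
variable {g : ℝ → ℝ} {k p Q κ θ₁ c : ℝ} {φ φ₁ : ℝ → ℝ}

theorem Wavefront.front (W : Wavefront g κ c 1 φ) : Front g κ c c φ (deriv φ) := by
  refine ⟨⟨fun t => (W.smooth.differentiable two_ne_zero t).hasDerivAt, fun t => ?_⟩, W.pos,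
    W.lim_bot, W.lim_top⟩
  have h1 := (W.smooth.differentiable_deriv_two t).hasDerivAt
  refine h1.congr_deriv ?_
  have := W.eqn t
  rw [mul_one] at this
  linarith

theorem Front.wavefront (F : Front g κ c c φ φ₁) (hg : Continuous g) : Wavefront g κ c 1 φ := by
  have e1 : deriv φ = φ₁ := funext fun t => (F.d1 t).deriv
  have e2 : deriv φ₁ = fun t => c * φ₁ t + φ t - g (φ (t - c)) := funext fun t => (F.d2 t).deriv
  have hc := F.continuous
  have hc1 := F.continuous₁
  refine ⟨?_, F.pos, fun t => ?_, F.bot, F.top⟩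
  · rw [show (2 : WithTop ℕ∞) = 1 + 1 from rfl, contDiff_succ_iff_deriv]
    refine ⟨fun t => (F.d1 t).differentiableAt, by simp, ?_⟩
    rw [e1, contDiff_one_iff_deriv]
    refine ⟨fun t => (F.d2 t).differentiableAt, ?_⟩
    rw [e2]
    fun_prop
  · rw [e1, e2, mul_one]
    ring

theorem Front.slowlyOscillating {η μ₂ μ₁ : ℝ} (F : Front g κ c c φ (deriv φ))
    (B : BirthProps g k p Q κ θ₁) (R : CharRoots k c c μ₂ μ₁) (hc : 0 < c) (hη : 0 < η)
    (hδ : ∀ x ≥ 0, η * (c + 2 * x + η) ≤ p * exp (x * c) + 1 - c * x - x ^ 2) :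
    SlowlyOscillating φ κ c 1 := by
  have hbelow : ∀ T : ℝ, ∃ t ≥ T, φ t < κ := fun T => by
    obtain ⟨t, ht, h⟩ := F.not_one_sided B hc hc hη hδ (Or.inl rfl) T
    exact ⟨t, ht, by linarith⟩
  have habove : ∀ T : ℝ, ∃ t ≥ T, κ < φ t := fun T => by
    obtain ⟨t, ht, h⟩ := F.not_one_sided B hc hc hη hδ (Or.inr rfl) T
    exact ⟨t, ht, by linarith⟩
  refine ⟨fun T => ?_, habove, hbelow, ?_⟩
  · obtain ⟨x, hx, hx'⟩ := hbelow T
    obtain ⟨y, hy, hy'⟩ := habove T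
    obtain ⟨t, ht, h⟩ := (isPreconnected_Ici (a := T)).intermediate_value hx hy
      F.continuous.continuousOn ⟨hx'.le, hy'.le⟩
    exact ⟨t, ht, h⟩
  obtain ⟨a, ha⟩ := F.window_changes_sign B hc hc hη hδ
  have hbar : ∀ t, ∀ s ≤ 0, phibar φ κ t s = φ (t + s) - κ := fun t s hs => by
    simp [phibar, (show s ≠ 1 by linarith)]
  have hbar1 : ∀ t, phibar φ κ t 1 = deriv φ t := fun t => by simp [phibar]
  refine ⟨a, fun t ht => ⟨?_, ?_⟩⟩
  · by_contra hcon
    have hlt : ∀ u ∈ sigK c 1, ∀ v ∈ sigK c 1, u < v →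
        0 ≤ phibar φ κ t u * phibar φ κ t v := by
      intro u hu v hv huv
      by_contra h
      push Not at h
      refine hcon ⟨![u, v], ?_, ?_, ?_⟩
      · intro i j hij
        fin_cases i <;> fin_cases j <;> simp_all
      · intro i
        fin_cases i <;> simpa
      · intro i
        fin_cases i
        simpa using h
    have hpair : ∀ u ∈ sigK c 1, ∀ v ∈ sigK c 1, 0 ≤ phibar φ κ t u * phibar φ κ t v := by
      intro u hu v hv
      rcases lt_trichotomy u v with h | h | h
      · exact hlt u hu v hv h
      · rw [h]
        exact mul_self_nonneg _
      · rw [mul_comm]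
        exact hlt v hv u hu h
    have hmem : ∀ s ∈ Icc (t - c) t, s - t ∈ sigK c 1 := fun s hs =>
      Or.inl ⟨by linarith [hs.1], by linarith [hs.2]⟩
    have hval : ∀ s ∈ Icc (t - c) t, phibar φ κ t (s - t) = φ s - κ := fun s hs => by
      rw [hbar t _ (by linarith [hs.2]), add_sub_cancel]
    have hone : (1:ℝ) ∈ sigK c 1 := Or.inr rfl
    have key : ∀ s₀ ∈ Icc (t - c) t, ∀ σ : ℝ, (σ = 1 ∨ σ = -1) → ¬ 0 < σ * (φ s₀ - κ) := by
      intro s₀ hs₀ σ hσ hpos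
      have hσ2 : σ * σ = 1 := by rcases hσ with rfl | rfl <;> norm_num
      have hall : ∀ v ∈ sigK c 1, 0 ≤ σ * phibar φ κ t v := by
        intro v hv
        have h := hpair _ (hmem s₀ hs₀) v hv
        rw [hval s₀ hs₀] at h
        have e : (φ s₀ - κ) * phibar φ κ t v = (σ * (φ s₀ - κ)) * (σ * phibar φ κ t v) := by
          linear_combination -((φ s₀ - κ) * phibar φ κ t v) * hσ2
        rw [e] at h
        exact nonneg_of_mul_nonneg_right h hpos
      have h1 := ha t ht σ hσ fun s hs => by
        rw [← hval s hs]
        exact hall _ (hmem s hs)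
      have h2 := hall 1 hone
      rw [hbar1] at h2
      linarith
    have hz : ∀ s ∈ Icc (t - c) t, φ s - κ = 0 := fun s hs => by
      have h1 := key s hs 1 (Or.inl rfl)
      have h2 := key s hs (-1) (Or.inr rfl)
      linarith
    have h1 := ha t ht 1 (Or.inl rfl) fun s hs => by rw [hz s hs, mul_zero]
    have h2 := ha t ht (-1) (Or.inr rfl) fun s hs => by rw [hz s hs, mul_zero]
    linarith
  · rintro ⟨x, hx, hmem, hsign⟩
    have H := F.extremumRule B R hc
    obtain ⟨X, hX⟩ := eventually_atBot.1 (F.bot.eventually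
      (gt_mem_nhds (show 0 < κ by linarith [B.lt_kappa, B.one_lt])))
    have hneg : ∀ s ≤ X, φ s - κ < 0 := fun s hs => by linarith [hX s hs]
    have hcont : Continuous fun s => φ s - κ := F.continuous.sub continuous_const
    have h01 : x 0 < x 1 := hx (by decide)
    have h12 : x 1 < x 2 := hx (by decide)
    have h23 : x 2 < x 3 := hx (by decide)
    have hle1 : ∀ i, x i ≤ 1 := fun i => by
      rcases hmem i with h | h
      · exact h.2.trans zero_le_one
      · exact (mem_singleton_iff.1 h).le
    have hin : ∀ i, x i < 1 → x i ∈ Icc (-c) 0 := fun i hi => by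
      rcases hmem i with h | h
      · rwa [mul_one] at h
      · exact absurd (mem_singleton_iff.1 h) hi.ne
    have m0 := hin 0 (by linarith [hle1 3])
    have m1 := hin 1 (by linarith [hle1 3])
    have m2 := hin 2 (by linarith [hle1 3])
    have s0 : phibar φ κ t (x 0) * phibar φ κ t (x 1) < 0 := hsign 0
    have s1 : phibar φ κ t (x 1) * phibar φ κ t (x 2) < 0 := hsign 1
    have s2 : phibar φ κ t (x 2) * phibar φ κ t (x 3) < 0 := hsign 2
    rw [hbar t _ m0.2, hbar t _ m1.2] at s0
    rw [hbar t _ m1.2, hbar t _ m2.2] at s1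
    rw [hbar t _ m2.2] at s2
    have hσ : ∃ σ : ℝ, (σ = 1 ∨ σ = -1) ∧ 0 < σ * (φ (t + x 0) - κ) ∧
        σ * (φ (t + x 1) - κ) < 0 ∧ 0 < σ * (φ (t + x 2) - κ) ∧ σ * phibar φ κ t (x 3) < 0 := by
      rcases mul_neg_iff.1 s0 with ⟨p0, p1⟩ | ⟨p0, p1⟩
      · have p2 := pos_of_mul_neg_right s1 p1.le
        have p3 := neg_of_mul_neg_right s2 p2.le
        exact ⟨1, Or.inl rfl, by linarith, by linarith, by linarith, by linarith⟩
      · have p2 := neg_of_mul_neg_right s1 p1.le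
        have p3 := pos_of_mul_neg_right s2 p2.le
        exact ⟨-1, Or.inr rfl, by linarith, by linarith, by linarith, by linarith⟩
    obtain ⟨σ, hσ, p0, p1, p2, p3⟩ := hσ
    rcases (hle1 3).eq_or_lt with h3 | h3
    · rw [h3, hbar1] at p3
      exact H.no_pattern_slope hc hcont hneg hσ (s₀ := t + x 0) (s₁ := t + x 1) (s₂ := t + x 2)
        (by linarith) (by linarith) (by linarith [m2.2]) (by linarith [m0.1]) p0 p1 p2
        ((F.d1 t).sub_const κ) p3
    · have m3 := hin 3 h3
      rw [hbar t _ m3.2] at p3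
      exact H.no_pattern hc hcont hneg hσ (x₀ := t + x 0) (x₁ := t + x 1) (x₂ := t + x 2)
        (x₃ := t + x 3) (by linarith) (by linarith) (by linarith) (by linarith [m0.1, m3.2])
        p0 p1 p2 p3

theorem Front.nonmonotone_evMonotone (F : Front g κ c c φ φ₁)
    (h : ∃ T, ∀ t ≥ T, κ < φ t ∧ φ₁ t ≤ 0) : (¬ Monotone φ ∧ ¬ Antitone φ) ∧ EvMonotone φ := by
  obtain ⟨T, hT⟩ := h
  refine ⟨⟨fun hm => ?_, fun hm => ?_⟩, T, Or.inr fun x hx y _ hxy => ?_⟩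
  · have := ge_of_tendsto F.top (b := φ T) (by
      filter_upwards [eventually_ge_atTop T] with t ht
      exact hm ht)
    linarith [(hT T le_rfl).1]
  · have := ge_of_tendsto F.bot (b := φ 0) (by
      filter_upwards [eventually_le_atBot 0] with t ht
      exact hm ht)
    linarith [F.pos 0]
  · have := le_of_hasDerivAt_nonneg (f := fun t => -φ t) hxy (fun t _ => (F.d1 t).fun_neg)
      (fun t ht => by linarith [(hT t (hx.out.trans ht.1)).2])
    linarith

end Translation

/-- Main Theorem: there exist a piecewise linear unimodal birth function
`g` of the form (DG) satisfying (UM) and (FC) and speeds `0 < c_* < c^*` such that: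
(a) wavefronts with speed `c` exist (uniquely up to translation) exactly for `c ≥ c_*`;
(b) for `c ∈ [c_*, c^*]` the wavefront is non-monotone but eventually monotone;
(c) for `c > c^*` the wavefront slowly oscillates about `κ`. -/
theorem stmt14 :
    ∃ (g : ℝ → ℝ) (k₁ k₂ k₃ θ θ₁ q₂ q₃ κ h cstar cup : ℝ),
      DGHyp g k₁ k₂ k₃ θ θ₁ q₂ q₃ κ ∧
      UMHyp g θ κ k₁ k₃ ∧
      FCHyp g θ κ ∧
      0 < h ∧ 0 < cstar ∧ cstar < cup ∧
      (∀ c ≥ cstar,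
        (∃ φ : ℝ → ℝ, Wavefront g κ c h φ) ∧
        (∀ φ₁ φ₂ : ℝ → ℝ, Wavefront g κ c h φ₁ → Wavefront g κ c h φ₂ →
          ∃ s : ℝ, ∀ t, φ₂ t = φ₁ (t + s))) ∧
      (∀ c : ℝ, 0 < c → c < cstar → ¬ ∃ φ : ℝ → ℝ, Wavefront g κ c h φ) ∧
      (∀ c ∈ Icc cstar cup, ∀ φ : ℝ → ℝ, Wavefront g κ c h φ →
        (¬ Monotone φ ∧ ¬ Antitone φ) ∧ EvMonotone φ) ∧
      (∀ c : ℝ, cup < c → ∀ φ : ℝ → ℝ, Wavefront g κ c h φ →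
        SlowlyOscillating φ κ c h) := by
  obtain ⟨p, hp⟩ : ∃ p, p = 5 / 4 * exp (-2) := ⟨_, rfl⟩
  have he1 := exp_one_gt_d9
  have he2 := exp_one_lt_d9
  have hk3 : exp 3 = exp 1 ^ 3 := by rw [← exp_nat_mul]; norm_num
  have hp2 : p * exp 1 ^ 2 = 5 / 4 := by
    rw [hp, mul_assoc, ← exp_nat_mul, ← exp_add]; norm_num
  have hk : 20 < exp 3 := by
    rw [hk3]
    have : (2.718 : ℝ) ^ 3 ≤ exp 1 ^ 3 := pow_le_pow_left₀ (by norm_num) (by linarith) 3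
    linarith
  have hpk : p * exp 3 = 5 / 4 * exp 1 := by
    rw [hk3]
    linear_combination exp 1 * hp2
  have hp0 : 0 < p := by rw [hp]; positivity
  have hp1 : p < 1 / 5 := by nlinarith
  obtain ⟨κ, hκ⟩ : ∃ κ, κ = 9 / 2 / (1 + p) := ⟨_, rfl⟩
  have hfix : κ * (1 + p) = 9 / 2 := by rw [hκ, div_mul_cancel₀ _ (by linarith)]
  have hκ1 : 21 / 20 < κ := by nlinarith
  have hκ2 : κ < 5 := by nlinarith
  set g := birth (exp 3) p (9 / 2) (21 / 20) with hg
  have hθ : (1:ℝ) < 21 / 20 := by norm_num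
  have B : BirthProps g (exp 3) p (9 / 2) κ (21 / 20) :=
    birthProps_birth hθ hκ1 (by linarith) hfix hp0 (by linarith) (by linarith) (by linarith)
  have hone : g 1 = exp 3 := by rw [B.lin 1 zero_le_one le_rfl, mul_one]
  have hsq : ∀ c : ℝ, √3 ≤ c → 0 < c ∧ 3 ≤ c ^ 2 := fun c hc => by
    have h3 : (0:ℝ) < √3 := by positivity
    have h4 := sq_sqrt (show (0:ℝ) ≤ 3 by norm_num)
    exact ⟨h3.trans_le hc, by nlinarith⟩
  have hs4 : √3 < 4 := by
    rw [sqrt_lt' (by norm_num)]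
    norm_num
  have hM : 0 < (exp 3 + p - 9 / 2) / (21 / 20 - 1) := div_pos (by linarith) (by norm_num)
  refine ⟨g, exp 3, -p - (exp 3 + p - 9 / 2) / (21 / 20 - 1), -p, 1, 21 / 20,
    9 / 2 + (exp 3 + p - 9 / 2) / (21 / 20 - 1) * (21 / 20), 9 / 2, κ, 1, √3, 4,
    ⟨one_pos, hθ, hκ1, by rw [hone]; linarith, by linarith, by linarith, by linarith,
      B.lin, fun x h1 h2 => ?_, fun x h1 h2 => ?_, by ring⟩,
    B.umHyp (strictAntiOn_birth hθ (by linarith) hp0 (by linarith) (by linarith)), B.fcHyp,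
    one_pos, by positivity, hs4, fun c hc => ?_, ?_, ?_, ?_⟩
  · rw [hg, birth_mid hθ h1 h2]
    ring
  · rw [B.right x h1.le (hone ▸ h2)]
    ring
  · obtain ⟨hc0, hc3⟩ := hsq c hc
    obtain ⟨μ₂, μ₁, R, -⟩ := exists_charRoots hc0 hc3
    refine ⟨?_, fun φ ψ hφ hψ => hφ.front.unique hψ.front B R hc0⟩
    obtain ⟨φ, φ₁, F⟩ := exists_front B R hc0 hc0 (by linarith)
    exact ⟨φ, F.wavefront B.cont⟩
  · rintro c hc hlt ⟨φ, W⟩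
    obtain ⟨T, hT⟩ := W.front.exists_linear
    obtain ⟨z, -, hz, -⟩ := W.front.exists_rate B hc (T := T)
      (fun t ht => B.lin _ (W.pos _).le (hT _ (by linarith)))
    have hc3 : c ^ 2 < 3 := by
      rwa [lt_sqrt hc.le] at hlt
    linarith [charFun_pos hc3 z]
  · intro c hc φ W
    obtain ⟨hc0, hc3⟩ := hsq c hc.1
    obtain ⟨μ₂, μ₁, R, hμ⟩ := exists_charRoots hc0 hc3
    obtain ⟨l, ν, hν, hl, hrl, hrν, hsl⟩ := exists_kappaRoots hc0 hc3 (by nlinarith [hc.2]) hp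
    have hl0 : l < 0 := by nlinarith
    refine W.front.nonmonotone_evMonotone
      (W.front.eventually_above B R hc0 hl0 hν hrl hrν hsl ?_)
    refine lt_of_mul_lt_mul_right ?_ hc0.le
    nlinarith
  · intro c hc φ W
    obtain ⟨hc0, hc3⟩ := hsq c (hs4.trans hc).le
    obtain ⟨μ₂, μ₁, R, -⟩ := exists_charRoots hc0 hc3
    obtain ⟨η, hη, hδ⟩ := exists_gap hc hp
    exact W.front.slowlyOscillating B R hc0 hη hδ

end
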